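/- For every positive integer t there exists an integer c_t such that every finite simple (C4, diamond, theta, pyramid, prism, even wheel)-free graph G with clique number ω(G) ≤ t satisfies tw(G) ≤ c_t, where tw denotes treewidth. -/

import Mathlib

open SimpleGraph

namespace Paper

variable {V : Type*}

/-- `G` contains an induced subgraph isomorphic to `H`. -/
def ContainsInduced {W : Type*} (G : SimpleGraph V) (H : SimpleGraph W) : Prop :=
  ∃ S : Set V, Nonempty (G.induce S ≃g H)

/-- `G` is `H`-free: no induced subgraph of `G` is isomorphic to `H`. -/
def Free {W : Type*} (G : SimpleGraph V) (H : SimpleGraph W) : Prop :=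
  ¬ ContainsInduced G H

/-- The diamond: `K₄` minus an edge. -/
def diamond : SimpleGraph (Fin 4) :=
  (⊤ : SimpleGraph (Fin 4)).deleteEdges {s(0, 1)}

/-- `S` induces a hole (an induced cycle of length at least 4) in `G`. -/
def IsHoleSet (G : SimpleGraph V) (S : Set V) : Prop :=
  ∃ n : ℕ, 4 ≤ n ∧ Nonempty (G.induce S ≃g cycleGraph n)

/-- `G` contains an even hole. -/
def HasEvenHole (G : SimpleGraph V) : Prop :=
  ∃ S : Set V, ∃ n : ℕ, 4 ≤ n ∧ Even n ∧ Nonempty (G.induce S ≃g cycleGraph n)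

/-- The union of the vertex sets of two walks induces a hole in `G`. -/
def PairHole (G : SimpleGraph V) {a b c d : V} (P : G.Walk a b) (Q : G.Walk c d) : Prop :=
  IsHoleSet G {v | v ∈ P.support ∨ v ∈ Q.support}

/-- `G` contains a theta. -/
def HasTheta (G : SimpleGraph V) : Prop :=
  ∃ (a b : V) (P₁ P₂ P₃ : G.Walk a b),
    a ≠ b ∧ ¬ G.Adj a b ∧
    P₁.IsPath ∧ P₂.IsPath ∧ P₃.IsPath ∧
    PairHole G P₁ P₂ ∧ PairHole G P₁ P₃ ∧ PairHole G P₂ P₃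

/-- `G` contains a pyramid. -/
def HasPyramid (G : SimpleGraph V) : Prop :=
  ∃ (a b₁ b₂ b₃ : V) (P₁ : G.Walk a b₁) (P₂ : G.Walk a b₂) (P₃ : G.Walk a b₃),
    G.Adj b₁ b₂ ∧ G.Adj b₁ b₃ ∧ G.Adj b₂ b₃ ∧
    a ≠ b₁ ∧ a ≠ b₂ ∧ a ≠ b₃ ∧
    P₁.IsPath ∧ P₂.IsPath ∧ P₃.IsPath ∧
    PairHole G P₁ P₂ ∧ PairHole G P₁ P₃ ∧ PairHole G P₂ P₃

/-- `G` contains a prism. -/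
def HasPrism (G : SimpleGraph V) : Prop :=
  ∃ (a₁ a₂ a₃ b₁ b₂ b₃ : V) (P₁ : G.Walk a₁ b₁) (P₂ : G.Walk a₂ b₂) (P₃ : G.Walk a₃ b₃),
    G.Adj a₁ a₂ ∧ G.Adj a₁ a₃ ∧ G.Adj a₂ a₃ ∧
    G.Adj b₁ b₂ ∧ G.Adj b₁ b₃ ∧ G.Adj b₂ b₃ ∧
    ({a₁, a₂, a₃} : Set V) ∩ {b₁, b₂, b₃} = ∅ ∧
    P₁.IsPath ∧ P₂.IsPath ∧ P₃.IsPath ∧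
    PairHole G P₁ P₂ ∧ PairHole G P₁ P₃ ∧ PairHole G P₂ P₃

/-- The neighbors of `v` inside the set `S`. -/
def nbrsIn (G : SimpleGraph V) (S : Set V) (v : V) : Set V :=
  {u | u ∈ S ∧ G.Adj v u}

/-- `(S, v)` is a wheel of `G`: `S` is a hole and `v ∉ S` has at least 3 neighbors in `S`. -/
def IsWheel (G : SimpleGraph V) (S : Set V) (v : V) : Prop :=
  IsHoleSet G S ∧ v ∉ S ∧ 3 ≤ (nbrsIn G S v).ncard

/-- `(S, v)` is an even wheel of `G`. -/
def IsEvenWheel (G : SimpleGraph V) (S : Set V) (v : V) : Prop :=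
  IsWheel G S v ∧ Even (nbrsIn G S v).ncard

def HasWheel (G : SimpleGraph V) : Prop := ∃ (S : Set V) (v : V), IsWheel G S v

def HasEvenWheel (G : SimpleGraph V) : Prop := ∃ (S : Set V) (v : V), IsEvenWheel G S v

/-- A bug: a wheel whose hub has exactly three neighbors in the hole,
exactly two of which are adjacent. -/
def IsBug (G : SimpleGraph V) (S : Set V) (v : V) : Prop :=
  IsWheel G S v ∧ ∃ x y z : V, x ≠ y ∧ x ≠ z ∧ y ≠ z ∧
    nbrsIn G S v = {x, y, z} ∧ G.Adj x y ∧ ¬ G.Adj x z ∧ ¬ G.Adj y z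

/-- A twin wheel: the neighbors of the hub in the hole induce a path of length two. -/
def IsTwinWheel (G : SimpleGraph V) (S : Set V) (v : V) : Prop :=
  IsWheel G S v ∧ ∃ x y z : V, x ≠ y ∧ x ≠ z ∧ y ≠ z ∧
    nbrsIn G S v = {x, y, z} ∧ G.Adj x y ∧ G.Adj y z ∧ ¬ G.Adj x z

/-- A universal wheel: the hub is adjacent to every vertex of the hole. -/
def IsUniversalWheel (G : SimpleGraph V) (S : Set V) (v : V) : Prop :=
  IsWheel G S v ∧ ∀ u ∈ S, G.Adj v u

/-- `G` is a member of the class 𝒞 of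
(C4, diamond, theta, pyramid, prism, even wheel)-free graphs. -/
def InC (G : SimpleGraph V) : Prop :=
  Free G (cycleGraph 4) ∧ Free G diamond ∧ ¬ HasTheta G ∧ ¬ HasPyramid G ∧
    ¬ HasPrism G ∧ ¬ HasEvenWheel G

/-- The independence number of `G`. -/
noncomputable def indepNum (G : SimpleGraph V) : ℕ :=
  sSup {n | ∃ S : Set V, (S.Pairwise fun u v => ¬ G.Adj u v) ∧ S.ncard = n}

/-- The clique number of `G`. -/
noncomputable def cliqueNum (G : SimpleGraph V) : ℕ :=
  sSup {n | ∃ S : Set V, G.IsClique S ∧ S.ncard = n}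

/-- The (vertex) clique cover number of `G`: the minimum number of parts in a
partition of the vertex set of `G` into cliques. -/
noncomputable def cliqueCoverNum (G : SimpleGraph V) : ℕ :=
  sInf {n | ∃ F : Finset (Set V), F.card = n ∧ (∀ C ∈ F, G.IsClique C) ∧
    ∀ v : V, ∃! C : Set V, C ∈ F ∧ v ∈ C}

/-- A tree decomposition of `G`. -/
structure TreeDecomp (G : SimpleGraph V) where
  ι : Type
  tree : SimpleGraph ι
  tree_acyclic : tree.IsAcyclic
  tree_connected : tree.Connected
  bag : ι → Set V
  bag_cover : ∀ v : V, ∃ t, v ∈ bag t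
  bag_edge : ∀ ⦃u v : V⦄, G.Adj u v → ∃ t, u ∈ bag t ∧ v ∈ bag t
  bag_subtree : ∀ v : V, (tree.induce {t | v ∈ bag t}).Connected

/-- The treewidth of `G`: the minimum over tree decompositions of (max bag size − 1). -/
noncomputable def treewidth (G : SimpleGraph V) : ℕ :=
  sInf {k | ∃ D : TreeDecomp G, ∀ t, (D.bag t).ncard ≤ k + 1}

/-- The tree independence number of `G`. -/
noncomputable def treeIndepNum (G : SimpleGraph V) : ℕ :=
  sInf {k | ∃ D : TreeDecomp G, ∀ t, indepNum (G.induce (D.bag t)) ≤ k}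

/-- The tree clique cover number of `G`. -/
noncomputable def treeCliqueCoverNum (G : SimpleGraph V) : ℕ :=
  sInf {k | ∃ D : TreeDecomp G, ∀ t, cliqueCoverNum (G.induce (D.bag t)) ≤ k}

/-- A weight function on a finite graph: values in `[0,1]` summing to `1`. -/
def IsWeightFn [Fintype V] (w : V → ℝ) : Prop :=
  (∀ v, 0 ≤ w v ∧ w v ≤ 1) ∧ ∑ v, w v = 1

/-- The weight of a set of vertices. -/
noncomputable def wSet (w : V → ℝ) (S : Set V) : ℝ := ∑ᶠ x ∈ S, w x

/-- `X` is a `(w, c)`-balanced separator of `G`: every connected component of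
`G − X` has weight at most `c`. -/
def IsBalancedSep (G : SimpleGraph V) (w : V → ℝ) (c : ℝ) (X : Set V) : Prop :=
  ∀ D : (G.induce Xᶜ).ConnectedComponent, wSet w (Subtype.val '' D.supp) ≤ c

/-- `G` has a clique cutset: a clique `C` such that `G − C` is disconnected. -/
def HasCliqueCutset (G : SimpleGraph V) : Prop :=
  ∃ C : Set V, G.IsClique C ∧ ¬ (G.induce Cᶜ).Preconnected

/-- The closed neighborhood of `v`. -/
def closedNbhd (G : SimpleGraph V) (v : V) : Set V := insert v (G.neighborSet v)

/-- The (open) neighborhood of a set `S`: vertices outside `S` with a neighbor in `S`. -/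
def setNbhd (G : SimpleGraph V) (S : Set V) : Set V :=
  {v | v ∉ S ∧ ∃ u ∈ S, G.Adj v u}

/-- `(A, C, B)` is a separation of `G`. -/
def IsSeparation (G : SimpleGraph V) (A C B : Set V) : Prop :=
  A ∪ C ∪ B = Set.univ ∧ Disjoint A C ∧ Disjoint A B ∧ Disjoint C B ∧
    ∀ a ∈ A, ∀ b ∈ B, ¬ G.Adj a b

/-- `v` is a balanced vertex with respect to `w`: every connected component of
`G − N[v]` has weight at most `1/2`. -/
def IsBalancedVtx (G : SimpleGraph V) (w : V → ℝ) (v : V) : Prop :=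
  ∀ D : (G.induce (closedNbhd G v)ᶜ).ConnectedComponent,
    wSet w (Subtype.val '' D.supp) ≤ 1 / 2


end Paper
section
open SimpleGraph
namespace Paper
variable {V : Type*}

/-- `f` restricted to `[i,j]` is an induced path. -/
def IPath (G : SimpleGraph V) (f : ℤ → V) (i j : ℤ) : Prop :=
  ∀ x y, i ≤ x → x ≤ j → i ≤ y → y ≤ j →
    (G.Adj (f x) (f y) ↔ (y = x + 1 ∨ x = y + 1)) ∧ (f x = f y → x = y)

lemma IPath.sub {G : SimpleGraph V} {f : ℤ → V} {i j i' j' : ℤ} (h : IPath G f i j)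
    (hi : i ≤ i') (hj : j' ≤ j) : IPath G f i' j' := by
  intro x y h1 h2 h3 h4
  exact h x y (by omega) (by omega) (by omega) (by omega)

lemma IPath.rev {G : SimpleGraph V} {f : ℤ → V} {i j : ℤ} (h : IPath G f i j) (d : ℤ) :
    IPath G (fun k => f (d - k)) (d - j) (d - i) := by
  intro x y h1 h2 h3 h4
  have := h (d - x) (d - y) (by omega) (by omega) (by omega) (by omega)
  refine ⟨this.1.trans (by omega), fun e => ?_⟩
  have := this.2 e
  omega

lemma IPath.shift {G : SimpleGraph V} {f : ℤ → V} {i j : ℤ} (h : IPath G f i j) (d : ℤ) :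
    IPath G (fun k => f (k + d)) (i - d) (j - d) := by
  intro x y h1 h2 h3 h4
  have := h (x + d) (y + d) (by omega) (by omega) (by omega) (by omega)
  refine ⟨this.1.trans (by omega), fun e => ?_⟩
  have := this.2 e
  omega

lemma IPath.congr {G : SimpleGraph V} {f g : ℤ → V} {i j : ℤ} (h : IPath G f i j)
    (e : ∀ x, i ≤ x → x ≤ j → g x = f x) : IPath G g i j := by
  intro x y h1 h2 h3 h4
  rw [e x h1 h2, e y h3 h4]
  exact h x y h1 h2 h3 h4

lemma IPath.single (G : SimpleGraph V) (f : ℤ → V) (i : ℤ) : IPath G f i i := by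
  intro x y h1 h2 h3 h4
  obtain rfl : x = i := by omega
  obtain rfl : y = x := by omega
  simp

lemma IPath.adj {G : SimpleGraph V} {f : ℤ → V} {i j : ℤ} (h : IPath G f i j) {x y : ℤ}
    (h1 : i ≤ x) (h2 : x ≤ j) (h3 : i ≤ y) (h4 : y ≤ j) :
    G.Adj (f x) (f y) ↔ (y = x + 1 ∨ x = y + 1) := (h x y h1 h2 h3 h4).1

lemma IPath.inj {G : SimpleGraph V} {f : ℤ → V} {i j : ℤ} (h : IPath G f i j) {x y : ℤ}
    (h1 : i ≤ x) (h2 : x ≤ j) (h3 : i ≤ y) (h4 : y ≤ j) (e : f x = f y) : x = y :=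
  (h x y h1 h2 h3 h4).2 e

/-- concatenation -/
lemma IPath.append {G : SimpleGraph V} {f g : ℤ → V} {i j k : ℤ} (hf : IPath G f i j)
    (hg : IPath G g (j + 1) k)
    (hc : ∀ x y, i ≤ x → x ≤ j → j + 1 ≤ y → y ≤ k →
      (G.Adj (f x) (g y) ↔ (x = j ∧ y = j + 1)) ∧ f x ≠ g y) :
    IPath G (fun x => if x ≤ j then f x else g x) i k := by
  intro x y h1 h2 h3 h4
  by_cases hx : x ≤ j <;> by_cases hy : y ≤ j
  · simp only [hx, hy, if_true]; exact hf x y h1 hx h3 hy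
  · simp only [hx, hy, if_true, if_false]
    have := hc x y h1 hx (by omega) h4
    refine ⟨this.1.trans (by omega), fun e => absurd e this.2⟩
  · simp only [hx, hy, if_true, if_false]
    have := hc y x h3 hy (by omega) h2
    rw [G.adj_comm]
    refine ⟨this.1.trans (by omega), fun e => absurd e.symm this.2⟩
  · simp only [hx, hy, if_false]; exact hg x y (by omega) h2 (by omega) h4

lemma IPath.cons {G : SimpleGraph V} {f : ℤ → V} {i j : ℤ} (hf : IPath G f i j) (v : V)
    (hc : ∀ x, i ≤ x → x ≤ j → (G.Adj v (f x) ↔ x = i) ∧ v ≠ f x) :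
    IPath G (fun x => if x ≤ i - 1 then v else f x) (i - 1) j := by
  apply IPath.append (f := fun _ => v) (IPath.single _ _ _)
  · simpa using hf
  · intro x y h1 h2 h3 h4
    have := hc y (by omega) h4
    exact ⟨this.1.trans (by omega), this.2⟩

lemma IPath.snoc {G : SimpleGraph V} {f : ℤ → V} {i j : ℤ} (hf : IPath G f i j) (v : V)
    (hc : ∀ x, i ≤ x → x ≤ j → (G.Adj v (f x) ↔ x = j) ∧ v ≠ f x) :
    IPath G (fun x => if x ≤ j then f x else v) i (j + 1) := by
  apply IPath.append (g := fun _ => v) hf (IPath.single _ _ _)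
  · intro x y h1 h2 h3 h4
    have := hc x (by omega) h2
    rw [G.adj_comm]
    exact ⟨this.1.trans (by omega), this.2.symm⟩

/-- `f` restricted to `[i,j]` is an induced cycle (hole). -/
def Cyc (G : SimpleGraph V) (f : ℤ → V) (i j : ℤ) : Prop :=
  i + 3 ≤ j ∧ ∀ x y, i ≤ x → x ≤ j → i ≤ y → y ≤ j →
    (G.Adj (f x) (f y) ↔ (y = x + 1 ∨ x = y + 1 ∨ (x = i ∧ y = j) ∨ (x = j ∧ y = i))) ∧
    (f x = f y → x = y)

lemma Cyc.hole {G : SimpleGraph V} {f : ℤ → V} {i j : ℤ} (h : Cyc G f i j) :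
    IsHoleSet G (f '' Set.Icc i j) := by
  obtain ⟨hij, h⟩ := h
  obtain ⟨n, rfl⟩ : ∃ n : ℕ, j = i + n - 1 := ⟨(j - i + 1).toNat, by omega⟩
  refine ⟨n, by omega, ⟨?_⟩⟩
  let φ : Fin n → (f '' Set.Icc i (i + n - 1)) := fun k =>
    ⟨f (i + (k.val : ℤ)), i + (k.val : ℤ), ⟨by omega, by have := k.2; omega⟩, rfl⟩
  have hb : Function.Bijective φ := by
    constructor
    · intro a b e
      have e' : f (i + (a.val : ℤ)) = f (i + (b.val : ℤ)) := congrArg Subtype.val e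
      have := (h _ _ (by omega) (by have := a.2; omega) (by omega) (by have := b.2; omega)).2 e'
      exact Fin.ext (by omega)
    · rintro ⟨v, k, ⟨h1, h2⟩, rfl⟩
      refine ⟨⟨(k - i).toNat, by omega⟩, ?_⟩
      apply Subtype.ext
      change f _ = f _
      congr 1
      simp only
      omega
  refine (RelIso.mk (Equiv.ofBijective φ hb) ?_).symm
  intro a b
  change G.Adj (f (i + (a.val : ℤ))) (f (i + (b.val : ℤ))) ↔ _
  have := (h (i + (a.val : ℤ)) (i + (b.val : ℤ)) (by omega) (by have := a.2; omega) (by omega) (by have := b.2; omega)).1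
  rw [this, cycleGraph_adj']
  have ha := a.2
  have hb := b.2
  rcases lt_trichotomy a b with hab | hab | hab
  · rw [Fin.coe_sub_iff_lt.2 hab, Fin.coe_sub_iff_le.2 hab.le]
    have : a.val < b.val := hab
    omega
  · subst hab
    have : NeZero n := ⟨by omega⟩
    have h0 : (a - a).val = 0 := by simp
    rw [h0]
    omega
  · rw [Fin.coe_sub_iff_lt.2 hab, Fin.coe_sub_iff_le.2 hab.le]
    have : b.val < a.val := hab
    omega

lemma hole_cyc {G : SimpleGraph V} {S : Set V} (h : IsHoleSet G S) :
    ∃ (f : ℤ → V) (j : ℤ), Cyc G f 0 j ∧ S = f '' Set.Icc 0 j := by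
  obtain ⟨n, hn, ⟨e⟩⟩ := h
  have : NeZero n := ⟨by omega⟩
  let ψ : ℤ → Fin n := fun x => if hx : x.toNat < n then ⟨x.toNat, hx⟩ else 0
  have hψ : ∀ x : ℤ, 0 ≤ x → x ≤ n - 1 → ((ψ x).val : ℤ) = x := by
    intro x h1 h2
    have : x.toNat < n := by omega
    simp only [ψ, this, dif_pos]
    omega
  refine ⟨fun x => (e.symm (ψ x)).1, n - 1, ⟨by omega, ?_⟩, ?_⟩
  · intro x y h1 h2 h3 h4
    constructor
    · have : G.Adj (e.symm (ψ x)).1 (e.symm (ψ y)).1 ↔ (cycleGraph n).Adj (ψ x) (ψ y) :=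
        e.symm.map_adj_iff
      rw [this, cycleGraph_adj']
      have hx := hψ x h1 h2
      have hy := hψ y h3 h4
      have l1 := (ψ x).2
      have l2 := (ψ y).2
      rcases lt_trichotomy (ψ x) (ψ y) with hab | hab | hab
      · rw [Fin.coe_sub_iff_lt.2 hab, Fin.coe_sub_iff_le.2 hab.le]
        have : (ψ x).val < (ψ y).val := hab
        omega
      · rw [hab]; simp
        rw [hab] at hx
        omega
      · rw [Fin.coe_sub_iff_lt.2 hab, Fin.coe_sub_iff_le.2 hab.le]
        have : (ψ y).val < (ψ x).val := hab
        omega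
    · intro hxy
      have : ψ x = ψ y := e.symm.injective (Subtype.ext hxy)
      rw [← hψ x h1 h2, ← hψ y h3 h4, this]
  · ext v
    constructor
    · intro hv
      refine ⟨((e ⟨v, hv⟩).val : ℤ), ⟨by omega, by have := (e ⟨v, hv⟩).2; omega⟩, ?_⟩
      have : ψ ((e ⟨v, hv⟩).val : ℤ) = e ⟨v, hv⟩ := by
        apply Fin.ext
        have := hψ ((e ⟨v, hv⟩).val : ℤ) (by omega) (by have := (e ⟨v, hv⟩).2; omega)
        omega
      simp only [this, RelIso.symm_apply_apply]
    · rintro ⟨k, -, rfl⟩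
      exact (e.symm (ψ k)).2

lemma Cyc.congr {G : SimpleGraph V} {f g : ℤ → V} {i j : ℤ} (h : Cyc G f i j)
    (e : ∀ x, i ≤ x → x ≤ j → g x = f x) : Cyc G g i j := by
  refine ⟨h.1, ?_⟩
  intro x y h1 h2 h3 h4
  rw [e x h1 h2, e y h3 h4]
  exact h.2 x y h1 h2 h3 h4

/-- rotate by one step `r` -/
lemma Cyc.rot {G : SimpleGraph V} {f : ℤ → V} {j : ℤ} (h : Cyc G f 0 j) (r : ℤ)
    (h0 : 0 ≤ r) (hr : r ≤ j) :
    ∃ g, Cyc G g 0 j ∧ g '' Set.Icc 0 j = f '' Set.Icc 0 j ∧ g 0 = f r ∧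
      (r < j → g 1 = f (r + 1)) ∧ (r = j → g 1 = f 0) := by
  have hj := h.1
  refine ⟨fun x => if x + r ≤ j then f (x + r) else f (x + r - j - 1), ⟨h.1, ?_⟩, ?_, ?_, ?_, ?_⟩
  · intro x y h1 h2 h3 h4
    dsimp only
    split_ifs with p1 p2 p2
    · have := h.2 (x + r) (y + r) (by omega) (by omega) (by omega) (by omega)
      exact ⟨this.1.trans (by omega), fun e => by have := this.2 e; omega⟩
    · have := h.2 (x + r) (y + r - j - 1) (by omega) (by omega) (by omega) (by omega)
      exact ⟨this.1.trans (by omega), fun e => by have := this.2 e; omega⟩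
    · have := h.2 (x + r - j - 1) (y + r) (by omega) (by omega) (by omega) (by omega)
      exact ⟨this.1.trans (by omega), fun e => by have := this.2 e; omega⟩
    · have := h.2 (x + r - j - 1) (y + r - j - 1) (by omega) (by omega) (by omega) (by omega)
      exact ⟨this.1.trans (by omega), fun e => by have := this.2 e; omega⟩
  · ext v
    constructor
    · rintro ⟨x, ⟨h1, h2⟩, rfl⟩
      dsimp only
      split_ifs with p1
      · exact ⟨_, ⟨by omega, by omega⟩, rfl⟩
      · exact ⟨_, ⟨by omega, by omega⟩, rfl⟩
    · rintro ⟨x, ⟨h1, h2⟩, rfl⟩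
      by_cases p : r ≤ x
      · refine ⟨x - r, ⟨by omega, by omega⟩, ?_⟩
        dsimp only
        rw [if_pos (by omega)]; congr 1; omega
      · refine ⟨x - r + j + 1, ⟨by omega, by omega⟩, ?_⟩
        dsimp only
        rw [if_neg (by omega)]; congr 1; omega
  · simp [hr]
  · intro p
    dsimp only
    rw [if_pos (by omega)]; congr 1; omega
  · intro p
    dsimp only
    rw [if_neg (by omega)]; congr 1; omega

/-- two paths making a hole -/
lemma hole2 {G : SimpleGraph V} {f g : ℤ → V} {i j k l : ℤ} (hf : IPath G f i j)
    (hg : IPath G g k l) (hij : i ≤ j) (hkl : k ≤ l) (hn : 4 ≤ (j - i + 1) + (l - k + 1))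
    (hc : ∀ x y, i ≤ x → x ≤ j → k ≤ y → y ≤ l →
      (G.Adj (f x) (g y) ↔ (x = j ∧ y = k) ∨ (x = i ∧ y = l)) ∧ f x ≠ g y) :
    IsHoleSet G (f '' Set.Icc i j ∪ g '' Set.Icc k l) := by
  have hC : Cyc G (fun x => if x ≤ j then f x else g (x - j - 1 + k)) i (j + 1 + l - k) := by
    refine ⟨by omega, ?_⟩
    intro x y h1 h2 h3 h4
    by_cases hx : x ≤ j <;> by_cases hy : y ≤ j
    · simp only [hx, hy, if_true]
      have := hf x y h1 hx h3 hy
      exact ⟨this.1.trans (by omega), this.2⟩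
    · simp only [hx, hy, if_true, if_false]
      have := hc x (y - j - 1 + k) h1 hx (by omega) (by omega)
      refine ⟨this.1.trans (by omega), fun e => absurd e this.2⟩
    · simp only [hx, hy, if_true, if_false]
      have := hc y (x - j - 1 + k) h3 hy (by omega) (by omega)
      rw [G.adj_comm]
      refine ⟨this.1.trans (by omega), fun e => absurd e.symm this.2⟩
    · simp only [hx, hy, if_false]
      have := hg (x - j - 1 + k) (y - j - 1 + k) (by omega) (by omega) (by omega) (by omega)
      exact ⟨this.1.trans (by omega), fun e => by have := this.2 e; omega⟩
  have := hC.hole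
  convert this using 1
  ext v
  constructor
  · rintro (⟨x, ⟨h1, h2⟩, rfl⟩ | ⟨x, ⟨h1, h2⟩, rfl⟩)
    · exact ⟨x, ⟨h1, by omega⟩, by simp [h2]⟩
    · refine ⟨x + j + 1 - k, ⟨by omega, by omega⟩, ?_⟩
      dsimp only
      rw [if_neg (by omega)]; congr 1; omega
  · rintro ⟨x, ⟨h1, h2⟩, rfl⟩
    dsimp only
    split_ifs with p
    · exact Or.inl ⟨x, ⟨h1, p⟩, rfl⟩
    · exact Or.inr ⟨_, ⟨by omega, by omega⟩, rfl⟩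

/-- two paths making a hole, reversed variant -/
lemma hole2' {G : SimpleGraph V} {f g : ℤ → V} {i j k l : ℤ} (hf : IPath G f i j)
    (hg : IPath G g k l) (hij : i ≤ j) (hkl : k ≤ l) (hn : 4 ≤ (j - i + 1) + (l - k + 1))
    (hc : ∀ x y, i ≤ x → x ≤ j → k ≤ y → y ≤ l →
      (G.Adj (f x) (g y) ↔ (x = j ∧ y = l) ∨ (x = i ∧ y = k)) ∧ f x ≠ g y) :
    IsHoleSet G (f '' Set.Icc i j ∪ g '' Set.Icc k l) := by
  have := hole2 hf (hg.rev 0) hij (by omega) (by omega) (fun x y h1 h2 h3 h4 => by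
    have := hc x (0 - y) h1 h2 (by omega) (by omega)
    exact ⟨this.1.trans (by omega), this.2⟩)
  convert this using 2
  ext v
  constructor
  · rintro ⟨x, ⟨h1, h2⟩, rfl⟩
    exact ⟨0 - x, ⟨by omega, by omega⟩, by simp⟩
  · rintro ⟨x, ⟨h1, h2⟩, rfl⟩
    exact ⟨0 - x, ⟨by omega, by omega⟩, rfl⟩

lemma IPath.walk {G : SimpleGraph V} {f : ℤ → V} {i j : ℤ} (h : IPath G f i j) (hij : i ≤ j) :
    ∃ w : G.Walk (f i) (f j), w.IsPath ∧ {v | v ∈ w.support} = f '' Set.Icc i j := by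
  obtain ⟨n, rfl⟩ : ∃ n : ℕ, j = i + n := ⟨(j - i).toNat, by omega⟩
  clear hij
  induction n generalizing i with
  | zero =>
    refine ⟨(Walk.nil : G.Walk (f i) (f i)).copy rfl (by simp), by simp, ?_⟩
    ext v; simp
  | succ n ih =>
    have e : i + 1 + (n : ℤ) = i + ((n + 1 : ℕ) : ℤ) := by push_cast; ring
    obtain ⟨w, hw, hs⟩ := ih (i := i + 1) (h.sub (by omega) (by omega))
    have ha : G.Adj (f i) (f (i + 1)) := (h.adj (by omega) (by omega) (by omega) (by omega)).2 (by omega)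
    rw [← e]
    refine ⟨Walk.cons ha w, ?_, ?_⟩
    · rw [Walk.cons_isPath_iff]
      refine ⟨hw, fun hm => ?_⟩
      have : f i ∈ {v | v ∈ w.support} := hm
      rw [hs] at this
      obtain ⟨x, ⟨h1, h2⟩, h3⟩ := this
      have := h.inj (by omega) (by omega) (by omega) (by omega) h3
      omega
    · ext v
      have hs' : v ∈ w.support ↔ v ∈ f '' Set.Icc (i + 1) (i + 1 + (n : ℤ)) := by rw [← hs]; rfl
      simp only [Set.mem_ofPred_eq, Walk.support_cons, List.mem_cons, hs']
      constructor
      · rintro (rfl | ⟨x, ⟨h1, h2⟩, rfl⟩)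
        · exact ⟨i, ⟨by omega, by omega⟩, rfl⟩
        · exact ⟨x, ⟨by omega, by omega⟩, rfl⟩
      · rintro ⟨x, ⟨h1, h2⟩, rfl⟩
        by_cases p : x = i
        · left; rw [p]
        · right; exact ⟨x, ⟨by omega, by omega⟩, rfl⟩

end Paper
end

section
open SimpleGraph
namespace Paper
variable {V : Type*}

lemma IPath.walk' {G : SimpleGraph V} {f : ℤ → V} {i j : ℤ} (h : IPath G f i j) (hij : i ≤ j)
    (u v : V) (hu : f i = u) (hv : f j = v) :
    ∃ w : G.Walk u v, w.IsPath ∧ {v | v ∈ w.support} = f '' Set.Icc i j := by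
  subst hu; subst hv
  exact h.walk hij

lemma core_E {G : SimpleGraph V} (hT : ¬ HasTheta G) (hPy : ¬ HasPyramid G) (hPr : ¬ HasPrism G)
    {f q : ℤ → V} {j a b b' s : ℤ} (h : Cyc G f 0 j) (hq : IPath G q 1 s)
    (ha : a = 0 ∨ a = 1) (hb : b' = b ∨ b' = b + 1) (hab : a < b) (hbj : b' ≤ j) (hs : 1 ≤ s)
    (h1 : 4 ≤ b - a + 1 + s) (h2 : 4 ≤ j + 2 - b' + s)
    (hd : ∀ k x, 1 ≤ k → k ≤ s → 0 ≤ x → x ≤ j → q k ≠ f x)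
    (hA : ∀ k x, 1 ≤ k → k ≤ s → 0 ≤ x → x ≤ j →
      (G.Adj (q k) (f x) ↔ (k = 1 ∧ x ≤ a) ∨ (k = s ∧ b ≤ x ∧ x ≤ b')))
    (hna : a = 0 → b' = b → b ≠ 1 ∧ b ≠ j) (hs2 : a = 1 → b' = b + 1 → 2 ≤ s) : False := by
  have hj := h.1
  have hadj := fun x y p1 p2 p3 p4 => (h.2 x y p1 p2 p3 p4).1
  have hinj := fun x y p1 p2 p3 p4 => (h.2 x y p1 p2 p3 p4).2
  have P1 : IPath G f a b := by
    intro x y p1 p2 p3 p4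
    refine ⟨(hadj x y (by omega) (by omega) (by omega) (by omega)).trans (by omega),
      hinj x y (by omega) (by omega) (by omega) (by omega)⟩
  obtain ⟨g, hg⟩ : ∃ g : ℤ → V, g = fun k => if k = j + 1 then f 0 else f k := ⟨_, rfl⟩
  have hg1 : g (j + 1) = f 0 := by simp [hg]
  have hg2 : ∀ k, k ≤ j → g k = f k := by intro k hk; rw [hg]; dsimp only; rw [if_neg (by omega)]
  have P3 : IPath G g b' (j + 1) := by
    intro x y p1 p2 p3 p4
    rcases (by omega : x = j + 1 ∨ x ≤ j) with rfl | hx <;>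
    rcases (by omega : y = j + 1 ∨ y ≤ j) with rfl | hy
    · simp
    · rw [hg1, hg2 y hy]
      exact ⟨(hadj 0 y (by omega) (by omega) (by omega) (by omega)).trans (by omega),
        fun e => by have := hinj 0 y (by omega) (by omega) (by omega) (by omega) e; omega⟩
    · rw [hg1, hg2 x hx]
      exact ⟨(hadj x 0 (by omega) (by omega) (by omega) (by omega)).trans (by omega),
        fun e => by have := hinj x 0 (by omega) (by omega) (by omega) (by omega) e; omega⟩
    · rw [hg2 x hx, hg2 y hy]
      exact ⟨(hadj x y (by omega) (by omega) (by omega) (by omega)).trans (by omega),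
        hinj x y (by omega) (by omega) (by omega) (by omega)⟩
  obtain ⟨r, hr⟩ : ∃ r : ℤ → V, r = fun k => if k = 0 then f 0 else if k = s + 1 then f b else q k :=
    ⟨_, rfl⟩
  have hr0 : r 0 = f 0 := by simp [hr]
  have hr1 : r (s + 1) = f b := by
    rw [hr]; dsimp only; rw [if_neg (by omega), if_pos rfl]
  have hr2 : ∀ k, 1 ≤ k → k ≤ s → r k = q k := by
    intro k p1 p2; rw [hr]; dsimp only; rw [if_neg (by omega), if_neg (by omega)]
  obtain ⟨e, he⟩ : ∃ e : ℤ, e = s + 1 - (b' - b) := ⟨_, rfl⟩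
  have P2 : IPath G r a e := by
    intro x y p1 p2 p3 p4
    rcases (by omega : x = 0 ∨ x = s + 1 ∨ (1 ≤ x ∧ x ≤ s)) with hx | hx | hx <;>
    rcases (by omega : y = 0 ∨ y = s + 1 ∨ (1 ≤ y ∧ y ≤ s)) with hy | hy | hy
    · subst hx; subst hy; simp
    · subst hx; subst hy; rw [hr0, hr1]
      exact ⟨(hadj 0 b (by omega) (by omega) (by omega) (by omega)).trans (by omega),
        fun e => by have := hinj 0 b (by omega) (by omega) (by omega) (by omega) e; omega⟩
    · subst hx; rw [hr0, hr2 y hy.1 hy.2, G.adj_comm]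
      exact ⟨(hA y 0 (by omega) (by omega) (by omega) (by omega)).trans (by omega),
        fun e => absurd e.symm (hd y 0 (by omega) (by omega) (by omega) (by omega))⟩
    · subst hx; subst hy; rw [hr0, hr1]
      exact ⟨(hadj b 0 (by omega) (by omega) (by omega) (by omega)).trans (by omega),
        fun e => by have := hinj b 0 (by omega) (by omega) (by omega) (by omega) e; omega⟩
    · subst hx; subst hy; simp
    · subst hx; rw [hr1, hr2 y hy.1 hy.2, G.adj_comm]
      exact ⟨(hA y b (by omega) (by omega) (by omega) (by omega)).trans (by omega),
        fun e => absurd e.symm (hd y b (by omega) (by omega) (by omega) (by omega))⟩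
    · subst hy; rw [hr0, hr2 x hx.1 hx.2]
      exact ⟨(hA x 0 (by omega) (by omega) (by omega) (by omega)).trans (by omega),
        fun e => absurd e (hd x 0 (by omega) (by omega) (by omega) (by omega))⟩
    · subst hy; rw [hr1, hr2 x hx.1 hx.2]
      exact ⟨(hA x b (by omega) (by omega) (by omega) (by omega)).trans (by omega),
        fun e => absurd e (hd x b (by omega) (by omega) (by omega) (by omega))⟩
    · rw [hr2 x hx.1 hx.2, hr2 y hy.1 hy.2]
      exact hq x y hx.1 hx.2 hy.1 hy.2
  have H12 : IsHoleSet G (f '' Set.Icc a b ∪ q '' Set.Icc 1 s) := by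
    refine hole2' P1 hq (by omega) (by omega) (by omega) ?_
    intro x y p1 p2 p3 p4
    rw [G.adj_comm]
    exact ⟨(hA y x (by omega) (by omega) (by omega) (by omega)).trans (by omega),
      (hd y x (by omega) (by omega) (by omega) (by omega)).symm⟩
  have H32 : IsHoleSet G (g '' Set.Icc b' (j + 1) ∪ q '' Set.Icc 1 s) := by
    refine hole2 P3 hq (by omega) (by omega) (by omega) ?_
    intro x y p1 p2 p3 p4
    rw [G.adj_comm]
    rcases (by omega : x = j + 1 ∨ x ≤ j) with rfl | hx
    · rw [hg1]
      exact ⟨(hA y 0 (by omega) (by omega) (by omega) (by omega)).trans (by omega),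
        (hd y 0 (by omega) (by omega) (by omega) (by omega)).symm⟩
    · rw [hg2 x hx]
      exact ⟨(hA y x (by omega) (by omega) (by omega) (by omega)).trans (by omega),
        (hd y x (by omega) (by omega) (by omega) (by omega)).symm⟩
  have H13 : IsHoleSet G (f '' Set.Icc a b ∪ g '' Set.Icc b' (j + 1)) := by
    have := h.hole
    convert this using 1
    ext v
    constructor
    · rintro (⟨x, ⟨p1, p2⟩, rfl⟩ | ⟨x, ⟨p1, p2⟩, rfl⟩)
      · exact ⟨x, ⟨by omega, by omega⟩, rfl⟩
      · rcases (by omega : x = j + 1 ∨ x ≤ j) with rfl | hx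
        · exact ⟨0, ⟨by omega, by omega⟩, hg1.symm⟩
        · exact ⟨x, ⟨by omega, by omega⟩, (hg2 x hx).symm⟩
    · rintro ⟨x, ⟨p1, p2⟩, rfl⟩
      rcases (by omega : (a ≤ x ∧ x ≤ b) ∨ x = 0 ∨ b' ≤ x) with hx | hx | hx
      · exact Or.inl ⟨x, hx, rfl⟩
      · subst hx; exact Or.inr ⟨j + 1, ⟨by omega, by omega⟩, hg1⟩
      · exact Or.inr ⟨x, ⟨hx, by omega⟩, hg2 x p2⟩
  have R12 : f '' Set.Icc a b ∪ r '' Set.Icc a e = f '' Set.Icc a b ∪ q '' Set.Icc 1 s := by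
    ext v
    constructor
    · rintro (hv | ⟨x, ⟨p1, p2⟩, rfl⟩)
      · exact Or.inl hv
      · rcases (by omega : x = 0 ∨ x = s + 1 ∨ (1 ≤ x ∧ x ≤ s)) with hx | hx | hx
        · subst hx; exact Or.inl ⟨0, ⟨by omega, by omega⟩, hr0.symm⟩
        · subst hx; exact Or.inl ⟨b, ⟨by omega, by omega⟩, hr1.symm⟩
        · exact Or.inr ⟨x, hx, (hr2 x hx.1 hx.2).symm⟩
    · rintro (hv | ⟨x, ⟨p1, p2⟩, rfl⟩)
      · exact Or.inl hv
      · exact Or.inr ⟨x, ⟨by omega, by omega⟩, hr2 x p1 p2⟩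
  have R32 : g '' Set.Icc b' (j + 1) ∪ r '' Set.Icc a e = g '' Set.Icc b' (j + 1) ∪ q '' Set.Icc 1 s := by
    ext v
    constructor
    · rintro (hv | ⟨x, ⟨p1, p2⟩, rfl⟩)
      · exact Or.inl hv
      · rcases (by omega : x = 0 ∨ x = s + 1 ∨ (1 ≤ x ∧ x ≤ s)) with hx | hx | hx
        · subst hx; exact Or.inl ⟨j + 1, ⟨by omega, by omega⟩, by rw [hr0, hg1]⟩
        · subst hx
          have : b' = b := by omega
          exact Or.inl ⟨b, ⟨by omega, by omega⟩, by rw [hr1, hg2 b (by omega)]⟩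
        · exact Or.inr ⟨x, hx, (hr2 x hx.1 hx.2).symm⟩
    · rintro (hv | ⟨x, ⟨p1, p2⟩, rfl⟩)
      · exact Or.inl hv
      · exact Or.inr ⟨x, ⟨by omega, by omega⟩, hr2 x p1 p2⟩
  rw [← R12] at H12
  rw [← R32] at H32
  have P3' := P3.rev 0
  have S3 : (fun k => g (0 - k)) '' Set.Icc (0 - (j + 1)) (0 - b') = g '' Set.Icc b' (j + 1) := by
    ext v
    constructor
    · rintro ⟨x, ⟨h1, h2⟩, rfl⟩
      exact ⟨0 - x, ⟨by omega, by omega⟩, rfl⟩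
    · rintro ⟨x, ⟨h1, h2⟩, rfl⟩
      exact ⟨0 - x, ⟨by omega, by omega⟩, by simp⟩
  have g3 : (fun k => g (0 - k)) (0 - (j + 1)) = f 0 := by
    rw [← hg1]; dsimp only; congr 1; ring
  have g3' : (fun k => g (0 - k)) (0 - b') = f b' := by
    rw [← hg2 b' hbj]; dsimp only; congr 1; ring
  have ph : ∀ (u v u' v' : V) (w : G.Walk u v) (w' : G.Walk u' v') (X Y : Set V),
      {v | v ∈ w.support} = X → {v | v ∈ w'.support} = Y → IsHoleSet G (X ∪ Y) → PairHole G w w' := by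
    intro u v u' v' w w' X Y hX hY hh
    subst hX; subst hY; exact hh
  rcases ha with rfl | rfl <;> rcases hb with rfl | rfl
  · -- theta
    apply hT
    obtain ⟨w1, i1, s1⟩ := P1.walk' (by omega) (f 0) (f b') rfl rfl
    obtain ⟨w2, i2, s2⟩ := P2.walk' (by omega) (f 0) (f b') hr0 (by rw [← hr1, he]; congr 1; ring)
    obtain ⟨w3, i3, s3⟩ := P3'.walk' (by omega) (f 0) (f b') g3 g3'
    rw [S3] at s3
    refine ⟨f 0, f b', w1, w3, w2, ?_, ?_, i1, i3, i2, ph _ _ _ _ _ _ _ _ s1 s3 H13,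
      ph _ _ _ _ _ _ _ _ s1 s2 H12, ph _ _ _ _ _ _ _ _ s3 s2 H32⟩
    · intro e; have := hinj _ _ (by omega) (by omega) (by omega) (by omega) e; omega
    · rw [hadj _ _ (by omega) (by omega) (by omega) (by omega)]; omega
  · -- pyramid with apex f 0
    apply hPy
    obtain ⟨w1, i1, s1⟩ := P1.walk' (by omega) (f 0) (f b) rfl rfl
    obtain ⟨w2, i2, s2⟩ := P2.walk' (by omega) (f 0) (q s) hr0
      (by rw [← hr2 s (by omega) (by omega), he]; congr 1; ring)
    obtain ⟨w3, i3, s3⟩ := P3'.walk' (by omega) (f 0) (f (b + 1)) g3 g3'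
    rw [S3] at s3
    refine ⟨f 0, f b, f (b + 1), q s, w1, w3, w2, ?_, ?_, ?_, ?_, ?_, ?_, i1, i3, i2, ph _ _ _ _ _ _ _ _ s1 s3 H13,
      ph _ _ _ _ _ _ _ _ s1 s2 H12, ph _ _ _ _ _ _ _ _ s3 s2 H32⟩
    · rw [hadj _ _ (by omega) (by omega) (by omega) (by omega)]; omega
    · rw [G.adj_comm, hA _ _ (by omega) (by omega) (by omega) (by omega)]; omega
    · rw [G.adj_comm, hA _ _ (by omega) (by omega) (by omega) (by omega)]; omega
    · intro e; have := hinj _ _ (by omega) (by omega) (by omega) (by omega) e; omega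
    · intro e; have := hinj _ _ (by omega) (by omega) (by omega) (by omega) e; omega
    · exact (hd _ _ (by omega) (by omega) (by omega) (by omega)).symm
  · -- pyramid with apex f b
    apply hPy
    obtain ⟨w1, i1, s1⟩ := P1.walk' (by omega) (f 1) (f b') rfl rfl
    obtain ⟨w2, i2, s2⟩ := P2.walk' (by omega) (q 1) (f b') (hr2 1 (by omega) (by omega))
      (by rw [← hr1, he]; congr 1; ring)
    obtain ⟨w3, i3, s3⟩ := P3'.walk' (by omega) (f 0) (f b') g3 g3'
    rw [S3] at s3
    have rv : ∀ (u v : V) (w : G.Walk u v) (X : Set V), {v | v ∈ w.support} = X →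
        {v | v ∈ w.reverse.support} = X := by
      intro u v w X hX; rw [← hX]; ext v; simp
    refine ⟨f b', f 1, f 0, q 1, w1.reverse, w3.reverse, w2.reverse, ?_, ?_, ?_, ?_, ?_, ?_, i1.reverse, i3.reverse, i2.reverse,
      ph _ _ _ _ _ _ _ _ (rv _ _ _ _ s1) (rv _ _ _ _ s3) H13,
      ph _ _ _ _ _ _ _ _ (rv _ _ _ _ s1) (rv _ _ _ _ s2) H12, ph _ _ _ _ _ _ _ _ (rv _ _ _ _ s3) (rv _ _ _ _ s2) H32⟩
    · rw [hadj _ _ (by omega) (by omega) (by omega) (by omega)]; omega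
    · rw [G.adj_comm, hA _ _ (by omega) (by omega) (by omega) (by omega)]; omega
    · rw [G.adj_comm, hA _ _ (by omega) (by omega) (by omega) (by omega)]; omega
    · intro e; have := hinj _ _ (by omega) (by omega) (by omega) (by omega) e; omega
    · intro e; have := hinj _ _ (by omega) (by omega) (by omega) (by omega) e; omega
    · exact (hd _ _ (by omega) (by omega) (by omega) (by omega)).symm
  · -- prism
    have := hs2 rfl rfl
    apply hPr
    obtain ⟨w1, i1, s1⟩ := P1.walk' (by omega) (f 1) (f b) rfl rfl
    obtain ⟨w2, i2, s2⟩ := P2.walk' (by omega) (q 1) (q s) (hr2 1 (by omega) (by omega))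
      (by rw [← hr2 s (by omega) (by omega), he]; congr 1; ring)
    obtain ⟨w3, i3, s3⟩ := P3'.walk' (by omega) (f 0) (f (b + 1)) g3 g3'
    rw [S3] at s3
    refine ⟨f 1, f 0, q 1, f b, f (b + 1), q s, w1, w3, w2, ?_, ?_, ?_, ?_, ?_, ?_, ?_, i1, i3, i2, ph _ _ _ _ _ _ _ _ s1 s3 H13,
      ph _ _ _ _ _ _ _ _ s1 s2 H12, ph _ _ _ _ _ _ _ _ s3 s2 H32⟩
    · rw [hadj _ _ (by omega) (by omega) (by omega) (by omega)]; omega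
    · rw [G.adj_comm, hA _ _ (by omega) (by omega) (by omega) (by omega)]; omega
    · rw [G.adj_comm, hA _ _ (by omega) (by omega) (by omega) (by omega)]; omega
    · rw [hadj _ _ (by omega) (by omega) (by omega) (by omega)]; omega
    · rw [G.adj_comm, hA _ _ (by omega) (by omega) (by omega) (by omega)]; omega
    · rw [G.adj_comm, hA _ _ (by omega) (by omega) (by omega) (by omega)]; omega
    · have n1 := hinj 1 b (by omega) (by omega) (by omega) (by omega)
      have n2 := hinj 1 (b + 1) (by omega) (by omega) (by omega) (by omega)
      have n3 := hinj 0 b (by omega) (by omega) (by omega) (by omega)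
      have n4 := hinj 0 (b + 1) (by omega) (by omega) (by omega) (by omega)
      have n5 := hd 1 b (by omega) (by omega) (by omega) (by omega)
      have n6 := hd 1 (b + 1) (by omega) (by omega) (by omega) (by omega)
      have n7 := hd s 1 (by omega) (by omega) (by omega) (by omega)
      have n8 := hd s 0 (by omega) (by omega) (by omega) (by omega)
      have n9 := hq.inj (x := 1) (y := s) (by omega) (by omega) (by omega) (by omega)
      rw [Set.eq_empty_iff_forall_notMem]
      rintro v ⟨hv, hv'⟩
      simp only [Set.mem_insert_iff, Set.mem_singleton_iff] at hv hv'
      rcases hv with rfl | rfl | rfl <;> rcases hv' with e | e | e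
      · have := n1 e; omega
      · have := n2 e; omega
      · exact n7 e.symm
      · have := n3 e; omega
      · have := n4 e; omega
      · exact n8 e.symm
      · exact n5 e
      · exact n6 e
      · have := n9 e; omega

end Paper
end

section
open SimpleGraph
namespace Paper
variable {V : Type*}

lemma containsInduced_of {W : Type*} {G : SimpleGraph V} {H : SimpleGraph W} (φ : W → V)
    (hi : Function.Injective φ) (ha : ∀ x y, G.Adj (φ x) (φ y) ↔ H.Adj x y) :
    ContainsInduced G H := by
  refine ⟨Set.range φ, ⟨(RelIso.mk (Equiv.ofInjective φ hi) ?_).symm⟩⟩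
  intro a b
  exact ha a b

structure Good (G : SimpleGraph V) : Prop where
  K : ∀ x y u v, x ≠ y → ¬ G.Adj x y → G.Adj x u → G.Adj y u → G.Adj x v → G.Adj y v → u = v
  even : ∀ S v, IsHoleSet G S → v ∉ S → Even (nbrsIn G S v).ncard →
    ∀ a b, a ∈ S → b ∈ S → G.Adj v a → G.Adj v b → a = b ∨ G.Adj a b
  three : ∀ S v, IsHoleSet G S → v ∉ S → (nbrsIn G S v).ncard = 3 →
    ∀ a b, a ∈ S → b ∈ S → G.Adj v a → G.Adj v b → ¬ G.Adj a b
  E : ∀ S (q : ℤ → V) (s : ℤ) (A B : Set V), IsHoleSet G S → 2 ≤ s → IPath G q 1 s →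
    (∀ k, 1 ≤ k → k ≤ s → q k ∉ S) → A ⊆ S → B ⊆ S → (∀ x ∈ A, ∀ y ∈ A, x ≠ y → G.Adj x y) →
    (∀ x ∈ B, ∀ y ∈ B, x ≠ y → G.Adj x y) → (∀ x ∈ A, x ∉ B) →
    (∃ a ∈ A, ∃ b ∈ B, ¬ G.Adj a b) →
    (∀ k x, 1 ≤ k → k ≤ s → x ∈ S → (G.Adj (q k) x ↔ (k = 1 ∧ x ∈ A) ∨ (k = s ∧ x ∈ B))) → False

lemma good_K {G : SimpleGraph V} (h : InC G) (x y u v : V) (hxy : x ≠ y) (hn : ¬ G.Adj x y)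
    (h1 : G.Adj x u) (h2 : G.Adj y u) (h3 : G.Adj x v) (h4 : G.Adj y v) : u = v := by
  by_contra huv
  have hn' : ¬ G.Adj y x := fun e => hn e.symm
  have := h1.ne; have := h2.ne; have := h3.ne; have := h4.ne
  have := h1.symm; have := h2.symm; have := h3.symm; have := h4.symm
  by_cases hA : G.Adj u v
  · apply h.2.1
    have := hA.symm
    refine containsInduced_of ![x, y, u, v] ?_ ?_
    · intro a b; fin_cases a <;> fin_cases b <;> simp_all [eq_comm]
    · intro a b; fin_cases a <;> fin_cases b <;> simp_all [diamond]
  · apply h.1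
    have : ¬ G.Adj v u := fun e => hA e.symm
    refine containsInduced_of ![x, u, y, v] ?_ ?_
    · intro a b; fin_cases a <;> fin_cases b <;> simp_all [eq_comm]
    · intro a b; fin_cases a <;> fin_cases b <;> simp_all [cycleGraph_adj'] <;> decide

lemma mem_image_Icc {f : ℤ → V} {i j : ℤ} {S : Set V} (hS : S = f '' Set.Icc i j) {v : V} (hv : v ∈ S) :
    ∃ k, i ≤ k ∧ k ≤ j ∧ f k = v := by
  subst hS
  obtain ⟨k, ⟨h1, h2⟩, h3⟩ := hv
  exact ⟨k, h1, h2, h3⟩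

lemma hole_finite {G : SimpleGraph V} {S : Set V} (h : IsHoleSet G S) : S.Finite := by
  obtain ⟨f, j, -, rfl⟩ := hole_cyc h
  exact (Set.finite_Icc 0 j).image f

/-- a hole with a distinguished start vertex -/
lemma hole_cyc_at {G : SimpleGraph V} {S : Set V} (h : IsHoleSet G S) {a : V} (ha : a ∈ S) :
    ∃ (f : ℤ → V) (j : ℤ), Cyc G f 0 j ∧ S = f '' Set.Icc 0 j ∧ f 0 = a := by
  obtain ⟨f, j, hc, hS⟩ := hole_cyc h
  obtain ⟨k, h1, h2, h3⟩ := mem_image_Icc hS ha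
  obtain ⟨g, g1, g2, g3, -⟩ := hc.rot k h1 h2
  exact ⟨g, j, g1, by rw [g2, hS], by rw [g3, h3]⟩

/-- a hole with a distinguished start edge (up to order) -/
lemma hole_cyc_edge {G : SimpleGraph V} {S : Set V} (h : IsHoleSet G S) {a b : V} (ha : a ∈ S)
    (hb : b ∈ S) (hab : G.Adj a b) :
    ∃ (f : ℤ → V) (j : ℤ), Cyc G f 0 j ∧ S = f '' Set.Icc 0 j ∧ ((f 0 = a ∧ f 1 = b) ∨ (f 0 = b ∧ f 1 = a)) := by
  obtain ⟨f, j, hc, hS, h0⟩ := hole_cyc_at h ha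
  obtain ⟨k, h1, h2, h3⟩ := mem_image_Icc hS hb
  have hj := hc.1
  subst h0; subst h3
  rw [(hc.2 0 k (by omega) (by omega) (by omega) (by omega)).1] at hab
  rcases (by omega : k = 1 ∨ k = j) with rfl | rfl
  · exact ⟨f, j, hc, hS, Or.inl ⟨rfl, rfl⟩⟩
  · obtain ⟨g, g1, g2, g3, -, g4⟩ := hc.rot k h1 h2
    exact ⟨g, k, g1, by rw [g2, hS], Or.inr ⟨g3, g4 rfl⟩⟩

lemma good_even {G : SimpleGraph V} (h : InC G) (S : Set V) (v : V) (hS : IsHoleSet G S) (hv : v ∉ S)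
    (he : Even (nbrsIn G S v).ncard) (a b : V) (ha : a ∈ S) (hb : b ∈ S) (hva : G.Adj v a)
    (hvb : G.Adj v b) : a = b ∨ G.Adj a b := by
  by_contra hcon
  rw [not_or] at hcon
  obtain ⟨hne, hna⟩ := hcon
  have hfin : (nbrsIn G S v).Finite := (hole_finite hS).subset (fun x hx => hx.1)
  by_cases h3 : 3 ≤ (nbrsIn G S v).ncard
  · exact h.2.2.2.2.2 ⟨S, v, ⟨hS, hv, h3⟩, he⟩
  have hsub : ({a, b} : Set V) ⊆ nbrsIn G S v := by
    rintro x (rfl | rfl)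
    · exact ⟨ha, hva⟩
    · exact ⟨hb, hvb⟩
  have hc2 : ({a, b} : Set V).ncard = 2 := Set.ncard_pair hne
  have heq : ({a, b} : Set V) = nbrsIn G S v :=
    Set.eq_of_subset_of_ncard_le hsub (by omega) hfin
  obtain ⟨f, j, hc, hSf, h0⟩ := hole_cyc_at hS ha
  obtain ⟨k, h1, h2, h3⟩ := mem_image_Icc hSf hb
  have hj := hc.1
  subst h0; subst h3
  rw [(hc.2 0 k (by omega) (by omega) (by omega) (by omega)).1] at hna
  have hk : k ≠ 0 := by rintro rfl; exact hne rfl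
  have hm : ∀ x, 0 ≤ x → x ≤ j → f x ∈ S := by
    intro x p1 p2; rw [hSf]; exact ⟨x, ⟨p1, p2⟩, rfl⟩
  refine core_E h.2.2.1 h.2.2.2.1 h.2.2.2.2.1 (q := fun _ => v) (a := 0) (b := k) (b' := k) (s := 1) hc
    (IPath.single _ _ _) (Or.inl rfl) (Or.inl rfl) (by omega) (by omega) (by omega) (by omega) (by omega)
    ?_ ?_ (by omega) (by omega)
  · intro i x _ _ p1 p2 e
    exact hv (e ▸ hm x p1 p2)
  · intro i x q1 q2 p1 p2
    constructor
    · intro hadj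
      have : f x ∈ nbrsIn G S v := ⟨hm x p1 p2, hadj⟩
      rw [← heq] at this
      rcases this with e | e
      · have := (hc.2 x 0 p1 p2 (by omega) (by omega)).2 e; omega
      · have := (hc.2 x k p1 p2 (by omega) (by omega)).2 e; omega
    · intro hh
      rcases (by omega : x = 0 ∨ x = k) with rfl | rfl
      · exact hva
      · exact hvb

lemma good_three {G : SimpleGraph V} (h : InC G) (S : Set V) (v : V) (hS : IsHoleSet G S) (hv : v ∉ S)
    (he : (nbrsIn G S v).ncard = 3) (a b : V) (ha : a ∈ S) (hb : b ∈ S) (hva : G.Adj v a)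
    (hvb : G.Adj v b) : ¬ G.Adj a b := by
  intro hab
  have hfin : (nbrsIn G S v).Finite := (hole_finite hS).subset (fun x hx => hx.1)
  obtain ⟨f, j, hc, hSf, hfab⟩ := hole_cyc_edge hS ha hb hab
  have hj := hc.1
  have hva' : G.Adj v (f 0) ∧ G.Adj v (f 1) := by
    rcases hfab with ⟨h1, h2⟩ | ⟨h1, h2⟩ <;> rw [h1, h2] <;> exact ⟨by assumption, by assumption⟩
  obtain ⟨hv0, hv1⟩ := hva'
  have hm : ∀ x, 0 ≤ x → x ≤ j → f x ∈ S := by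
    intro x p1 p2; rw [hSf]; exact ⟨x, ⟨p1, p2⟩, rfl⟩
  have hne : f 0 ≠ f 1 := fun e => by
    have := (hc.2 0 1 (by omega) (by omega) (by omega) (by omega)).2 e; omega
  have hsub : ({f 0, f 1} : Set V) ⊆ nbrsIn G S v := by
    rintro x (rfl | rfl)
    · exact ⟨hm 0 (by omega) (by omega), hv0⟩
    · exact ⟨hm 1 (by omega) (by omega), hv1⟩
  have hc2 : ({f 0, f 1} : Set V).ncard = 2 := Set.ncard_pair hne
  obtain ⟨w, hw, hw'⟩ : ∃ w ∈ nbrsIn G S v, w ∉ ({f 0, f 1} : Set V) := by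
    by_contra hcon
    push Not at hcon
    have := Set.ncard_le_ncard (s := nbrsIn G S v) (t := {f 0, f 1}) hcon (by simp)
    omega
  have hc3 : (insert w ({f 0, f 1} : Set V)).ncard = 3 := by
    rw [Set.ncard_insert_of_notMem hw' (by simp), hc2]
  have heq : insert w ({f 0, f 1} : Set V) = nbrsIn G S v := by
    refine Set.eq_of_subset_of_ncard_le ?_ (by omega) hfin
    rintro x (rfl | hx)
    · exact hw
    · exact hsub hx
  obtain ⟨k, h1, h2, h3⟩ := mem_image_Icc hSf hw.1
  have hk0 : k ≠ 0 := by rintro rfl; exact hw' (Or.inl h3.symm)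
  have hk1 : k ≠ 1 := by rintro rfl; exact hw' (Or.inr h3.symm)
  subst h3
  have ad := fun x y p1 p2 p3 p4 => (hc.2 x y p1 p2 p3 p4).1
  by_cases hk2 : k = 2
  · subst hk2
    have := good_K h (f 0) (f 2) (f 1) v (fun e => by
      have := (hc.2 0 2 (by omega) (by omega) (by omega) (by omega)).2 e; omega)
      (by rw [ad _ _ (by omega) (by omega) (by omega) (by omega)]; omega)
      (by rw [ad _ _ (by omega) (by omega) (by omega) (by omega)]; omega)
      (by rw [ad _ _ (by omega) (by omega) (by omega) (by omega)]; omega) hv0.symm hw.2.symm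
    exact hv (this ▸ hm 1 (by omega) (by omega))
  by_cases hkj : k = j
  · subst hkj
    have := good_K h (f k) (f 1) (f 0) v (fun e => by
      have := (hc.2 k 1 (by omega) (by omega) (by omega) (by omega)).2 e; omega)
      (by rw [ad _ _ (by omega) (by omega) (by omega) (by omega)]; omega)
      (by rw [ad _ _ (by omega) (by omega) (by omega) (by omega)]; omega)
      (by rw [ad _ _ (by omega) (by omega) (by omega) (by omega)]; omega) hw.2.symm hv1.symm
    exact hv (this ▸ hm 0 (by omega) (by omega))
  refine core_E h.2.2.1 h.2.2.2.1 h.2.2.2.2.1 (q := fun _ => v) (a := 1) (b := k) (b' := k) (s := 1) hc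
    (IPath.single _ _ _) (Or.inr rfl) (Or.inl rfl) (by omega) (by omega) (by omega) (by omega) (by omega)
    ?_ ?_ (by omega) (by omega)
  · intro i x _ _ p1 p2 e
    exact hv (e ▸ hm x p1 p2)
  · intro i x q1 q2 p1 p2
    constructor
    · intro hadj
      have : f x ∈ nbrsIn G S v := ⟨hm x p1 p2, hadj⟩
      rw [← heq] at this
      rcases this with e | e | e
      · have := (hc.2 x k p1 p2 (by omega) (by omega)).2 e; omega
      · have := (hc.2 x 0 p1 p2 (by omega) (by omega)).2 e; omega
      · have := (hc.2 x 1 p1 p2 (by omega) (by omega)).2 e; omega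
    · intro hh
      rcases (by omega : x = 0 ∨ x = 1 ∨ x = k) with rfl | rfl | rfl
      · exact hv0
      · exact hv1
      · exact hw.2

lemma clique_norm {G : SimpleGraph V} {S : Set V} (h : IsHoleSet G S) {A : Set V} (hA : A ⊆ S)
    (hAn : A.Nonempty) (hAc : ∀ x ∈ A, ∀ y ∈ A, x ≠ y → G.Adj x y) :
    ∃ (f : ℤ → V) (j a : ℤ), Cyc G f 0 j ∧ S = f '' Set.Icc 0 j ∧ (a = 0 ∨ a = 1) ∧
      ∀ x, 0 ≤ x → x ≤ j → (f x ∈ A ↔ x ≤ a) := by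
  obtain ⟨u, hu⟩ := hAn
  by_cases h1 : ∀ v ∈ A, v = u
  · obtain ⟨f, j, hc, hS, h0⟩ := hole_cyc_at h (hA hu)
    refine ⟨f, j, 0, hc, hS, Or.inl rfl, fun x p1 p2 => ?_⟩
    constructor
    · intro hx
      have := h1 _ hx
      rw [← h0] at this
      have := (hc.2 x 0 p1 p2 (by omega) (by omega)).2 this; omega
    · intro hx
      obtain rfl : x = 0 := by omega
      rw [h0]; exact hu
  · push Not at h1
    obtain ⟨v, hv, hne⟩ := h1
    obtain ⟨f, j, hc, hS, h0⟩ := hole_cyc_edge h (hA hu) (hA hv) (hAc u hu v hv hne.symm)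
    have hj := hc.1
    have h01 : f 0 ∈ A ∧ f 1 ∈ A := by
      rcases h0 with ⟨e1, e2⟩ | ⟨e1, e2⟩ <;> rw [e1, e2] <;> exact ⟨by assumption, by assumption⟩
    refine ⟨f, j, 1, hc, hS, Or.inr rfl, fun x p1 p2 => ?_⟩
    constructor
    · intro hx
      by_contra hx1
      have e1 := hAc _ hx _ h01.1 (fun e => by
        have := (hc.2 x 0 p1 p2 (by omega) (by omega)).2 e; omega)
      have e2 := hAc _ hx _ h01.2 (fun e => by
        have := (hc.2 x 1 p1 p2 (by omega) (by omega)).2 e; omega)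
      rw [(hc.2 x 0 p1 p2 (by omega) (by omega)).1] at e1
      rw [(hc.2 x 1 p1 p2 (by omega) (by omega)).1] at e2
      omega
    · intro hx
      rcases (by omega : x = 0 ∨ x = 1) with rfl | rfl
      · exact h01.1
      · exact h01.2

lemma good_E {G : SimpleGraph V} (h : InC G) (S : Set V) (q : ℤ → V) (s : ℤ) (A B : Set V)
    (hS : IsHoleSet G S) (hs : 2 ≤ s) (hq : IPath G q 1 s)
    (hqS : ∀ k, 1 ≤ k → k ≤ s → q k ∉ S) (hA : A ⊆ S) (hB : B ⊆ S)
    (hAc : ∀ x ∈ A, ∀ y ∈ A, x ≠ y → G.Adj x y)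
    (hBc : ∀ x ∈ B, ∀ y ∈ B, x ≠ y → G.Adj x y) (hAB : ∀ x ∈ A, x ∉ B)
    (hna : ∃ a ∈ A, ∃ b ∈ B, ¬ G.Adj a b)
    (had : ∀ k x, 1 ≤ k → k ≤ s → x ∈ S → (G.Adj (q k) x ↔ (k = 1 ∧ x ∈ A) ∨ (k = s ∧ x ∈ B))) :
    False := by
  obtain ⟨a0, ha0, b0, hb0, hn0⟩ := hna
  obtain ⟨f, j, a, hc, hSf, ha, hfA⟩ := clique_norm hS hA ⟨a0, ha0⟩ hAc
  have hj := hc.1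
  have hm : ∀ x, 0 ≤ x → x ≤ j → f x ∈ S := by
    intro x p1 p2; rw [hSf]; exact ⟨x, ⟨p1, p2⟩, rfl⟩
  obtain ⟨i0, i1, i2, rfl⟩ := mem_image_Icc hSf (hA ha0)
  obtain ⟨k0, k1, k2, rfl⟩ := mem_image_Icc hSf (hB hb0)
  have fB : ∀ x, 0 ≤ x → x ≤ j → f x ∈ B → a < x := by
    intro x p1 p2 hx
    by_contra hcon
    exact hAB _ ((hfA x p1 p2).2 (by omega)) hx
  have ad := fun x y p1 p2 p3 p4 => (hc.2 x y p1 p2 p3 p4).1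
  obtain ⟨b, b', hb, hb1, hb2, hfB⟩ : ∃ b b', (b' = b ∨ b' = b + 1) ∧ 0 ≤ b ∧ b' ≤ j ∧
      ∀ x, 0 ≤ x → x ≤ j → (f x ∈ B ↔ (b ≤ x ∧ x ≤ b')) := by
    have key : ∀ x y, 0 ≤ x → x ≤ j → 0 ≤ y → y ≤ j → f x ∈ B → f y ∈ B → x < y → y = x + 1 := by
      intro x y p1 p2 p3 p4 hx hy hxy
      have := hBc _ hx _ hy (fun e => by have := (hc.2 x y p1 p2 p3 p4).2 e; omega)
      rw [ad x y p1 p2 p3 p4] at this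
      have := fB x p1 p2 hx
      omega
    by_cases c1 : k0 + 1 ≤ j ∧ f (k0 + 1) ∈ B
    · refine ⟨k0, k0 + 1, Or.inr rfl, k1, c1.1, fun x p1 p2 => ⟨fun hx => ?_, fun hx => ?_⟩⟩
      · have u1 := key x k0 p1 p2 k1 k2 hx hb0
        have u2 := key k0 x k1 k2 p1 p2 hb0 hx
        have u3 := key x (k0+1) p1 p2 (by omega) (by omega) hx c1.2
        omega
      · rcases (by omega : x = k0 ∨ x = k0 + 1) with rfl | rfl
        · exact hb0
        · exact c1.2
    · by_cases c2 : 0 ≤ k0 - 1 ∧ f (k0 - 1) ∈ B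
      · refine ⟨k0 - 1, k0, Or.inr (by omega), c2.1, k2, fun x p1 p2 => ⟨fun hx => ?_, fun hx => ?_⟩⟩
        · have u1 := key x k0 p1 p2 k1 k2 hx hb0
          have u2 := key k0 x k1 k2 p1 p2 hb0 hx
          have u3 := key (k0 - 1) x (by omega) (by omega) p1 p2 c2.2 hx
          omega
        · rcases (by omega : x = k0 ∨ x = k0 - 1) with rfl | rfl
          · exact hb0
          · exact c2.2
      · refine ⟨k0, k0, Or.inl rfl, k1, k2, fun x p1 p2 => ⟨fun hx => ?_, fun hx => ?_⟩⟩
        · have u1 := key x k0 p1 p2 k1 k2 hx hb0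
          have u2 := key k0 x k1 k2 p1 p2 hb0 hx
          rcases lt_trichotomy x k0 with l | l | l
          · obtain rfl : x = k0 - 1 := by have := u1 l; omega
            exact absurd ⟨p1, hx⟩ c2
          · omega
          · obtain rfl := u2 l
            exact absurd ⟨p2, hx⟩ c1
        · obtain rfl : x = k0 := by omega
          exact hb0
  have hab := fB b hb1 (by omega) ((hfB b hb1 (by omega)).2 (by omega))
  have hi0 := (hfA i0 i1 i2).1 ha0
  have hk0 := (hfB k0 k1 k2).1 hb0
  rw [ad _ _ i1 i2 k1 k2] at hn0
  refine core_E h.2.2.1 h.2.2.2.1 h.2.2.2.2.1 (q := q) (a := a) (b := b) (b' := b') (s := s) hc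
    hq ha hb hab hb2 (by omega) (by omega) (by omega)
    ?_ ?_ (by omega) (by omega)
  · intro i x p1 p2 p3 p4 e
    exact hqS i p1 p2 (e ▸ hm x p3 p4)
  · intro i x p1 p2 p3 p4
    rw [had i _ p1 p2 (hm x p3 p4), hfA x p3 p4, hfB x p3 p4]

lemma InC.good {G : SimpleGraph V} (h : InC G) : Good G :=
  ⟨good_K h, good_even h, good_three h, good_E h⟩

lemma hole_lift {G : SimpleGraph V} (X : Set V) {S : Set X} (h : IsHoleSet (G.induce X) S) :
    IsHoleSet G (Subtype.val '' S) := by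
  obtain ⟨f, j, hc, rfl⟩ := hole_cyc h
  have : Cyc G (fun x => (f x).1) 0 j :=
    ⟨hc.1, fun x y p1 p2 p3 p4 => ⟨(hc.2 x y p1 p2 p3 p4).1,
      fun e => (hc.2 x y p1 p2 p3 p4).2 (Subtype.ext e)⟩⟩
  have := this.hole
  rw [Set.image_image]
  exact this

lemma Good.induce {G : SimpleGraph V} (h : Good G) (X : Set V) : Good (G.induce X) := by
  have nb : ∀ (S : Set X) (v : X), (nbrsIn (G.induce X) S v).ncard =
      (nbrsIn G (Subtype.val '' S) v.1).ncard := by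
    intro S v
    rw [← Set.ncard_image_of_injective _ Subtype.val_injective]
    congr 1
    ext w
    constructor
    · rintro ⟨u, ⟨h1, h2⟩, rfl⟩
      exact ⟨⟨u, h1, rfl⟩, h2⟩
    · rintro ⟨⟨u, h1, rfl⟩, h2⟩
      exact ⟨u, ⟨h1, h2⟩, rfl⟩
  have nm : ∀ (S : Set X) (v : X), v.1 ∈ Subtype.val '' S → v ∈ S := by
    rintro S v ⟨u, hu, e⟩
    rw [← Subtype.ext e]; exact hu
  constructor
  · intro x y u v h0 h1 h2 h3 h4 h5
    exact Subtype.ext (h.K x.1 y.1 u.1 v.1 (fun e => h0 (Subtype.ext e)) h1 h2 h3 h4 h5)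
  · intro S v h1 h2 h3 a b ha hb hva hvb
    rw [nb] at h3
    rcases h.even _ v.1 (hole_lift X h1) (fun hh => h2 (nm _ _ hh)) h3 a.1 b.1 ⟨a, ha, rfl⟩ ⟨b, hb, rfl⟩ hva hvb with e | e
    · exact Or.inl (Subtype.ext e)
    · exact Or.inr e
  · intro S v h1 h2 h3 a b ha hb hva hvb
    rw [nb] at h3
    exact h.three _ v.1 (hole_lift X h1) (fun hh => h2 (nm _ _ hh)) h3 a.1 b.1 ⟨a, ha, rfl⟩ ⟨b, hb, rfl⟩ hva hvb
  · intro S q s A B h1 h2 h3 h4 h5 h6 h7 h8 h9 h10 h11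
    refine h.E _ (fun k => (q k).1) s (Subtype.val '' A) (Subtype.val '' B) (hole_lift X h1) h2 ?_ ?_
      (Set.image_mono h5) (Set.image_mono h6) ?_ ?_ ?_ ?_ ?_
    · intro x y p1 p2 p3 p4
      exact ⟨(h3 x y p1 p2 p3 p4).1, fun e => (h3 x y p1 p2 p3 p4).2 (Subtype.ext e)⟩
    · intro k p1 p2 hh
      exact h4 k p1 p2 (nm _ _ hh)
    · rintro _ ⟨x, hx, rfl⟩ _ ⟨y, hy, rfl⟩ hne
      exact h7 x hx y hy (fun e => hne (congrArg _ e))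
    · rintro _ ⟨x, hx, rfl⟩ _ ⟨y, hy, rfl⟩ hne
      exact h8 x hx y hy (fun e => hne (congrArg _ e))
    · rintro _ ⟨x, hx, rfl⟩ hh
      exact h9 x hx (nm _ _ hh)
    · obtain ⟨a, ha, b, hb, hab⟩ := h10
      exact ⟨a, ⟨a, ha, rfl⟩, b, ⟨b, hb, rfl⟩, hab⟩
    · rintro k _ p1 p2 ⟨x, hx, rfl⟩
      have := h11 k x p1 p2 hx
      rw [show G.Adj (q k).1 x.1 ↔ (G.induce X).Adj (q k) x from Iff.rfl, this]
      constructor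
      · rintro (⟨u1, u2⟩ | ⟨u1, u2⟩)
        · exact Or.inl ⟨u1, x, u2, rfl⟩
        · exact Or.inr ⟨u1, x, u2, rfl⟩
      · rintro (⟨u1, u2⟩ | ⟨u1, u2⟩)
        · exact Or.inl ⟨u1, nm _ _ u2⟩
        · exact Or.inr ⟨u1, nm _ _ u2⟩

end Paper
end

section
open SimpleGraph
namespace Paper
variable {V : Type*}

/-- walks of length `m` inside `X` -/
inductive Wk (G : SimpleGraph V) (X : Set V) : ℕ → V → V → Prop
  | nil {x : V} : x ∈ X → Wk G X 0 x x
  | cons {m : ℕ} {x y z : V} : x ∈ X → G.Adj x y → Wk G X m y z → Wk G X (m + 1) x z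

lemma Wk.start_mem {G : SimpleGraph V} {X : Set V} {m x y} (h : Wk G X m x y) : x ∈ X := by
  cases h <;> assumption

lemma Wk.end_mem {G : SimpleGraph V} {X : Set V} {m x y} (h : Wk G X m x y) : y ∈ X := by
  induction h <;> assumption

lemma Wk.trans {G : SimpleGraph V} {X : Set V} {m n x y z} (h : Wk G X m x y) (h' : Wk G X n y z) :
    Wk G X (m + n) x z := by
  induction h with
  | nil _ => simpa using h'
  | cons hx ha _ ih =>
    have := Wk.cons hx ha (ih h')
    convert this using 1
    omega

lemma Wk.snoc {G : SimpleGraph V} {X : Set V} {m x y z} (h : Wk G X m x y) (ha : G.Adj y z) (hz : z ∈ X) :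
    Wk G X (m + 1) x z := h.trans (Wk.cons h.end_mem ha (Wk.nil hz))

lemma Wk.symm {G : SimpleGraph V} {X : Set V} {m x y} (h : Wk G X m x y) : Wk G X m y x := by
  induction h with
  | nil hx => exact Wk.nil hx
  | cons hx ha _ ih => exact ih.snoc ha.symm hx

lemma Wk.mono {G : SimpleGraph V} {X Y : Set V} (hXY : X ⊆ Y) {m x y} (h : Wk G X m x y) : Wk G Y m x y := by
  induction h with
  | nil hx => exact Wk.nil (hXY hx)
  | cons hx ha _ ih => exact Wk.cons (hXY hx) ha ih

lemma Wk.exit {G : SimpleGraph V} {X F : Set V} {m x y} (h : Wk G X m x y) (hx : x ∈ F) (hy : y ∉ F) :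
    ∃ a b, a ∈ F ∧ a ∈ X ∧ b ∉ F ∧ b ∈ X ∧ G.Adj a b := by
  induction h with
  | nil _ => exact absurd hx hy
  | @cons m x y' z hxX ha hw ih =>
    by_cases hc : y' ∈ F
    · exact ih hc hy
    · exact ⟨x, y', hx, hxX, hc, hw.start_mem, ha⟩

lemma wk_of_path {G : SimpleGraph V} {X : Set V} {q : ℤ → V} {i : ℤ} (n : ℕ)
    (hX : ∀ k, i ≤ k → k ≤ i + n → q k ∈ X) (ha : ∀ k, i ≤ k → k < i + n → G.Adj (q k) (q (k + 1))) :
    Wk G X n (q i) (q (i + n)) := by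
  induction n with
  | zero => simpa using Wk.nil (hX i (by omega) (by omega))
  | succ n ih =>
    have h1 := ih (fun k p1 p2 => hX k p1 (by omega)) (fun k p1 p2 => ha k p1 (by omega))
    have := h1.snoc (ha (i + n) (by omega) (by omega)) (hX _ (by omega) (by omega))
    convert this using 2
    push_cast; ring

lemma IPath.wk {G : SimpleGraph V} {X : Set V} {q : ℤ → V} {i j : ℤ} (h : IPath G q i j)
    (hX : ∀ k, i ≤ k → k ≤ j → q k ∈ X) {x y : ℤ} (hx : i ≤ x) (hxy : x ≤ y) (hy : y ≤ j) :
    Wk G X (y - x).toNat (q x) (q y) := by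
  have := wk_of_path (G := G) (X := X) (q := q) (i := x) (y - x).toNat
    (fun k p1 p2 => hX k (by omega) (by omega))
    (fun k p1 p2 => (h.adj (by omega) (by omega) (by omega) (by omega)).2 (by omega))
  convert this using 2
  omega

lemma Wk.toFun {G : SimpleGraph V} {X : Set V} {m x y} (h : Wk G X m x y) :
    ∃ q : ℤ → V, q 1 = x ∧ q (m + 1) = y ∧ (∀ k : ℤ, 1 ≤ k → k ≤ m + 1 → q k ∈ X) ∧
      ∀ k : ℤ, 1 ≤ k → k < m + 1 → G.Adj (q k) (q (k + 1)) := by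
  induction h with
  | @nil x hx => exact ⟨fun _ => x, rfl, rfl, fun _ _ _ => hx, fun k h1 h2 => by simp at h2; omega⟩
  | @cons m x y z hx ha hw ih =>
    obtain ⟨q, q1, q2, q3, q4⟩ := ih
    refine ⟨fun k => if k = 1 then x else q (k - 1), by simp, ?_, ?_, ?_⟩
    · push_cast; rw [if_neg (by omega), ← q2]; congr 1; ring
    · intro k p1 p2
      dsimp only
      split_ifs with hk
      · exact hx
      · exact q3 _ (by omega) (by push_cast at p2; omega)
    · intro k p1 p2
      dsimp only
      push_cast at p2
      rw [if_neg (by omega : ¬ k + 1 = 1)]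
      split_ifs with hk
      · subst hk; simpa [q1] using ha
      · have := q4 (k - 1) (by omega) (by omega)
        convert this using 2; ring

/-- shortest path lemma -/
lemma SP {G : SimpleGraph V} {X : Set V} (PA PB : V → Prop) {m x y} (hw : Wk G X m x y) (hA : PA x)
    (hB : PB y) : ∃ (s : ℤ) (q : ℤ → V), 1 ≤ s ∧ IPath G q 1 s ∧ (∀ k, 1 ≤ k → k ≤ s → q k ∈ X) ∧
      (∀ k, 1 ≤ k → k ≤ s → (PA (q k) ↔ k = 1)) ∧ (∀ k, 1 ≤ k → k ≤ s → (PB (q k) ↔ k = s)) ∧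
      ∀ m x y, PA x → PB y → Wk G X m x y → s ≤ m + 1 := by
  classical
  have hex : ∃ n, ∃ x y, PA x ∧ PB y ∧ Wk G X n x y := ⟨m, x, y, hA, hB, hw⟩
  obtain ⟨x0, y0, hx0, hy0, hw0⟩ := Nat.find_spec hex
  obtain ⟨n, hn⟩ : ∃ n, n = Nat.find hex := ⟨_, rfl⟩
  have hmin : ∀ m x y, PA x → PB y → Wk G X m x y → n ≤ m := by
    intro m x y h1 h2 h3; rw [hn]; exact Nat.find_min' hex ⟨x, y, h1, h2, h3⟩
  rw [← hn] at hw0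
  clear hn hex
  obtain ⟨q, q1, q2, q3, q4⟩ := hw0.toFun
  have sub : ∀ i j, 1 ≤ i → i ≤ j → j ≤ (n : ℤ) + 1 → Wk G X (j - i).toNat (q i) (q j) := by
    intro i j h1 h2 h3
    have := wk_of_path (G := G) (X := X) (q := q) (i := i) (j - i).toNat
      (fun k p1 p2 => q3 k (by omega) (by omega)) (fun k p1 p2 => q4 k (by omega) (by omega))
    convert this using 2
    omega
  have key : ∀ x y, 1 ≤ x → x < y → y ≤ (n : ℤ) + 1 →
      (G.Adj (q x) (q y) ↔ y = x + 1) ∧ q x ≠ q y := by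
    intro x y h1 h2 h3
    have w1 := sub 1 x (by omega) (by omega) (by omega)
    have w2 := sub y (n + 1) (by omega) (by omega) (by omega)
    refine ⟨⟨fun ha => ?_, fun e => ?_⟩, fun e => ?_⟩
    · have := (w1.snoc ha (q3 y (by omega) (by omega))).trans w2
      rw [q1, q2] at this
      have := hmin _ _ _ hx0 hy0 this
      omega
    · subst e; exact q4 x (by omega) (by omega)
    · rw [e] at w1
      have := w1.trans w2
      rw [q1, q2] at this
      have := hmin _ _ _ hx0 hy0 this
      omega
  refine ⟨n + 1, q, by omega, ?_, q3, ?_, ?_, ?_⟩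
  · intro x y h1 h2 h3 h4
    rcases lt_trichotomy x y with l | l | l
    · have := key x y h1 l h4
      exact ⟨this.1.trans (by omega), fun e => absurd e this.2⟩
    · subst l; simp
    · have := key y x h3 l h2
      rw [G.adj_comm]
      exact ⟨this.1.trans (by omega), fun e => absurd e.symm this.2⟩
  · intro k h1 h2
    constructor
    · intro hp
      have w2 := sub k (n + 1) (by omega) (by omega) (by omega)
      rw [q2] at w2
      have := hmin _ _ _ hp hy0 w2
      omega
    · rintro rfl; rw [q1]; exact hx0
  · intro k h1 h2
    constructor
    · intro hp
      have w2 := sub 1 k (by omega) (by omega) (by omega)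
      rw [q1] at w2
      have := hmin _ _ _ hx0 hp w2
      omega
    · rintro rfl; rw [q2]; exact hy0
  · intro m x y h1 h2 h3
    have := hmin m x y h1 h2 h3
    omega

def Conn (G : SimpleGraph V) (F : Set V) : Prop := ∀ x ∈ F, ∀ y ∈ F, ∃ m, Wk G F m x y

def Comp (G : SimpleGraph V) (X : Set V) (x : V) : Set V := {y | ∃ m, Wk G X m x y}

lemma Conn.union {G : SimpleGraph V} {F F' : Set V} (h : Conn G F) (h' : Conn G F')
    (hc : ∃ a ∈ F, ∃ b ∈ F', a = b ∨ G.Adj a b) : Conn G (F ∪ F') := by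
  obtain ⟨a, ha, b, hb, hab⟩ := hc
  have hab' : ∃ m, Wk G (F ∪ F') m a b := by
    rcases hab with rfl | hab
    · exact ⟨0, Wk.nil (Or.inl ha)⟩
    · exact ⟨1, Wk.cons (Or.inl ha) hab (Wk.nil (Or.inr hb))⟩
  obtain ⟨m, hm⟩ := hab'
  have key : ∀ x ∈ F ∪ F', ∃ m, Wk G (F ∪ F') m x a := by
    rintro x (hx | hx)
    · obtain ⟨k, hk⟩ := h x hx a ha
      exact ⟨k, hk.mono Set.subset_union_left⟩
    · obtain ⟨k, hk⟩ := h' x hx b hb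
      exact ⟨_, (hk.mono Set.subset_union_right).trans hm.symm⟩
  intro x hx y hy
  obtain ⟨k, hk⟩ := key x hx
  obtain ⟨l, hl⟩ := key y hy
  exact ⟨_, hk.trans hl.symm⟩

lemma Conn.singleton (G : SimpleGraph V) (v : V) : Conn G {v} := by
  rintro x rfl y rfl
  exact ⟨0, Wk.nil rfl⟩

lemma conn_clique {G : SimpleGraph V} {F : Set V} (h : ∀ x ∈ F, ∀ y ∈ F, x ≠ y → G.Adj x y) : Conn G F := by
  intro x hx y hy
  by_cases e : x = y
  · subst e; exact ⟨0, Wk.nil hx⟩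
  · exact ⟨1, Wk.cons hx (h x hx y hy e) (Wk.nil hy)⟩

/-- adding a set of vertices each attached to the core -/
lemma Conn.add {G : SimpleGraph V} {F W : Set V} (h : Conn G F) 
    (hW : ∀ w ∈ W, ∃ a ∈ F, G.Adj w a) : Conn G (F ∪ W) := by
  have key : ∀ x ∈ F ∪ W, ∃ a ∈ F, ∃ m, Wk G (F ∪ W) m x a := by
    rintro x (hx | hx)
    · exact ⟨x, hx, 0, Wk.nil (Or.inl hx)⟩
    · obtain ⟨a, ha, hxa⟩ := hW x hx
      exact ⟨a, ha, 1, Wk.cons (Or.inr hx) hxa (Wk.nil (Or.inl ha))⟩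
  intro x hx y hy
  obtain ⟨a, ha, k, hk⟩ := key x hx
  obtain ⟨b, hb, l, hl⟩ := key y hy
  obtain ⟨m, hm⟩ := h a ha b hb
  exact ⟨_, (hk.trans (hm.mono Set.subset_union_left)).trans hl.symm⟩

lemma IPath.conn {G : SimpleGraph V} {q : ℤ → V} {i j : ℤ} (h : IPath G q i j) :
    Conn G (q '' Set.Icc i j) := by
  have hX : ∀ k, i ≤ k → k ≤ j → q k ∈ q '' Set.Icc i j := fun k p1 p2 => ⟨k, ⟨p1, p2⟩, rfl⟩
  rintro _ ⟨x, ⟨h1, h2⟩, rfl⟩ _ ⟨y, ⟨h3, h4⟩, rfl⟩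
  rcases le_total x y with l | l
  · exact ⟨_, h.wk hX h1 l h4⟩
  · exact ⟨_, (h.wk hX h3 l h2).symm⟩

lemma Comp.subset {G : SimpleGraph V} {X : Set V} {x : V} : Comp G X x ⊆ X := by
  rintro y ⟨m, h⟩; exact h.end_mem

lemma Comp.self {G : SimpleGraph V} {X : Set V} {x : V} (h : x ∈ X) : x ∈ Comp G X x := ⟨0, Wk.nil h⟩

lemma Comp.closed {G : SimpleGraph V} {X : Set V} {x y z : V} (h : y ∈ Comp G X x) (ha : G.Adj y z)
    (hz : z ∈ X) : z ∈ Comp G X x := by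
  obtain ⟨m, hm⟩ := h
  exact ⟨_, hm.snoc ha hz⟩

lemma Comp.wk_in {G : SimpleGraph V} {X : Set V} {x : V} {m y z} (h : Wk G X m y z) (hy : y ∈ Comp G X x) :
    Wk G (Comp G X x) m y z := by
  induction h with
  | nil hx => exact Wk.nil hy
  | cons hx ha hw ih => exact Wk.cons hy ha (ih (Comp.closed hy ha hw.start_mem))

lemma Comp.conn {G : SimpleGraph V} {X : Set V} {x : V} : Conn G (Comp G X x) := by
  rintro y ⟨m, hm⟩ z ⟨n, hn⟩
  exact ⟨_, Comp.wk_in (hm.symm.trans hn) ⟨m, hm⟩⟩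

lemma Conn.subset_comp {G : SimpleGraph V} {X F : Set V} {x : V} (h : Conn G F) (hF : F ⊆ X) {y : V} (hy : y ∈ F)
    (hyc : y ∈ Comp G X x) : F ⊆ Comp G X x := by
  intro z hz
  obtain ⟨m, hm⟩ := h y hy z hz
  obtain ⟨n, hn⟩ := hyc
  exact ⟨_, hn.trans (hm.mono hF)⟩

lemma Comp.eq_of_mem {G : SimpleGraph V} {X : Set V} {x y : V} (h : y ∈ Comp G X x) : Comp G X y = Comp G X x := by
  obtain ⟨m, hm⟩ := h
  ext z
  constructor
  · rintro ⟨n, hn⟩; exact ⟨_, hm.trans hn⟩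
  · rintro ⟨n, hn⟩; exact ⟨_, hm.symm.trans hn⟩

/-- no clique cutset -/
def NCC (G : SimpleGraph V) : Prop :=
  ∀ K : Set V, (∀ x ∈ K, ∀ y ∈ K, x ≠ y → G.Adj x y) → ∀ x y, x ∉ K → y ∉ K → ∃ m, Wk G Kᶜ m x y

lemma NCC.att {G : SimpleGraph V} (h : NCC G) {K F : Set V} (hK : ∀ x ∈ K, ∀ y ∈ K, x ≠ y → G.Adj x y)
    {x v : V} (hx : x ∈ F) (hFK : ∀ x ∈ F, x ∉ K) (hv : v ∉ F) (hvK : v ∉ K) :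
    ∃ f ∈ F, ∃ w, w ∉ F ∧ w ∉ K ∧ G.Adj f w := by
  obtain ⟨m, hm⟩ := h K hK x v (hFK x hx) hvK
  obtain ⟨a, b, h1, -, h2, h3, h4⟩ := hm.exit hx hv
  exact ⟨a, h1, b, h2, h3, h4⟩

def Qc (G : SimpleGraph V) (x y : V) : Set V := {z | (z = x ∨ G.Adj z x) ∧ (z = y ∨ G.Adj z y)}

lemma Qc.left {G : SimpleGraph V} {x y : V} (h : G.Adj x y) : x ∈ Qc G x y := ⟨Or.inl rfl, Or.inr h⟩
lemma Qc.right {G : SimpleGraph V} {x y : V} (h : G.Adj x y) : y ∈ Qc G x y := ⟨Or.inr h.symm, Or.inl rfl⟩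

lemma Good.clique {G : SimpleGraph V} (g : Good G) {x y : V} (h : G.Adj x y) :
    ∀ a ∈ Qc G x y, ∀ b ∈ Qc G x y, a ≠ b → G.Adj a b := by
  rintro a ⟨a1, a2⟩ b ⟨b1, b2⟩ hne
  rcases a1 with rfl | a1
  · rcases b1 with rfl | b1
    · exact absurd rfl hne
    · exact b1.symm
  rcases b1 with rfl | b1
  · exact a1
  rcases a2 with rfl | a2
  · rcases b2 with rfl | b2
    · exact absurd rfl hne
    · exact b2.symm
  rcases b2 with rfl | b2
  · exact a2
  by_contra hcon
  exact h.ne (g.K a b x y hne hcon a1 b1 a2 b2)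

lemma Good.absorb {G : SimpleGraph V} (g : Good G) {x y : V} (h : G.Adj x y) {a b v : V}
    (ha : a ∈ Qc G x y) (hb : b ∈ Qc G x y) (hab : a ≠ b) (hva : G.Adj v a) (hvb : G.Adj v b) :
    v ∈ Qc G x y := by
  have key : ∀ w ∈ Qc G x y, v = w ∨ G.Adj v w := by
    intro w hw
    by_cases e : v = w
    · exact Or.inl e
    right
    by_cases e1 : w = a
    · rw [e1]; exact hva
    by_cases e2 : w = b
    · rw [e2]; exact hvb
    by_contra hcon
    exact hab (g.K v w a b e hcon hva (g.clique h _ hw _ ha e1) hvb (g.clique h _ hw _ hb e2))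
  exact ⟨key x (Qc.left h), key y (Qc.right h)⟩

lemma Good.Qc_eq {G : SimpleGraph V} (g : Good G) {x y : V} (h : G.Adj x y) {a b : V}
    (ha : a ∈ Qc G x y) (hb : b ∈ Qc G x y) (hab : a ≠ b) : Qc G a b = Qc G x y := by
  have hadj := g.clique h a ha b hb hab
  have cl := g.clique h
  ext z
  constructor
  · rintro ⟨h1, h2⟩
    rcases h1 with rfl | h1
    · exact ha
    rcases h2 with rfl | h2
    · exact hb
    exact g.absorb h ha hb hab h1 h2
  · intro hz
    constructor
    · by_cases e : z = a
      · exact Or.inl e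
      · exact Or.inr (cl z hz a ha e)
    · by_cases e : z = b
      · exact Or.inl e
      · exact Or.inr (cl z hz b hb e)

lemma Good.Qc_inter {G : SimpleGraph V} (g : Good G) {p y z : V} (hy : G.Adj p y) (hz : G.Adj p z)
    (hne : y ≠ z) (hn : ¬ G.Adj y z) {w : V} (h1 : w ∈ Qc G p y) (h2 : w ∈ Qc G p z) : w = p := by
  by_contra e
  have e1 := g.Qc_eq hy (Qc.left hy) h1 (Ne.symm e)
  have e2 := g.Qc_eq hz (Qc.left hz) h2 (Ne.symm e)
  have : z ∈ Qc G p y := by rw [← e1, e2]; exact Qc.right hz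
  exact hn (g.clique hy _ (Qc.right hy) _ this hne)

lemma Good.Qc_noedge {G : SimpleGraph V} (g : Good G) {p y z : V} (hy : G.Adj p y) (hz : G.Adj p z)
    (hne : y ≠ z) (hn : ¬ G.Adj y z) {a b : V} (h1 : a ∈ Qc G p y) (h2 : b ∈ Qc G p z) (ha : a ≠ p) (hb : b ≠ p) :
    ¬ G.Adj a b := by
  intro hab
  have hbp := g.clique hz _ h2 _ (Qc.left hz) hb
  have := g.absorb hy h1 (Qc.left hy) ha hab.symm hbp
  exact hb (g.Qc_inter hy hz hne hn this h2)

lemma Good.Qc_adj {G : SimpleGraph V} (g : Good G) {p y a : V} (hy : G.Adj p y) (h : a ∈ Qc G p y) (ha : a ≠ p) :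
    G.Adj p a := g.clique hy _ (Qc.left hy) _ h ha.symm

/-- an outside vertex has at most one neighbour in the clique -/
lemma Good.Qc_one {G : SimpleGraph V} (g : Good G) {x y : V} (h : G.Adj x y) {a b v : V}
    (ha : a ∈ Qc G x y) (hb : b ∈ Qc G x y) (hva : G.Adj v a) (hvb : G.Adj v b) (hv : v ∉ Qc G x y) : a = b := by
  by_contra e
  exact hv (g.absorb h ha hb e hva hvb)

end Paper
end

section
open SimpleGraph
namespace Paper
variable {V : Type*}

/-- hub-free hole of length at least five, indexed periodically -/
structure HF (G : SimpleGraph V) (c : ℤ → V) (n : ℤ) : Prop where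
  five : 5 ≤ n
  eq_iff : ∀ x y, c x = c y ↔ n ∣ x - y
  adj_iff : ∀ x y, G.Adj (c x) (c y) ↔ (n ∣ x - y - 1 ∨ n ∣ x - y + 1)
  hub : ∀ v x y, (∀ z, v ≠ c z) → G.Adj v (c x) → G.Adj v (c y) → c x = c y ∨ G.Adj (c x) (c y)

lemma dvd_small {n z : ℤ} (hn : 5 ≤ n) (h1 : -(2 * n) < z) (h2 : z < 2 * n) :
    n ∣ z ↔ z = 0 ∨ z = n ∨ z = -n := by
  constructor
  · rintro ⟨k, rfl⟩
    have k1 : k < 2 := by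
      by_contra hc
      nlinarith
    have k2 : -2 < k := by
      by_contra hc
      nlinarith
    rcases (by omega : k = -1 ∨ k = 0 ∨ k = 1) with rfl | rfl | rfl <;> simp
  · rintro (rfl | rfl | rfl)
    · exact dvd_zero _
    · exact dvd_refl _
    · exact (dvd_neg).2 (dvd_refl _)

lemma HF.shift {G : SimpleGraph V} {c : ℤ → V} {n : ℤ} (h : HF G c n) (d : ℤ) :
    HF G (fun x => c (x + d)) n := by
  refine ⟨h.five, fun x y => ?_, fun x y => ?_, fun v x y hv h1 h2 => ?_⟩
  · rw [h.eq_iff, show x + d - (y + d) = x - y by ring]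
  · rw [h.adj_iff, show x + d - (y + d) = x - y by ring]
  · refine h.hub v _ _ (fun z => ?_) h1 h2
    have := hv (z - d)
    simpa using this

lemma HF.refl {G : SimpleGraph V} {c : ℤ → V} {n : ℤ} (h : HF G c n) :
    HF G (fun x => c (-x)) n := by
  refine ⟨h.five, fun x y => ?_, fun x y => ?_, fun v x y hv h1 h2 => ?_⟩
  · rw [h.eq_iff, show -x - -y = -(x - y) by ring, dvd_neg]
  · rw [h.adj_iff, show -x - -y - 1 = -(x - y + 1) by ring, show -x - -y + 1 = -(x - y - 1) by ring,
      dvd_neg, dvd_neg, or_comm]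
  · refine h.hub v _ _ (fun z => ?_) h1 h2
    have := hv (- z)
    simpa using this

lemma HF.win {G : SimpleGraph V} {c : ℤ → V} {n : ℤ} (h : HF G c n) (d : ℤ) :
    Cyc G c d (d + n - 1) := by
  have hn := h.five
  refine ⟨by omega, fun x y h1 h2 h3 h4 => ⟨?_, fun e => ?_⟩⟩
  · rw [h.adj_iff, dvd_small hn (by omega) (by omega), dvd_small hn (by omega) (by omega)]
    omega
  · rw [h.eq_iff, dvd_small hn (by omega) (by omega)] at e
    omega

lemma HF.add {G : SimpleGraph V} {c : ℤ → V} {n : ℤ} (h : HF G c n) (x : ℤ) : c (x + n) = c x := by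
  rw [h.eq_iff]; simp

lemma HF.sub {G : SimpleGraph V} {c : ℤ → V} {n : ℤ} (h : HF G c n) (x : ℤ) : c (x - n) = c x := by
  rw [h.eq_iff]; simp

/-- every vertex has an index in the window starting at `d` -/
lemma HF.norm {G : SimpleGraph V} {c : ℤ → V} {n : ℤ} (h : HF G c n) (d z : ℤ) :
    ∃ x, d ≤ x ∧ x ≤ d + n - 1 ∧ ∀ t, c (x + t) = c (z + t) := by
  have hn := h.five
  have h1 := Int.emod_nonneg (z - d) (by omega : n ≠ 0)
  have h2 := Int.emod_lt_of_pos (z - d) (by omega : 0 < n)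
  refine ⟨d + (z - d) % n, by omega, by omega, fun t => ?_⟩
  rw [h.eq_iff]
  have := Int.emod_add_mul_ediv (z - d) n
  exact ⟨-((z - d) / n), by linarith⟩

lemma HF.norm' {G : SimpleGraph V} {c : ℤ → V} {n : ℤ} (h : HF G c n) (d z : ℤ) :
    ∃ x, d ≤ x ∧ x ≤ d + n - 1 ∧ c x = c z := by
  obtain ⟨x, h1, h2, h3⟩ := h.norm d z
  exact ⟨x, h1, h2, by simpa using h3 0⟩

lemma HF.range {G : SimpleGraph V} {c : ℤ → V} {n : ℤ} (h : HF G c n) (d : ℤ) :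
    Set.range c = c '' Set.Icc d (d + n - 1) := by
  ext v
  constructor
  · rintro ⟨z, rfl⟩
    obtain ⟨x, h1, h2, h3⟩ := h.norm' d z
    exact ⟨x, ⟨h1, h2⟩, h3⟩
  · rintro ⟨x, -, rfl⟩; exact ⟨x, rfl⟩

lemma HF.hole {G : SimpleGraph V} {c : ℤ → V} {n : ℤ} (h : HF G c n) : IsHoleSet G (Set.range c) := by
  rw [h.range 0]; exact (h.win 0).hole

lemma HF.succ {G : SimpleGraph V} {c : ℤ → V} {n : ℤ} (h : HF G c n) (x : ℤ) : G.Adj (c x) (c (x + 1)) := by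
  rw [h.adj_iff]; right; ring_nf; exact dvd_zero _

lemma HF.adj_cases {G : SimpleGraph V} {c : ℤ → V} {n : ℤ} (h : HF G c n) {x y : ℤ} (hxy : G.Adj (c x) (c y)) :
    c y = c (x + 1) ∨ c y = c (x - 1) := by
  rw [h.adj_iff] at hxy
  rw [h.eq_iff, h.eq_iff]
  rcases hxy with e | e
  · right; have := (dvd_neg).2 e; rwa [show -(x - y - 1) = y - (x - 1) by ring] at this
  · left; have := (dvd_neg).2 e; rwa [show -(x - y + 1) = y - (x + 1) by ring] at this

lemma HF.E {G : SimpleGraph V} (g : Good G) {c : ℤ → V} {n : ℤ} (h : HF G c n) {l : ℤ → V} {i j : ℤ}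
    (hl : IPath G l i j) (hij : i < j) (hout : ∀ k, i ≤ k → k ≤ j → ∀ x, l k ≠ c x)
    (hinn : ∀ k, i < k → k < j → ∀ x, ¬ G.Adj (l k) (c x))
    (hdis : ∀ x, G.Adj (l i) (c x) → ¬ G.Adj (l j) (c x))
    (hna : ∃ x y, G.Adj (l i) (c x) ∧ G.Adj (l j) (c y) ∧ ¬ G.Adj (c x) (c y)) : False := by
  obtain ⟨x0, y0, hx0, hy0, hxy⟩ := hna
  have hq := hl.shift (i - 1)
  rw [show i - (i - 1) = 1 by ring, show j - (i - 1) = j - i + 1 by ring] at hq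
  refine g.E (Set.range c) (fun k => l (k + (i - 1))) (j - i + 1) {v | v ∈ Set.range c ∧ G.Adj (l i) v}
    {v | v ∈ Set.range c ∧ G.Adj (l j) v} h.hole (by omega) hq ?_ (fun v hv => hv.1) (fun v hv => hv.1)
    ?_ ?_ ?_ ?_ ?_
  · rintro k p1 p2 ⟨x, hx⟩
    exact hout (k + (i - 1)) (by omega) (by omega) x hx.symm
  · rintro _ ⟨⟨x, rfl⟩, hx⟩ _ ⟨⟨y, rfl⟩, hy⟩ hne
    exact (h.hub _ _ _ (hout i (by omega) (by omega)) hx hy).resolve_left hne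
  · rintro _ ⟨⟨x, rfl⟩, hx⟩ _ ⟨⟨y, rfl⟩, hy⟩ hne
    exact (h.hub _ _ _ (hout j (by omega) (by omega)) hx hy).resolve_left hne
  · rintro _ ⟨⟨x, rfl⟩, hx⟩ hy
    exact hdis x hx hy.2
  · exact ⟨c x0, ⟨⟨x0, rfl⟩, hx0⟩, c y0, ⟨⟨y0, rfl⟩, hy0⟩, hxy⟩
  · rintro k _ p1 p2 ⟨x, rfl⟩
    rcases (by omega : k = 1 ∨ k = j - i + 1 ∨ (1 < k ∧ k < j - i + 1)) with rfl | rfl | hk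
    · rw [show (1 : ℤ) + (i - 1) = i by ring]
      constructor
      · intro hh; exact Or.inl ⟨rfl, ⟨x, rfl⟩, hh⟩
      · rintro (⟨-, hh⟩ | ⟨hh, -⟩)
        · exact hh.2
        · omega
    · rw [show j - i + 1 + (i - 1) = j by ring]
      constructor
      · intro hh; exact Or.inr ⟨rfl, ⟨x, rfl⟩, hh⟩
      · rintro (⟨hh, -⟩ | ⟨-, hh⟩)
        · omega
        · exact hh.2
    · constructor
      · intro hh; exact absurd hh (hinn _ (by omega) (by omega) x)
      · rintro (⟨hh, -⟩ | ⟨hh, -⟩) <;> omega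

/-- E with a path of two vertices -/
lemma HF.E2 {G : SimpleGraph V} (g : Good G) {c : ℤ → V} {n : ℤ} (h : HF G c n) {u v : V} (huv : G.Adj u v)
    (hu : ∀ x, u ≠ c x) (hv : ∀ x, v ≠ c x) (hdis : ∀ x, G.Adj u (c x) → ¬ G.Adj v (c x))
    (hna : ∃ x y, G.Adj u (c x) ∧ G.Adj v (c y) ∧ ¬ G.Adj (c x) (c y)) : False := by
  have hl : IPath G (fun k : ℤ => if k ≤ 1 then u else v) 1 (1 + 1) := by
    refine IPath.snoc (f := fun _ => u) (IPath.single _ _ _) v ?_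
    intro x p1 p2
    exact ⟨⟨fun _ => by omega, fun _ => huv.symm⟩, huv.ne'⟩
  refine h.E g hl (by omega) ?_ (by omega) ?_ ?_
  · intro k p1 p2 x
    split_ifs
    · exact hu x
    · exact hv x
  · simpa using hdis
  · simpa using hna

/-- the maximal cliques along the hole -/
def Q (G : SimpleGraph V) (c : ℤ → V) (i : ℤ) : Set V := Qc G (c i) (c (i + 1))

def Z (G : SimpleGraph V) (c : ℤ → V) : Set V := {v | ∃ i, v ∈ Q G c i}

lemma HF.Q_congr {G : SimpleGraph V} {c : ℤ → V} {n : ℤ} (h : HF G c n) {i j : ℤ} (e : c i = c j) :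
    Q G c i = Q G c j := by
  have : c (i + 1) = c (j + 1) := by
    rw [h.eq_iff] at e ⊢; convert e using 1; ring
  rw [Q, Q, e, this]

lemma HF.mem0 {G : SimpleGraph V} {c : ℤ → V} {n : ℤ} (h : HF G c n) (i : ℤ) : c i ∈ Q G c i :=
  Qc.left (h.succ i)

lemma HF.mem1 {G : SimpleGraph V} {c : ℤ → V} {n : ℤ} (h : HF G c n) (i : ℤ) : c (i + 1) ∈ Q G c i :=
  Qc.right (h.succ i)

lemma HF.mem1' {G : SimpleGraph V} {c : ℤ → V} {n : ℤ} (h : HF G c n) (i : ℤ) : c i ∈ Q G c (i - 1) := by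
  have := h.mem1 (i - 1)
  rwa [sub_add_cancel] at this

lemma HF.memZ {G : SimpleGraph V} {c : ℤ → V} {n : ℤ} (h : HF G c n) (i : ℤ) : c i ∈ Z G c := ⟨i, h.mem0 i⟩

lemma HF.cl {G : SimpleGraph V} (g : Good G) {c : ℤ → V} {n : ℤ} (h : HF G c n) (i : ℤ) :
    ∀ a ∈ Q G c i, ∀ b ∈ Q G c i, a ≠ b → G.Adj a b := g.clique (h.succ i)

lemma HF.no_common {G : SimpleGraph V} {c : ℤ → V} {n : ℤ} (h : HF G c n) {i x : ℤ}
    (h1 : G.Adj (c x) (c i)) (h2 : G.Adj (c x) (c (i + 1))) : False := by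
  have hn := h.five
  obtain ⟨y, y1, y2, y3⟩ := h.norm' (i - 1) x
  rw [← y3] at h1 h2
  have w := (h.win (i - 1)).2
  rw [(w y i (by omega) (by omega) (by omega) (by omega)).1] at h1
  rw [(w y (i + 1) (by omega) (by omega) (by omega) (by omega)).1] at h2
  omega

lemma HF.z1 {G : SimpleGraph V} {c : ℤ → V} {n : ℤ} (h : HF G c n) {i : ℤ} {z : V} (hz : z ∈ Q G c i)
    (hzH : ∀ x, z ≠ c x) (x : ℤ) : G.Adj z (c x) ↔ (c x = c i ∨ c x = c (i + 1)) := by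
  have a1 : G.Adj z (c i) := hz.1.resolve_left (hzH i)
  have a2 : G.Adj z (c (i + 1)) := hz.2.resolve_left (hzH (i + 1))
  constructor
  · intro hx
    rcases h.hub z x i hzH hx a1 with e | e
    · exact Or.inl e
    rcases h.hub z x (i + 1) hzH hx a2 with e' | e'
    · exact Or.inr e'
    exact absurd (h.no_common e e') id
  · rintro (e | e)
    · rw [e]; exact a1
    · rw [e]; exact a2

lemma HF.z2 {G : SimpleGraph V} {c : ℤ → V} {n : ℤ} (h : HF G c n) {i x : ℤ} (hz : c x ∈ Q G c i) :
    c x = c i ∨ c x = c (i + 1) := by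
  rcases hz.1 with e | e
  · exact Or.inl e
  rcases hz.2 with e' | e'
  · exact Or.inr e'
  exact absurd (h.no_common e e') id

lemma HF.ne_of_not_Z {G : SimpleGraph V} {c : ℤ → V} {n : ℤ} (h : HF G c n) {v : V} (hv : v ∉ Z G c) (x : ℤ) :
    v ≠ c x := by
  rintro rfl; exact hv (h.memZ x)

lemma HF.pair_Q {G : SimpleGraph V} {c : ℤ → V} {n : ℤ} (h : HF G c n) {v : V} {x y : ℤ}
    (h1 : G.Adj v (c x)) (h2 : G.Adj v (c y)) (hxy : G.Adj (c x) (c y)) :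
    (v ∈ Q G c x ∧ c y = c (x + 1)) ∨ (v ∈ Q G c y ∧ c x = c (y + 1)) := by
  rcases h.adj_cases hxy with e | e
  · left; refine ⟨⟨Or.inr h1, Or.inr (e ▸ h2)⟩, e⟩
  · right
    have e' : c x = c (y + 1) := by
      rw [h.eq_iff] at e ⊢; have := (dvd_neg).2 e; rwa [show -(y - (x - 1)) = x - (y + 1) by ring] at this
    exact ⟨⟨Or.inr h2, Or.inr (e' ▸ h1)⟩, e'⟩

lemma HF.z3 {G : SimpleGraph V} {c : ℤ → V} {n : ℤ} (h : HF G c n) {v : V} (hv : v ∉ Z G c) {x y : ℤ}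
    (h1 : G.Adj v (c x)) (h2 : G.Adj v (c y)) : c x = c y := by
  rcases h.hub v x y (h.ne_of_not_Z hv) h1 h2 with e | e
  · exact e
  · rcases h.pair_Q h1 h2 e with ⟨q, -⟩ | ⟨q, -⟩
    · exact absurd ⟨_, q⟩ hv
    · exact absurd ⟨_, q⟩ hv

lemma HF.pair_inj {G : SimpleGraph V} {c : ℤ → V} {n : ℤ} (h : HF G c n) {i j : ℤ}
    (h1 : c i = c j ∨ c i = c (j + 1)) (h2 : c (i + 1) = c j ∨ c (i + 1) = c (j + 1)) : c i = c j := by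
  have hn := h.five
  obtain ⟨y, y1, y2, y3⟩ := h.norm (i - 1) j
  have e0 : c y = c j := by simpa using y3 0
  have e1 : c (y + 1) = c (j + 1) := y3 1
  rw [← e0, ← e1] at h1 h2
  have w := (h.win (i - 1)).2
  rcases h1 with h1 | h1
  · rw [h1, e0]
  · rcases h2 with h2 | h2
    · have := (w (i + 1) y (by omega) (by omega) (by omega) (by omega)).2 h2
      subst this
      exfalso
      have := (w i (i + 2) (by omega) (by omega) (by omega) (by omega)).2 (by rw [h1]; congr 1; ring)
      omega
    · have := h1.trans h2.symm
      have := (w i (i + 1) (by omega) (by omega) (by omega) (by omega)).2 this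
      omega

lemma HF.z4 {G : SimpleGraph V} (g : Good G) {c : ℤ → V} {n : ℤ} (h : HF G c n) {i j : ℤ} {z z' : V}
    (hz : z ∈ Q G c i) (hz' : z' ∈ Q G c j) (hzH : ∀ x, z ≠ c x) (hzH' : ∀ x, z' ≠ c x)
    (hzz : z = z' ∨ G.Adj z z') : c i = c j := by
  have b1 := h.z1 hz hzH
  have b2 := h.z1 hz' hzH'
  rcases hzz with rfl | hadj
  · exact h.pair_inj ((b2 i).1 ((b1 i).2 (Or.inl rfl))) ((b2 (i + 1)).1 ((b1 (i + 1)).2 (Or.inr rfl)))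
  · by_contra hij
    by_cases hdis : ∀ x, G.Adj z (c x) → ¬ G.Adj z' (c x)
    · refine h.E2 g hadj hzH hzH' hdis ?_
      by_contra hcon
      push Not at hcon
      have a1 := hcon i j ((b1 i).2 (Or.inl rfl)) ((b2 j).2 (Or.inl rfl))
      have a2 := hcon i (j + 1) ((b1 i).2 (Or.inl rfl)) ((b2 (j + 1)).2 (Or.inr rfl))
      exact h.no_common a1 a2
    · push Not at hdis
      obtain ⟨x, x1, x2⟩ := hdis
      have hx' : c x ∈ Q G c j := by
        rcases (b2 x).1 x2 with e | e <;> rw [e]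
        · exact h.mem0 j
        · exact h.mem1 j
      have : z ∈ Q G c j := g.absorb (h.succ j) hz' hx' (hzH' x) hadj x1
      have b3 := h.z1 this hzH
      exact hij (h.pair_inj ((b3 i).1 ((b1 i).2 (Or.inl rfl))) ((b3 (i + 1)).1 ((b1 (i + 1)).2 (Or.inr rfl))))

lemma HF.alpha {G : SimpleGraph V} (g : Good G) {c : ℤ → V} {n : ℤ} (h : HF G c n) {v z : V} {x : ℤ}
    (hv : v ∉ Z G c) (hz : z ∈ Z G c) (hzH : ∀ x, z ≠ c x) (h1 : G.Adj v (c x)) (h2 : G.Adj v z) : False := by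
  obtain ⟨i, hi⟩ := hz
  have b := h.z1 hi hzH
  by_cases hc : c x = c i ∨ c x = c (i + 1)
  · apply hv
    have hx' : c x ∈ Q G c i := by
      rcases hc with e | e <;> rw [e]
      · exact h.mem0 i
      · exact h.mem1 i
    exact ⟨i, g.absorb (h.succ i) hi hx' (hzH x) h2 h1⟩
  · refine h.E2 g h2 (h.ne_of_not_Z hv) hzH ?_ ?_
    · intro y hy hzy
      have := h.z3 hv hy h1
      rw [b, this] at hzy
      exact hc hzy
    · by_contra hcon
      push Not at hcon
      exact h.no_common (hcon x i h1 ((b i).2 (Or.inl rfl))) (hcon x (i + 1) h1 ((b (i + 1)).2 (Or.inr rfl)))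

lemma hf_of_cyc {G : SimpleGraph V} {f : ℤ → V} {n : ℤ} (hn : 5 ≤ n) (hc : Cyc G f 0 (n - 1))
    (hub : ∀ v x y, (∀ z, 0 ≤ z → z ≤ n - 1 → v ≠ f z) → 0 ≤ x → x ≤ n - 1 → 0 ≤ y → y ≤ n - 1 →
      G.Adj v (f x) → G.Adj v (f y) → f x = f y ∨ G.Adj (f x) (f y)) :
    HF G (fun x => f (x % n)) n := by
  have e1 : ∀ x : ℤ, 0 ≤ x % n := fun x => Int.emod_nonneg x (by omega)
  have e2 : ∀ x : ℤ, x % n ≤ n - 1 := fun x => by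
    have := Int.emod_lt_of_pos x (by omega : 0 < n); omega
  have tr : ∀ x y t : ℤ, n ∣ x - y + t ↔ n ∣ x % n - y % n + t := by
    intro x y t
    have h1 := Int.emod_add_mul_ediv x n
    have h2 := Int.emod_add_mul_ediv y n
    have : x - y + t = n * (x / n - y / n) + (x % n - y % n + t) := by
      rw [mul_sub]; linarith
    rw [this]
    exact dvd_add_right (dvd_mul_right _ _)
  refine ⟨hn, fun x y => ?_, fun x y => ?_, fun v x y hv h1 h2 => ?_⟩
  · have := e1 x; have := e2 x; have := e1 y; have := e2 y
    have t := tr x y 0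
    rw [add_zero, add_zero] at t
    rw [t, dvd_small hn (by omega) (by omega)]
    constructor
    · intro e
      have := (hc.2 _ _ (e1 x) (e2 x) (e1 y) (e2 y)).2 e
      omega
    · intro e
      have : x % n = y % n := by omega
      rw [this]
  · have := e1 x; have := e2 x; have := e1 y; have := e2 y
    have t := tr x y (-1)
    rw [show x - y - 1 = x - y + -1 by ring, t, tr x y 1, dvd_small hn (by omega) (by omega),
      dvd_small hn (by omega) (by omega), (hc.2 _ _ (e1 x) (e2 x) (e1 y) (e2 y)).1]
    omega
  · refine hub v _ _ (fun z p1 p2 => ?_) (e1 x) (e2 x) (e1 y) (e2 y) h1 h2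
    have := hv z
    rwa [Int.emod_eq_of_lt p1 (by omega)] at this

/-- constructor: vertex `p` plus a path -/
lemma hf_of_path {G : SimpleGraph V} {f : ℤ → V} {p : V} {i j : ℤ} (hij : i + 3 ≤ j) (hf : IPath G f i j)
    (hp : ∀ k, i ≤ k → k ≤ j → p ≠ f k) (hpa : ∀ k, i ≤ k → k ≤ j → (G.Adj p (f k) ↔ (k = i ∨ k = j)))
    (hub : ∀ v x y, v ≠ p → (∀ z, i ≤ z → z ≤ j → v ≠ f z) → i ≤ x → x ≤ j → i ≤ y → y ≤ j →
      G.Adj v (f x) → G.Adj v (f y) → f x = f y ∨ G.Adj (f x) (f y))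
    (hub' : ∀ v x, v ≠ p → (∀ z, i ≤ z → z ≤ j → v ≠ f z) → i ≤ x → x ≤ j →
      G.Adj v (f x) → G.Adj v p → G.Adj p (f x)) :
    ∃ c, HF G c (j - i + 2) ∧ c 0 = p ∧ (∀ k, 1 ≤ k → k ≤ j - i + 1 → c k = f (i + k - 1)) := by
  obtain ⟨F, hF⟩ : ∃ F : ℤ → V, F = fun x => if x = 0 then p else f (i + x - 1) := ⟨_, rfl⟩
  have F0 : F 0 = p := by simp [hF]
  have F1 : ∀ k, 1 ≤ k → F k = f (i + k - 1) := by
    intro k hk; rw [hF]; dsimp only; rw [if_neg (by omega)]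
  have hC : Cyc G F 0 (j - i + 2 - 1) := by
    refine ⟨by omega, fun x y p1 p2 p3 p4 => ?_⟩
    rcases (by omega : x = 0 ∨ 1 ≤ x) with rfl | hx <;> rcases (by omega : y = 0 ∨ 1 ≤ y) with rfl | hy
    · simp; omega
    · rw [F0, F1 y hy, hpa _ (by omega) (by omega)]
      exact ⟨by omega, fun e => absurd e (hp _ (by omega) (by omega))⟩
    · rw [F0, F1 x hx, G.adj_comm, hpa _ (by omega) (by omega)]
      exact ⟨by omega, fun e => absurd e.symm (hp _ (by omega) (by omega))⟩
    · rw [F1 x hx, F1 y hy, hf.adj (by omega) (by omega) (by omega) (by omega)]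
      refine ⟨by omega, fun e => ?_⟩
      have := hf.inj (by omega) (by omega) (by omega) (by omega) e
      omega
  have hH := hf_of_cyc (by omega) hC ?_
  · refine ⟨_, hH, ?_, ?_⟩
    · simp [F0]
    · intro k h1 h2
      rw [Int.emod_eq_of_lt (by omega) (by omega), F1 k h1]
  · intro v x y hv p1 p2 p3 p4 h1 h2
    have v0 : v ≠ p := by have := hv 0 (by omega) (by omega); rwa [F0] at this
    have v1 : ∀ z, i ≤ z → z ≤ j → v ≠ f z := by
      intro z q1 q2
      have := hv (z - i + 1) (by omega) (by omega)
      rwa [F1 _ (by omega), show i + (z - i + 1) - 1 = z by ring] at this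
    rcases (by omega : x = 0 ∨ 1 ≤ x) with rfl | hx <;> rcases (by omega : y = 0 ∨ 1 ≤ y) with rfl | hy
    · left; rfl
    · right; rw [F0, F1 y hy] at *
      exact hub' v _ v0 v1 (by omega) (by omega) h2 h1
    · right; rw [F0, F1 x hx] at *
      exact (hub' v _ v0 v1 (by omega) (by omega) h1 h2).symm
    · rw [F1 x hx, F1 y hy] at *
      exact hub v _ _ v0 v1 (by omega) (by omega) (by omega) (by omega) h1 h2

end Paper
end

section
open SimpleGraph
namespace Paper
variable {V : Type*}

/-- number of positions in `[i,j]` adjacent to `p` -/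
noncomputable def cnt (G : SimpleGraph V) (p : V) (l : ℤ → V) (i j : ℤ) : ℕ :=
  {k : ℤ | i ≤ k ∧ k ≤ j ∧ G.Adj p (l k)}.ncard

lemma cnt_fin (G : SimpleGraph V) (p : V) (l : ℤ → V) (i j : ℤ) :
    {k : ℤ | i ≤ k ∧ k ≤ j ∧ G.Adj p (l k)}.Finite :=
  (Set.finite_Icc i j).subset (fun _ hk => ⟨hk.1, hk.2.1⟩)

lemma cnt_split (G : SimpleGraph V) (p : V) (l : ℤ → V) {i m j : ℤ} (h1 : i ≤ m + 1) (h2 : m ≤ j) :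
    cnt G p l i j = cnt G p l i m + cnt G p l (m + 1) j := by
  unfold cnt
  rw [← Set.ncard_union_eq ?_ (cnt_fin _ _ _ _ _) (cnt_fin _ _ _ _ _)]
  · congr 1
    ext k
    constructor
    · rintro ⟨a1, a2, a3⟩
      by_cases h : k ≤ m
      · exact Or.inl ⟨a1, h, a3⟩
      · exact Or.inr ⟨by omega, a2, a3⟩
    · rintro (⟨a1, a2, a3⟩ | ⟨a1, a2, a3⟩)
      · exact ⟨a1, by omega, a3⟩
      · exact ⟨by omega, a2, a3⟩
  · rw [Set.disjoint_left]
    rintro k ⟨-, a2, -⟩ ⟨a1, -, -⟩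
    omega

lemma cnt_zero {G : SimpleGraph V} {p : V} {l : ℤ → V} {i j : ℤ}
    (h : ∀ k, i ≤ k → k ≤ j → ¬ G.Adj p (l k)) : cnt G p l i j = 0 := by
  unfold cnt
  rw [Set.ncard_eq_zero (cnt_fin _ _ _ _ _), Set.eq_empty_iff_forall_notMem]
  rintro k ⟨a1, a2, a3⟩
  exact h k a1 a2 a3

lemma cnt_ne_zero {G : SimpleGraph V} {p : V} {l : ℤ → V} {i j : ℤ}
    (h : cnt G p l i j ≠ 0) : ∃ k, i ≤ k ∧ k ≤ j ∧ G.Adj p (l k) := by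
  by_contra hc
  push Not at hc
  exact h (cnt_zero hc)

lemma cnt_one {G : SimpleGraph V} {p : V} {l : ℤ → V} {i j k0 : ℤ}
    (h : ∀ k, i ≤ k → k ≤ j → (G.Adj p (l k) ↔ k = k0)) (h1 : i ≤ k0) (h2 : k0 ≤ j) : cnt G p l i j = 1 := by
  unfold cnt
  rw [Set.ncard_eq_one]
  refine ⟨k0, ?_⟩
  ext k
  constructor
  · rintro ⟨a1, a2, a3⟩; exact (h k a1 a2).1 a3
  · rintro rfl; exact ⟨h1, h2, (h _ h1 h2).2 rfl⟩

lemma count_path {G : SimpleGraph V} {p : V} {l : ℤ → V} {i j : ℤ} (hl : IPath G l i j) {U : Set V} (hU : U.Finite)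
    (hd : ∀ k, i ≤ k → k ≤ j → l k ∉ U) :
    (nbrsIn G (l '' Set.Icc i j ∪ U) p).ncard = cnt G p l i j + (nbrsIn G U p).ncard := by
  have e : nbrsIn G (l '' Set.Icc i j ∪ U) p =
      l '' {k : ℤ | i ≤ k ∧ k ≤ j ∧ G.Adj p (l k)} ∪ nbrsIn G U p := by
    ext v
    constructor
    · rintro ⟨⟨k, ⟨a1, a2⟩, rfl⟩ | h1, h2⟩
      · exact Or.inl ⟨k, ⟨a1, a2, h2⟩, rfl⟩
      · exact Or.inr ⟨h1, h2⟩
    · rintro (⟨k, ⟨a1, a2, a3⟩, rfl⟩ | ⟨h1, h2⟩)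
      · exact ⟨Or.inl ⟨k, ⟨a1, a2⟩, rfl⟩, a3⟩
      · exact ⟨Or.inr h1, h2⟩
  rw [e, Set.ncard_union_eq ?_ ((cnt_fin _ _ _ _ _).image _) (hU.subset (fun v hv => hv.1)),
    Set.ncard_image_of_injOn, cnt]
  · rintro x ⟨a1, a2, -⟩ y ⟨b1, b2, -⟩ exy
    exact hl.inj a1 a2 b1 b2 exy
  · rw [Set.disjoint_left]
    rintro _ ⟨k, ⟨a1, a2, -⟩, rfl⟩ hv
    exact hd k a1 a2 hv.1

lemma exists_max_int {P : ℤ → Prop} {i j x : ℤ} (h1 : i ≤ x) (h2 : x ≤ j) (hx : P x) :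
    ∃ y, x ≤ y ∧ y ≤ j ∧ P y ∧ ∀ z, y < z → z ≤ j → ¬ P z := by
  classical
  obtain ⟨n, hn⟩ : ∃ n : ℕ, (n : ℤ) = j - x := ⟨(j - x).toNat, by omega⟩
  clear h1
  induction n using Nat.strong_induction_on generalizing x with
  | _ n ih =>
    by_cases hc : ∃ z, x < z ∧ z ≤ j ∧ P z
    · obtain ⟨z, z1, z2, z3⟩ := hc
      obtain ⟨y, y1, y2, y3, y4⟩ := ih (j - z).toNat (by omega) z2 z3 (by omega)
      exact ⟨y, by omega, y2, y3, y4⟩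
    · push Not at hc
      exact ⟨x, le_refl _, h2, hx, hc⟩

lemma exists_min_int {P : ℤ → Prop} {i x : ℤ} (h1 : i ≤ x) (hx : P x) :
    ∃ y, i ≤ y ∧ y ≤ x ∧ P y ∧ ∀ z, i ≤ z → z < y → ¬ P z := by
  obtain ⟨y, y1, y2, y3, y4⟩ := exists_max_int (P := fun z => P (-z)) (i := -x) (j := -i) (x := -x)
    (le_refl _) (by omega) (by simpa using hx)
  refine ⟨-y, by omega, by omega, y3, fun z z1 z2 hz => y4 (-z) (by omega) (by omega) (by simpa using hz)⟩

lemma Ppp {G : SimpleGraph V} (g : Good G) {c : ℤ → V} {n : ℤ} (h : HF G c n) {l : ℤ → V} {lo hi : ℤ}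
    (hle : lo ≤ hi) (hl : IPath G l lo hi) (hout : ∀ k, lo ≤ k → k ≤ hi → ∀ x, l k ≠ c x)
    (h1 : ∀ k, lo ≤ k → k ≤ hi → (G.Adj (l k) (c (n - 1)) ↔ k = lo))
    (h2 : ∀ k x, lo ≤ k → k ≤ hi → 2 ≤ x → x ≤ n - 2 → G.Adj (l k) (c x) → k = hi)
    (h3 : ∃ x, 2 ≤ x ∧ x ≤ n - 3 ∧ G.Adj (l hi) (c x))
    (h4 : ∀ k, lo ≤ k → k ≤ hi → G.Adj (l k) (c 0) → ¬ G.Adj (l k) (c 1)) : False := by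
  have hn := h.five
  obtain ⟨x0, x01, x02, x03⟩ := h3
  have w := (h.win 0).2
  have cadj : ∀ x y, 0 ≤ x → x ≤ n - 1 → 0 ≤ y → y ≤ n - 1 →
      (G.Adj (c x) (c y) ↔ (y = x + 1 ∨ x = y + 1 ∨ (x = 0 ∧ y = n - 1) ∨ (x = n - 1 ∧ y = 0))) := by
    intro x y p1 p2 p3 p4
    rw [(w x y p1 (by omega) p3 (by omega)).1]; omega
  have cinj : ∀ x y, 0 ≤ x → x ≤ n - 1 → 0 ≤ y → y ≤ n - 1 → c x = c y → x = y := by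
    intro x y p1 p2 p3 p4
    exact (w x y p1 (by omega) p3 (by omega)).2
  have hub : ∀ k x y, lo ≤ k → k ≤ hi → 0 ≤ x → x ≤ n - 1 → 0 ≤ y → y ≤ n - 1 →
      G.Adj (l k) (c x) → G.Adj (l k) (c y) →
      (x = y ∨ y = x + 1 ∨ x = y + 1 ∨ (x = 0 ∧ y = n - 1) ∨ (x = n - 1 ∧ y = 0)) := by
    intro k x y q1 q2 p1 p2 p3 p4 e1 e2
    rcases h.hub _ x y (hout k q1 q2) e1 e2 with e | e
    · exact Or.inl (cinj x y p1 p2 p3 p4 e)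
    · exact Or.inr ((cadj x y p1 p2 p3 p4).1 e)
  have hlt : lo < hi := by
    rcases (by omega : lo = hi ∨ lo < hi) with e | e
    · have := hub hi (n - 1) x0 (by omega) (by omega) (by omega) (by omega) (by omega) (by omega)
        ((h1 hi (by omega) (by omega)).2 e.symm) x03
      omega
    · exact e
  have nlo1 : ¬ G.Adj (l lo) (c 1) := fun e => by
    have := hub lo (n - 1) 1 (by omega) (by omega) (by omega) (by omega) (by omega) (by omega)
        ((h1 lo (by omega) (by omega)).2 rfl) e
    omega
  have nhi0 : ¬ G.Adj (l hi) (c 0) := fun e => by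
    have := hub hi 0 x0 (by omega) (by omega) (by omega) (by omega) (by omega) (by omega) e x03
    omega
  -- all attachments of an interior vertex
  have att : ∀ k x, lo ≤ k → k < hi → 0 ≤ x → x ≤ n - 1 → G.Adj (l k) (c x) → x = 0 ∨ x = 1 ∨ (x = n - 1 ∧ k = lo) := by
    intro k x p1 p2 p3 p4 e
    by_contra hc
    by_cases e1 : x = n - 1
    · subst e1
      have := (h1 k p1 (by omega)).1 e
      omega
    · have := h2 k x p1 (by omega) (by omega) (by omega) e
      omega
  -- first b hole
  have fin : ∀ i j, (c '' Set.Icc i j).Finite := fun i j => (Set.finite_Icc i j).image c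
  have cpath : ∀ i, 1 ≤ i → IPath G c i (n - 1) := by
    intro i hi x y p1 p2 p3 p4
    exact ⟨(cadj x y (by omega) (by omega) (by omega) (by omega)).trans (by omega),
      cinj x y (by omega) (by omega) (by omega) (by omega)⟩
  have lnc : ∀ k, lo ≤ k → k ≤ hi → ∀ i j, l k ∉ c '' Set.Icc i j := by
    rintro k p1 p2 i j ⟨x, -, e⟩
    exact hout k p1 p2 x e.symm
  have c0ne : ∀ k, lo ≤ k → k ≤ hi → c 0 ≠ l k := fun k p1 p2 e => hout k p1 p2 0 e.symm
  have nb1 : (nbrsIn G (c '' Set.Icc 1 (n - 1)) (c 0)).ncard = 2 := by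
    have : nbrsIn G (c '' Set.Icc 1 (n - 1)) (c 0) = {c 1, c (n - 1)} := by
      ext v
      constructor
      · rintro ⟨⟨x, ⟨p1, p2⟩, rfl⟩, e⟩
        rw [cadj _ _ (by omega) (by omega) (by omega) (by omega)] at e
        rcases (by omega : x = 1 ∨ x = n - 1) with rfl | rfl
        · exact Or.inl rfl
        · exact Or.inr rfl
      · rintro (rfl | rfl)
        · exact ⟨⟨1, ⟨by omega, by omega⟩, rfl⟩, (cadj _ _ (by omega) (by omega) (by omega) (by omega)).2 (by omega)⟩
        · exact ⟨⟨n - 1, ⟨by omega, by omega⟩, rfl⟩, (cadj _ _ (by omega) (by omega) (by omega) (by omega)).2 (by omega)⟩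
    rw [this, Set.ncard_pair]
    intro e
    have := cinj _ _ (by omega) (by omega) (by omega) (by omega) e
    omega
  have first : ∀ b, lo ≤ b → b < hi → G.Adj (l b) (c 1) → (∀ k, lo ≤ k → k < b → ¬ G.Adj (l k) (c 1)) →
      IsHoleSet G (l '' Set.Icc lo b ∪ c '' Set.Icc 1 (n - 1)) ∧
      c 0 ∉ (l '' Set.Icc lo b ∪ c '' Set.Icc 1 (n - 1)) ∧
      (nbrsIn G (l '' Set.Icc lo b ∪ c '' Set.Icc 1 (n - 1)) (c 0)).ncard = cnt G (c 0) l lo b + 2 := by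
    intro b p1 p2 hb hf
    refine ⟨?_, ?_, ?_⟩
    · refine hole2 (hl.sub (le_refl _) (by omega)) (cpath 1 (by omega)) p1 (by omega) (by omega) ?_
      intro k x q1 q2 q3 q4
      refine ⟨⟨fun e => ?_, ?_⟩, hout k q1 (by omega) x⟩
      · have := att k x q1 (by omega) (by omega) q4 e
        by_cases hkb : k = b
        · omega
        · have hk1 := hf k q1 (by omega)
          have : x ≠ 1 := by rintro rfl; exact hk1 e
          omega
      · rintro (⟨rfl, rfl⟩ | ⟨rfl, rfl⟩)
        · exact hb
        · exact (h1 _ (by omega) (by omega)).2 rfl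
    · rintro (⟨k, ⟨q1, q2⟩, e⟩ | ⟨x, ⟨q1, q2⟩, e⟩)
      · exact hout k q1 (by omega) 0 e
      · have := cinj x 0 (by omega) (by omega) (by omega) (by omega) e
        omega
    · rw [count_path (hl.sub (le_refl _) (by omega)) (fin _ _) (fun k q1 q2 => lnc k q1 (by omega) _ _), nb1]
  have hm1 : ∀ b : ℤ, c 1 ∈ (l '' Set.Icc lo b ∪ c '' Set.Icc 1 (n - 1)) :=
    fun b => Or.inr ⟨1, ⟨by omega, by omega⟩, rfl⟩
  have hmn : ∀ b : ℤ, c (n - 1) ∈ (l '' Set.Icc lo b ∪ c '' Set.Icc 1 (n - 1)) :=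
    fun b => Or.inr ⟨n - 1, ⟨by omega, by omega⟩, rfl⟩
  have a01 : G.Adj (c 0) (c 1) := (cadj _ _ (by omega) (by omega) (by omega) (by omega)).2 (by omega)
  have a0n : G.Adj (c 0) (c (n - 1)) := (cadj _ _ (by omega) (by omega) (by omega) (by omega)).2 (by omega)
  -- claim
  have claim : ∀ m : ℕ, ∀ b, (b - lo).toNat = m → lo ≤ b → b < hi → G.Adj (l b) (c 1) → Odd (cnt G (c 0) l lo b) := by
    intro m
    induction m using Nat.strong_induction_on with
    | _ m ih =>
      intro b hbm p1 p2 hb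
      by_cases hf : ∀ k, lo ≤ k → k < b → ¬ G.Adj (l k) (c 1)
      · obtain ⟨f1, f2, f3⟩ := first b p1 p2 hb hf
        rw [← Nat.not_even_iff_odd]
        intro hev
        have := g.even _ _ f1 f2 (by rw [f3]; exact hev.add even_two) (c 1) (c (n - 1)) (hm1 b) (hmn b) a01 a0n
        rcases this with e | e
        · have := cinj _ _ (by omega) (by omega) (by omega) (by omega) e; omega
        · rw [cadj _ _ (by omega) (by omega) (by omega) (by omega)] at e; omega
      · push Not at hf
        obtain ⟨k, k1, k2, k3⟩ := hf
        obtain ⟨b', b1, b2, b3, b4⟩ := exists_max_int (P := fun k => G.Adj (l k) (c 1)) (i := lo) (j := b - 1) (x := k)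
          k1 (by omega) k3
        have ih' := ih (b' - lo).toNat (by omega) b' rfl (by omega) (by omega) b3
        have nb' : ¬ G.Adj (c 0) (l b') := fun e => h4 b' (by omega) (by omega) e.symm b3
        rw [cnt_split G (c 0) l (m := b') (by omega) (by omega)]
        suffices hev : Even (cnt G (c 0) l (b' + 1) b) from ih'.add_even hev
        by_cases hbb : b = b' + 1
        · rw [cnt_zero]
          · exact Even.zero
          · intro k q1 q2 e
            have : k = b := by omega
            subst this
            exact h4 k (by omega) (by omega) e.symm hb
        · have hcc : cnt G (c 0) l b' b = cnt G (c 0) l (b' + 1) b := by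
            rw [cnt_split G (c 0) l (m := b') (by omega) (by omega), cnt_zero (i := b') (j := b')]
            · simp
            · intro k q1 q2
              have : k = b' := by omega
              subst this; exact nb'
          rw [← hcc]
          by_contra hodd
          rw [Nat.not_even_iff_odd] at hodd
          have hS : IsHoleSet G (l '' Set.Icc b' b ∪ (fun _ : ℤ => c 1) '' Set.Icc 0 0) := by
            refine hole2 (hl.sub (by omega) (by omega)) (IPath.single _ _ _) (by omega) (by omega) (by omega) ?_
            intro k x q1 q2 q3 q4
            refine ⟨⟨fun e => ?_, ?_⟩, hout k (by omega) (by omega) 1⟩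
            · have := b4 k
              by_contra hc
              exact this (by omega) (by omega) e
            · rintro (⟨rfl, -⟩ | ⟨rfl, -⟩)
              · exact hb
              · exact b3
          have hU : (fun _ : ℤ => c 1) '' Set.Icc 0 0 = {c 1} := by
            ext v; simp [eq_comm]
          rw [hU] at hS
          have hnb : (nbrsIn G ({c 1} : Set V) (c 0)).ncard = 1 := by
            rw [Set.ncard_eq_one]
            refine ⟨c 1, ?_⟩
            ext v
            constructor
            · rintro ⟨e, -⟩; exact e
            · rintro rfl; exact ⟨rfl, a01⟩
          have hcount := count_path (p := c 0) (hl.sub (i' := b') (j' := b) (by omega) (by omega)) (Set.finite_singleton (c 1))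
            (fun k q1 q2 e => hout k (by omega) (by omega) 1 e)
          rw [hnb] at hcount
          have h0S : c 0 ∉ l '' Set.Icc b' b ∪ {c 1} := by
            rintro (⟨k, ⟨q1, q2⟩, e⟩ | e)
            · exact hout k (by omega) (by omega) 0 e
            · have := cinj 0 1 (by omega) (by omega) (by omega) (by omega) e; omega
          obtain ⟨k, q1, q2, q3⟩ := cnt_ne_zero (fun e => by rw [e] at hodd; exact absurd hodd (by decide) :
            cnt G (c 0) l b' b ≠ 0)
          have := g.even _ _ hS h0S (by rw [hcount]; exact hodd.add_one) (l k) (c 1) (Or.inl ⟨k, ⟨q1, q2⟩, rfl⟩)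
            (Or.inr rfl) q3 a01
          rcases this with e | e
          · exact hout k (by omega) (by omega) 1 e
          · exact h4 k (by omega) (by omega) q3.symm e
  -- an `a` exists
  by_cases hA : ∃ k, lo ≤ k ∧ k ≤ hi ∧ G.Adj (l k) (c 0)
  · obtain ⟨k0, k1, k2, k3⟩ := hA
    obtain ⟨a, a1, a2, a3, a4⟩ := exists_max_int (P := fun k => G.Adj (l k) (c 0)) k1 k2 k3
    have ahi : a < hi := by
      rcases (by omega : a < hi ∨ a = hi) with e | e
      · exact e
      · subst e; exact absurd a3 nhi0
    by_cases hB : ∃ b, a < b ∧ b < hi ∧ G.Adj (l b) (c 1)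
    · obtain ⟨B, B1, B2, B3⟩ := hB
      -- all a before B
      have hodd := claim _ B rfl (by omega) B2 B3
      have hcA : cnt G (c 0) l lo hi = cnt G (c 0) l lo B := by
        rw [cnt_split G (c 0) l (m := B) (by omega) (by omega), cnt_zero (i := B + 1)]
        · simp
        · intro k q1 q2 e
          exact a4 k (by omega) q2 e.symm
      obtain ⟨β, β1, β2, β3, β4⟩ := exists_max_int (P := fun x => G.Adj (l hi) (c x)) (j := n - 2) x01 (by omega) x03
      have hS : IsHoleSet G (l '' Set.Icc lo hi ∪ c '' Set.Icc β (n - 1)) := by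
        refine hole2 hl (cpath β (by omega)) (by omega) (by omega) (by omega) ?_
        intro k x q1 q2 q3 q4
        refine ⟨⟨fun e => ?_, ?_⟩, hout k q1 (by omega) x⟩
        · by_cases e1 : x = n - 1
          · subst e1
            have := (h1 k q1 q2).1 e
            omega
          · have := h2 k x q1 q2 (by omega) (by omega) e
            subst this
            have : ¬ β < x := fun hx => β4 x hx (by omega) e
            omega
        · rintro (⟨rfl, rfl⟩ | ⟨rfl, rfl⟩)
          · exact β3
          · exact (h1 _ (by omega) (by omega)).2 rfl
      have h0S : c 0 ∉ l '' Set.Icc lo hi ∪ c '' Set.Icc β (n - 1) := by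
        rintro (⟨k, ⟨q1, q2⟩, e⟩ | ⟨x, ⟨q1, q2⟩, e⟩)
        · exact hout k q1 (by omega) 0 e
        · have := cinj x 0 (by omega) (by omega) (by omega) (by omega) e
          omega
      have hnb : (nbrsIn G (c '' Set.Icc β (n - 1)) (c 0)).ncard = 1 := by
        rw [Set.ncard_eq_one]
        refine ⟨c (n - 1), ?_⟩
        ext v
        constructor
        · rintro ⟨⟨x, ⟨q1, q2⟩, rfl⟩, e⟩
          rw [cadj _ _ (by omega) (by omega) (by omega) (by omega)] at e
          have : x = n - 1 := by omega
          rw [this]; rfl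
        · rintro rfl; exact ⟨⟨n - 1, ⟨by omega, by omega⟩, rfl⟩, a0n⟩
      have hcount := count_path (p := c 0) hl (fin β (n - 1)) (fun k q1 q2 => lnc k q1 q2 _ _)
      rw [hnb, hcA] at hcount
      have honly : ∀ k, lo ≤ k → k ≤ hi → G.Adj (c 0) (l k) → k = lo := by
        intro k q1 q2 e
        have := g.even _ _ hS h0S (by rw [hcount]; exact hodd.add_one) (l k) (c (n - 1)) (Or.inl ⟨k, ⟨q1, q2⟩, rfl⟩)
          (Or.inr ⟨n - 1, ⟨by omega, by omega⟩, rfl⟩) e a0n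
        rcases this with e | e
        · exact absurd e (hout k q1 q2 _)
        · exact (h1 k q1 q2).1 e
      have hlo : G.Adj (c 0) (l lo) := by
        have := honly a (by omega) (by omega) a3.symm
        rw [← this]; exact a3.symm
      obtain ⟨b, b1, b2, b3, b4⟩ := exists_min_int (P := fun k => G.Adj (l k) (c 1)) (i := lo) (x := B) (by omega) B3
      obtain ⟨f1, f2, f3⟩ := first b b1 (by omega) b3 b4
      have hc1 : cnt G (c 0) l lo b = 1 := by
        apply cnt_one (k0 := lo) _ (le_refl _) b1
        intro k q1 q2
        exact ⟨honly k q1 (by omega), fun e => by rw [e]; exact hlo⟩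
      rw [hc1] at f3
      exact g.three _ _ f1 f2 f3 (l lo) (c (n - 1)) (Or.inl ⟨lo, ⟨le_refl _, b1⟩, rfl⟩) (hmn b) hlo a0n
        ((h1 lo (le_refl _) hle).2 rfl)
    · push Not at hB
      refine h.E g (hl.sub (i' := a) (by omega) (le_refl _)) ahi (fun k q1 q2 => hout k (by omega) q2) ?_ ?_ ?_
      · intro k q1 q2 x e
        obtain ⟨y, y1, y2, y3⟩ := h.norm' 0 x
        rw [← y3] at e
        rcases att k y (by omega) q2 y1 (by omega) e with rfl | rfl | ⟨-, h5⟩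
        · exact a4 k q1 (by omega) e
        · exact hB k q1 q2 e
        · omega
      · intro x e e'
        obtain ⟨y, y1, y2, y3⟩ := h.norm' 0 x
        rw [← y3] at e e'
        rcases att a y (by omega) ahi y1 (by omega) e with rfl | rfl | ⟨rfl, h5⟩
        · exact nhi0 e'
        · exact h4 a (by omega) (by omega) a3 e
        · have := (h1 hi (by omega) (by omega)).1 e'
          omega
      · refine ⟨0, x0, a3, x03, ?_⟩
        rw [cadj _ _ (by omega) (by omega) (by omega) (by omega)]; omega
  · push Not at hA
    have hB : ∀ b, lo ≤ b → b < hi → ¬ G.Adj (l b) (c 1) := by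
      intro b b1 b2 e
      have := claim _ b rfl b1 b2 e
      rw [cnt_zero] at this
      · exact absurd this (by decide)
      · intro k q1 q2 e'
        exact hA k q1 (by omega) e'.symm
    refine h.E g hl hlt hout ?_ ?_ ?_
    · intro k q1 q2 x e
      obtain ⟨y, y1, y2, y3⟩ := h.norm' 0 x
      rw [← y3] at e
      rcases att k y (by omega) q2 y1 (by omega) e with rfl | rfl | ⟨-, h5⟩
      · exact hA k (by omega) (by omega) e
      · exact hB k (by omega) q2 e
      · omega
    · intro x e e'
      obtain ⟨y, y1, y2, y3⟩ := h.norm' 0 x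
      rw [← y3] at e e'
      rcases att lo y (by omega) hlt y1 (by omega) e with rfl | rfl | ⟨rfl, h5⟩
      · exact hA lo (by omega) (by omega) e
      · exact nlo1 e
      · have := (h1 hi (by omega) (by omega)).1 e'
        omega
    · refine ⟨n - 1, x0, (h1 lo (by omega) (by omega)).2 rfl, x03, ?_⟩
      rw [cadj _ _ (by omega) (by omega) (by omega) (by omega)]; omega

end Paper
end

section
open SimpleGraph
namespace Paper
variable {V : Type*}

lemma Pp {G : SimpleGraph V} (g : Good G) {c : ℤ → V} {n : ℤ} (h : HF G c n) {l : ℤ → V} {r : ℤ}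
    (hr : 1 ≤ r) (hl : IPath G l 1 r) (hZ : ∀ k, 1 ≤ k → k ≤ r → l k ∉ Z G c) {u w : V}
    (hu : u ∈ Q G c (-1)) (hu0 : u ≠ c 0) (hua : ∀ k, 1 ≤ k → k ≤ r → (G.Adj u (l k) ↔ k = 1))
    (hA : ∀ k, 1 ≤ k → k ≤ r → G.Adj (l k) (c (-1)) → k = 1)
    (hwZ : w ∈ Z G c) (hw1 : w ∉ Q G c (-1)) (hw0 : w ∉ Q G c 0)
    (hwa : ∀ k, 1 ≤ k → k ≤ r → (G.Adj w (l k) ↔ k = r))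
    (hW : ∀ k x, 1 ≤ k → k ≤ r → 2 ≤ x → x ≤ n - 2 → G.Adj (l k) (c x) → k = r) : w ∈ Q G c (-2) := by
  by_contra hw2
  have hn := h.five
  have win := (h.win 0).2
  have cadj : ∀ x y, 0 ≤ x → x ≤ n - 1 → 0 ≤ y → y ≤ n - 1 →
      (G.Adj (c x) (c y) ↔ (y = x + 1 ∨ x = y + 1 ∨ (x = 0 ∧ y = n - 1) ∨ (x = n - 1 ∧ y = 0))) := by
    intro x y p1 p2 p3 p4
    rw [(win x y p1 (by omega) p3 (by omega)).1]; omega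
  have cinj : ∀ x y, 0 ≤ x → x ≤ n - 1 → 0 ≤ y → y ≤ n - 1 → c x = c y → x = y := by
    intro x y p1 p2 p3 p4
    exact (win x y p1 (by omega) p3 (by omega)).2
  have cm1 : c (n - 1) = c (-1) := by rw [h.eq_iff]; exact ⟨1, by ring⟩
  have cm2 : c (n - 2) = c (-2) := by rw [h.eq_iff]; exact ⟨1, by ring⟩
  have qm1 : Q G c (n - 1) = Q G c (-1) := h.Q_congr cm1
  have qm2 : Q G c (n - 2) = Q G c (-2) := h.Q_congr cm2
  have cn : c n = c 0 := by rw [h.eq_iff]; exact ⟨1, by ring⟩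
  have uH : (∃ x, u = c x) → u = c (-1) := by
    rintro ⟨x, rfl⟩
    rcases h.z2 hu with e | e
    · exact e
    · exact absurd e (by simpa using hu0)
  have un : (∀ x, u ≠ c x) → ∀ x, G.Adj u (c x) ↔ c x = c (-1) ∨ c x = c 0 := by
    intro e x
    simpa using h.z1 hu e x
  have wH : (∃ x, w = c x) → ∃ x, 2 ≤ x ∧ x ≤ n - 3 ∧ w = c x := by
    rintro ⟨x, rfl⟩
    obtain ⟨y, y1, y2, y3⟩ := h.norm' 0 x
    rw [← y3] at hw1 hw0 hw2 ⊢
    refine ⟨y, ?_, ?_, rfl⟩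
    · by_contra hy
      rcases (by omega : y = 0 ∨ y = 1) with rfl | rfl
      · exact hw0 (h.mem0 _)
      · exact hw0 (h.mem1 0)
    · by_contra hy
      rcases (by omega : y = n - 1 ∨ y = n - 2) with rfl | rfl
      · rw [cm1] at hw1; exact hw1 (h.mem0 _)
      · rw [cm2] at hw2; exact hw2 (h.mem0 _)
  have wn : (∀ x, w ≠ c x) → ∃ j, 1 ≤ j ∧ j ≤ n - 3 ∧ ∀ x, 0 ≤ x → x ≤ n - 1 → (G.Adj w (c x) ↔ x = j ∨ x = j + 1) := by
    intro e
    obtain ⟨i, hi⟩ := hwZ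
    obtain ⟨y, y1, y2, y3⟩ := h.norm' 0 i
    rw [← h.Q_congr y3] at hi
    have : 1 ≤ y ∧ y ≤ n - 3 := by
      by_contra hy
      rcases (by omega : y = 0 ∨ y = n - 1 ∨ y = n - 2) with rfl | rfl | rfl
      · exact hw0 hi
      · exact hw1 (qm1 ▸ hi)
      · exact hw2 (qm2 ▸ hi)
    refine ⟨y, this.1, this.2, fun x x1 x2 => ?_⟩
    rw [h.z1 hi e]
    constructor
    · rintro (e | e)
      · exact Or.inl (cinj _ _ (by omega) (by omega) (by omega) (by omega) e)
      · exact Or.inr (cinj _ _ (by omega) (by omega) (by omega) (by omega) e)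
    · rintro (rfl | rfl)
      · exact Or.inl rfl
      · exact Or.inr rfl
  have uw : ¬ G.Adj u w ∧ u ≠ w := by
    by_cases e1 : ∃ x, u = c x
    · have := uH e1
      rw [this]
      refine ⟨fun e => ?_, fun e => hw1 (e ▸ h.mem0 _)⟩
      by_cases e2 : ∃ x, w = c x
      · obtain ⟨x, x1, x2, rfl⟩ := wH e2
        rw [← cm1, cadj _ _ (by omega) (by omega) (by omega) (by omega)] at e
        omega
      · push Not at e2
        obtain ⟨j, j1, j2, j3⟩ := wn e2
        rw [← cm1, G.adj_comm, j3 _ (by omega) (by omega)] at e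
        omega
    · push Not at e1
      refine ⟨fun e => ?_, fun e => hw1 (e ▸ hu)⟩
      by_cases e2 : ∃ x, w = c x
      · obtain ⟨x, x1, x2, rfl⟩ := wH e2
        rw [un e1, ← cm1] at e
        rcases e with e | e
        · have := cinj _ _ (by omega) (by omega) (by omega) (by omega) e
          omega
        · have := cinj _ _ (by omega) (by omega) (by omega) (by omega) e
          omega
      · push Not at e2
        have hwZ' := hwZ
        obtain ⟨i, hi⟩ := hwZ'
        have := h.z4 g hu hi e1 e2 (Or.inr e)
        exact hw1 (h.Q_congr this ▸ hi)
  have uZ : u ∈ Z G c := ⟨_, hu⟩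
  -- the long path
  have P1 := hl.snoc w (fun x x1 x2 => ⟨hwa x x1 x2, fun e => hZ x x1 x2 (e ▸ hwZ)⟩)
  have P2 := P1.cons u (fun x x1 x2 => by
    by_cases hx : x ≤ r
    · rw [if_pos hx]; exact ⟨hua x x1 hx, fun e => hZ x x1 hx (e ▸ uZ)⟩
    · rw [if_neg hx]; exact ⟨⟨fun e => absurd e uw.1, by omega⟩, uw.2⟩)
  obtain ⟨f, hf⟩ : ∃ f : ℤ → V, f = fun x => if x ≤ 1 - 1 then u else if x ≤ r then l x else w := ⟨_, rfl⟩
  have P3 : IPath G f 0 (r + 1) := by rw [hf]; simpa using P2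
  have f0 : f 0 = u := by simp [hf]
  have fm : ∀ k, 1 ≤ k → k ≤ r → f k = l k := by
    intro k k1 k2; rw [hf]; dsimp only; rw [if_neg (by omega), if_pos k2]
  have fr : f (r + 1) = w := by
    rw [hf]; dsimp only; rw [if_neg (by omega), if_neg (by omega)]
  obtain ⟨lo, hlo⟩ : ∃ lo : ℤ, (lo = 0 ∧ ∀ x, u ≠ c x) ∨ (lo = 1 ∧ u = c (-1)) := by
    by_cases e1 : ∃ x, u = c x
    · exact ⟨1, Or.inr ⟨rfl, uH e1⟩⟩
    · push Not at e1; exact ⟨0, Or.inl ⟨rfl, e1⟩⟩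
  obtain ⟨hi, hhi⟩ : ∃ hi : ℤ, (hi = r + 1 ∧ ∀ x, w ≠ c x) ∨ (hi = r ∧ ∃ x, 2 ≤ x ∧ x ≤ n - 3 ∧ w = c x) := by
    by_cases e1 : ∃ x, w = c x
    · exact ⟨r, Or.inr ⟨rfl, wH e1⟩⟩
    · push Not at e1; exact ⟨r + 1, Or.inl ⟨rfl, e1⟩⟩
  have lo01 : lo = 0 ∨ lo = 1 := by rcases hlo with e | e; exact Or.inl e.1; exact Or.inr e.1
  have hi01 : hi = r + 1 ∨ hi = r := by rcases hhi with e | e; exact Or.inl e.1; exact Or.inr e.1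
  have cases3 : ∀ k, lo ≤ k → k ≤ hi → (k = 0 ∧ lo = 0 ∧ f k = u ∧ ∀ x, u ≠ c x) ∨
      (1 ≤ k ∧ k ≤ r ∧ f k = l k) ∨ (k = r + 1 ∧ hi = r + 1 ∧ f k = w ∧ ∀ x, w ≠ c x) := by
    intro k k1 k2
    rcases (by omega : k = 0 ∨ (1 ≤ k ∧ k ≤ r) ∨ k = r + 1) with rfl | e | rfl
    · left
      rcases hlo with e | e
      · exact ⟨rfl, e.1, f0, e.2⟩
      · omega
    · exact Or.inr (Or.inl ⟨e.1, e.2, fm k e.1 e.2⟩)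
    · right; right
      rcases hhi with e | e
      · exact ⟨rfl, e.1, fr, e.2⟩
      · omega
  refine Ppp g h (l := f) (lo := lo) (hi := hi) (by omega) (P3.sub (by omega) (by omega)) ?_ ?_ ?_ ?_ ?_
  · intro k k1 k2 x
    rcases cases3 k k1 k2 with ⟨-, -, e, e'⟩ | ⟨a1, a2, e⟩ | ⟨-, -, e, e'⟩ <;> rw [e]
    · exact e' x
    · exact h.ne_of_not_Z (hZ k a1 a2) x
    · exact e' x
  · intro k k1 k2
    rcases cases3 k k1 k2 with ⟨b1, b2, e, e'⟩ | ⟨a1, a2, e⟩ | ⟨b1, b2, e, e'⟩ <;> rw [e]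
    · constructor
      · intro _; omega
      · intro _; rw [un e', cm1]; exact Or.inl rfl
    · rcases hlo with ⟨q1, q2⟩ | ⟨q1, q2⟩
      · constructor
        · intro ha
          rw [cm1] at ha
          have := hA k a1 a2 ha
          subst this
          exact absurd ((hua 1 (by omega) (by omega)).2 rfl) (fun hh => h.alpha g (hZ 1 (by omega) hr) uZ q2 ha hh.symm)
        · omega
      · rw [cm1]
        have := hua k a1 a2
        rw [q2] at this
        rw [G.adj_comm, this, q1]
    · constructor
      · intro ha
        obtain ⟨j, j1, j2, j3⟩ := wn e'
        rw [j3 _ (by omega) (by omega)] at ha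
        omega
      · omega
  · intro k x k1 k2 x1 x2 ha
    rcases cases3 k k1 k2 with ⟨b1, b2, e, e'⟩ | ⟨a1, a2, e⟩ | ⟨b1, b2, e, e'⟩ <;> rw [e] at ha
    · rw [un e', ← cm1] at ha
      rcases ha with ha | ha
      · have := cinj _ _ (by omega) (by omega) (by omega) (by omega) ha; omega
      · have := cinj _ _ (by omega) (by omega) (by omega) (by omega) ha; omega
    · have := hW k x a1 a2 x1 x2 ha
      subst this
      rcases hhi with ⟨q1, q2⟩ | ⟨q1, q2⟩
      · exact absurd ((hwa k (by omega) (by omega)).2 rfl) (fun hh => h.alpha g (hZ k a1 a2) hwZ q2 ha hh.symm)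
      · omega
    · omega
  · rcases hhi with ⟨rfl, q2⟩ | ⟨rfl, x, x1, x2, q2⟩
    · obtain ⟨j, j1, j2, j3⟩ := wn q2
      rw [fr]
      by_cases hj : j = 1
      · exact ⟨2, by omega, by omega, (j3 _ (by omega) (by omega)).2 (by omega)⟩
      · exact ⟨j, by omega, by omega, (j3 _ (by omega) (by omega)).2 (by omega)⟩
    · refine ⟨x, x1, x2, ?_⟩
      rw [fm _ hr (le_refl _), ← q2]
      exact ((hwa _ hr (le_refl _)).2 rfl).symm
  · intro k k1 k2 ha hb
    rcases cases3 k k1 k2 with ⟨b1, b2, e, e'⟩ | ⟨a1, a2, e⟩ | ⟨b1, b2, e, e'⟩ <;> rw [e] at ha hb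
    · rw [un e', ← cm1] at hb
      rcases hb with ha | ha
      · have := cinj _ _ (by omega) (by omega) (by omega) (by omega) ha; omega
      · have := cinj _ _ (by omega) (by omega) (by omega) (by omega) ha; omega
    · have := cinj _ _ (by omega) (by omega) (by omega) (by omega) (h.z3 (hZ k a1 a2) ha hb)
      omega
    · obtain ⟨j, j1, j2, j3⟩ := wn e'
      rw [j3 _ (by omega) (by omega)] at ha
      omega

end Paper
end

section
open SimpleGraph
namespace Paper
variable {V : Type*}

lemma Qc_comm (G : SimpleGraph V) (x y : V) : Qc G x y = Qc G y x := by
  ext z; exact and_comm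

lemma Q_shift (G : SimpleGraph V) (c : ℤ → V) (d i : ℤ) : Q G (fun x => c (x + d)) i = Q G c (i + d) := by
  unfold Q; dsimp only; rw [show i + 1 + d = i + d + 1 by ring]

lemma Z_shift (G : SimpleGraph V) (c : ℤ → V) (d : ℤ) : Z G (fun x => c (x + d)) = Z G c := by
  ext v
  constructor
  · rintro ⟨i, hi⟩; rw [Q_shift] at hi; exact ⟨_, hi⟩
  · rintro ⟨i, hi⟩; refine ⟨i - d, ?_⟩; rw [Q_shift, sub_add_cancel]; exact hi

lemma Q_refl (G : SimpleGraph V) (c : ℤ → V) (i : ℤ) : Q G (fun x => c (-x)) i = Q G c (-i - 1) := by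
  unfold Q; dsimp only; rw [Qc_comm, show -(i + 1) = -i - 1 by ring, show -i - 1 + 1 = -i by ring]

lemma Z_refl (G : SimpleGraph V) (c : ℤ → V) : Z G (fun x => c (-x)) = Z G c := by
  ext v
  constructor
  · rintro ⟨i, hi⟩; rw [Q_refl] at hi; exact ⟨_, hi⟩
  · rintro ⟨i, hi⟩; refine ⟨-i - 1, ?_⟩; rw [Q_refl, show -(-i - 1) - 1 = i by ring]; exact hi

lemma HF.clique_pair {G : SimpleGraph V} {c : ℤ → V} {n : ℤ} (h : HF G c n) (S : V → Prop)
    (hS : ∀ x y, S (c x) → S (c y) → c x = c y ∨ G.Adj (c x) (c y)) :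
    ∃ i, ∀ x, S (c x) → c x = c i ∨ c x = c (i + 1) := by
  by_cases h0 : ∃ x, S (c x)
  swap
  · push Not at h0; exact ⟨0, fun x hx => absurd hx (h0 x)⟩
  obtain ⟨x, hx⟩ := h0
  by_cases h1 : ∃ y, S (c y) ∧ G.Adj (c x) (c y)
  swap
  · push Not at h1
    exact ⟨x, fun y hy => Or.inl ((hS y x hy hx).resolve_right (fun e => h1 y hy e.symm))⟩
  obtain ⟨y, hy, hxy⟩ := h1
  have key : ∀ i, S (c i) → S (c (i + 1)) → ∀ x, S (c x) → c x = c i ∨ c x = c (i + 1) := by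
    intro i h1 h2 x hx
    rcases hS x i hx h1 with e | e
    · exact Or.inl e
    rcases hS x (i + 1) hx h2 with e' | e'
    · exact Or.inr e'
    exact absurd (h.no_common e e') id
  rcases h.adj_cases hxy with e | e
  · exact ⟨x, key x hx (e ▸ hy)⟩
  · exact ⟨x - 1, key (x - 1) (e ▸ hy) (by rw [sub_add_cancel]; exact hx)⟩

/-- a vertex of `Z` adjacent to the path before its vertex seeing `c 0` -/
lemma A2b {G : SimpleGraph V} (g : Good G) {c : ℤ → V} {n : ℤ} (h : HF G c n) {q : ℤ → V} {j k : ℤ} {w : V} {m : ℤ}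
    (hjk : j < k) (hq : IPath G q j k) (hZ : ∀ t, j ≤ t → t ≤ k → q t ∉ Z G c) (hw : w ∈ Q G c m)
    (hwH : ∀ x, w ≠ c x) (hw1 : w ∉ Q G c (-1)) (hw0 : w ∉ Q G c 0) (hwj : G.Adj w (q j)) (hk : G.Adj (q k) (c 0))
    (hat : ∀ t x, j ≤ t → t ≤ k → G.Adj (q t) (c x) → c x = c 0) : False := by
  have wZ : w ∈ Z G c := ⟨m, hw⟩
  obtain ⟨j1, p1, p2, p3, p4⟩ := exists_max_int (P := fun t => G.Adj w (q t)) (i := j) (j := k) (le_refl _) (by omega) hwj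
  have jk1 : j1 < k := by
    by_contra hc
    obtain rfl : j1 = k := by omega
    exact h.alpha g (hZ j1 p1 p2) wZ hwH hk p3.symm
  obtain ⟨k1, r1, r2, r3, r4⟩ := exists_min_int (P := fun t => G.Adj (q t) (c 0)) (i := j1) (x := k) (by omega) hk
  have jk2 : j1 < k1 := by
    by_contra hc
    obtain rfl : j1 = k1 := by omega
    exact h.alpha g (hZ j1 p1 p2) wZ hwH r3 p3.symm
  have hl := (hq.sub p1 r2).cons w (fun x x1 x2 => ⟨⟨fun e => by
    by_contra hx
    exact p4 x (by omega) (by omega) e, fun e => e ▸ p3⟩, fun e => hZ x (by omega) (by omega) (e ▸ wZ)⟩)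
  have w0 : ¬ G.Adj w (c 0) := by
    rw [h.z1 hw hwH]
    rintro (e | e)
    · exact hw0 (h.Q_congr e ▸ hw)
    · have : c (-1) = c m := by
        rw [h.eq_iff] at e ⊢; convert e using 1; ring
      exact hw1 (h.Q_congr this ▸ hw)
  refine h.E g hl (by omega) ?_ ?_ ?_ ?_
  · intro t t1 t2 x
    by_cases ht : t ≤ j1 - 1
    · rw [if_pos ht]; exact hwH x
    · rw [if_neg ht]; exact h.ne_of_not_Z (hZ t (by omega) (by omega)) x
  · intro t t1 t2 x e
    rw [if_neg (by omega)] at e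
    have := hat t x (by omega) (by omega) e
    rw [this] at e
    exact r4 t (by omega) t2 e
  · intro x e e'
    rw [if_pos (by omega)] at e
    rw [if_neg (by omega)] at e'
    have := hat k1 x (by omega) (by omega) e'
    rw [this] at e
    exact w0 e
  · have a1 : G.Adj w (c m) := hw.1.resolve_left (hwH m)
    have a2 : G.Adj w (c (m + 1)) := hw.2.resolve_left (hwH (m + 1))
    by_cases e : G.Adj (c m) (c 0)
    · refine ⟨m + 1, 0, ?_, ?_, fun e' => h.no_common e.symm e'.symm⟩
      · rw [if_pos (by omega)]; exact a2
      · rw [if_neg (by omega)]; exact r3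
    · refine ⟨m, 0, ?_, ?_, e⟩
      · rw [if_pos (by omega)]; exact a1
      · rw [if_neg (by omega)]; exact r3

lemma A3a {G : SimpleGraph V} (g : Good G) {c : ℤ → V} {n : ℤ} (h : HF G c n) {D : Set V} {t w u a : V}
    (hD : Conn G D) (hZ : ∀ v ∈ D, v ∉ Z G c) (ha : a ∈ D) (hu : u ∈ Q G c (-1)) (hu0 : u ≠ c 0) (hau : G.Adj a u)
    (ht : t ∈ D) (hwZ : w ∈ Z G c) (hw1 : w ∉ Q G c (-1)) (hw0 : w ∉ Q G c 0) (htw : G.Adj t w)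
    (huni : ∀ v ∈ D, ∀ w ∈ Z G c, w ∉ Q G c (-1) → w ∉ Q G c 0 → G.Adj v w → v = t) : w ∈ Q G c (-2) := by
  have hn := h.five
  obtain ⟨m, hm⟩ := hD a ha t ht
  obtain ⟨s, q, s1, hq, hX, hA, hB, -⟩ := SP (fun v => ∃ u, u ∈ Q G c (-1) ∧ u ≠ c 0 ∧ G.Adj v u)
    (fun v => v = t) hm ⟨u, hu, hu0, hau⟩ rfl
  obtain ⟨u', u1, u2, u3⟩ := (hA 1 (by omega) s1).2 rfl
  have hst : q s = t := (hB s s1 (le_refl _)).2 rfl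
  refine Pp g h s1 hq (fun k k1 k2 => hZ _ (hX k k1 k2)) u1 u2 ?_ ?_ hwZ hw1 hw0 ?_ ?_
  · intro k k1 k2
    constructor
    · intro e; exact (hA k k1 k2).1 ⟨u', u1, u2, e.symm⟩
    · rintro rfl; exact u3.symm
  · intro k k1 k2 e
    refine (hA k k1 k2).1 ⟨_, h.mem0 _, fun e => ?_, e⟩
    have := (h.win (-1)).2 (-1) 0 (by omega) (by omega) (by omega) (by omega)
    have := this.2 e
    omega
  · intro k k1 k2
    rw [← hB k k1 k2]
    constructor
    · intro e; exact huni _ (hX k k1 k2) w hwZ hw1 hw0 e.symm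
    · intro e; rw [e]; exact htw.symm
  · intro k x k1 k2 x1 x2 e
    rw [← hB k k1 k2]
    have wi := (h.win (-1)).2
    refine huni _ (hX k k1 k2) (c x) (h.memZ x) ?_ ?_ e
    · intro e
      rcases h.z2 e with e | e
      · have := (wi _ _ (by omega) (by omega) (by omega) (by omega)).2 e; omega
      · have := (wi _ _ (by omega) (by omega) (by omega) (by omega)).2 e; omega
    · intro e
      rcases h.z2 e with e | e
      · have := (wi _ _ (by omega) (by omega) (by omega) (by omega)).2 e; omega
      · have := (wi _ _ (by omega) (by omega) (by omega) (by omega)).2 e; omega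

lemma A3 {G : SimpleGraph V} (g : Good G) {c : ℤ → V} {n : ℤ} (h : HF G c n) {F Y : Set V} {a u b u' : V}
    (hF : Conn G F) (hZ : ∀ v ∈ F, v ∉ Z G c) (hY : Conn G Y) (hYF : Y ⊆ F)
    (ha : a ∈ Y) (hu : u ∈ Q G c (-1)) (hu0 : u ≠ c 0) (hau : G.Adj a u)
    (hb : b ∈ Y) (hu' : u' ∈ Q G c 0) (hu0' : u' ≠ c 0) (hbu : G.Adj b u')
    (hno : ∀ v ∈ Y, ∀ w ∈ Z G c, w ∉ Q G c (-1) → w ∉ Q G c 0 → ¬ G.Adj v w) :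
    ∀ v ∈ F, ∀ w ∈ Z G c, w ∉ Q G c (-1) → w ∉ Q G c 0 → ¬ G.Adj v w := by
  intro v hv w hwZ hw1 hw0 hvw
  have hn := h.five
  obtain ⟨m, hm⟩ := hF a (hYF ha) v hv
  obtain ⟨s, q, s1, hq, hX, hA, hB, -⟩ := SP (fun v => v ∈ Y)
    (fun v => ∃ w ∈ Z G c, w ∉ Q G c (-1) ∧ w ∉ Q G c 0 ∧ G.Adj v w) hm ha ⟨w, hwZ, hw1, hw0, hvw⟩
  obtain ⟨w', w1, w2, w3, w4⟩ := (hB s s1 (le_refl _)).2 rfl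
  have hD : Conn G (Y ∪ q '' Set.Icc 1 s) :=
    hY.union hq.conn ⟨_, (hA 1 (le_refl _) s1).2 rfl, q 1, ⟨1, ⟨le_refl _, s1⟩, rfl⟩, Or.inl rfl⟩
  have hDZ : ∀ v ∈ Y ∪ q '' Set.Icc 1 s, v ∉ Z G c := by
    rintro v (hv | ⟨k, ⟨k1, k2⟩, rfl⟩)
    · exact hZ _ (hYF hv)
    · exact hZ _ (hX k k1 k2)
  have huni : ∀ v ∈ Y ∪ q '' Set.Icc 1 s, ∀ w ∈ Z G c, w ∉ Q G c (-1) → w ∉ Q G c 0 → G.Adj v w → v = q s := by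
    rintro v (hv | ⟨k, ⟨k1, k2⟩, rfl⟩) w a1 a2 a3 a4
    · exact absurd a4 (hno v hv w a1 a2 a3)
    · rw [(hB k k1 k2).1 ⟨w, a1, a2, a3, a4⟩]
  have hs : q s ∈ Y ∪ q '' Set.Icc 1 s := Or.inr ⟨s, ⟨s1, le_refl _⟩, rfl⟩
  have c1 := A3a g h hD hDZ (Or.inl ha) hu hu0 hau hs w1 w2 w3 w4 huni
  have c2 : w' ∈ Q G c 1 := by
    have := A3a g h.refl (D := Y ∪ q '' Set.Icc 1 s) (t := q s) (w := w') (u := u') (a := b) hD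
      (by rw [Z_refl]; exact hDZ) (Or.inl hb) (by rw [Q_refl]; exact hu') hu0' hbu hs
      (by rw [Z_refl]; exact w1) (by rw [Q_refl]; exact w3) (by rw [Q_refl]; exact w2) w4
      (by rw [Z_refl, Q_refl, Q_refl]; exact fun v hv w a1 a2 a3 a4 => huni v hv w a1 a3 a2 a4)
    rw [Q_refl] at this
    exact this
  have wi := (h.win (-2)).2
  by_cases hH : ∃ x, w' = c x
  · obtain ⟨x, rfl⟩ := hH
    rcases h.z2 c1 with e | e <;> rcases h.z2 c2 with e' | e' <;> rw [e] at e'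
    all_goals
      have := (wi _ _ (by omega) (by omega) (by omega) (by omega)).2 e'; omega
  · push Not at hH
    have e := h.z4 g c1 c2 hH hH (Or.inl rfl)
    have := (wi _ _ (by omega) (by omega) (by omega) (by omega)).2 e; omega

end Paper
end

section
open SimpleGraph
namespace Paper
variable {V : Type*}

lemma A2 {G : SimpleGraph V} (g : Good G) {c : ℤ → V} {n : ℤ} (h : HF G c n) {F X : Set V} 
    (hF : Conn G F) (hZ : ∀ v ∈ F, v ∉ Z G c) (hXF : ∀ v ∈ X, v ∈ F ∨ (v ∈ Z G c ∧ ∀ x, v ≠ c x))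
    {q : ℤ → V} {s : ℤ} (hs : 2 ≤ s) (hq : IPath G q 1 s) (hX : ∀ k, 1 ≤ k → k ≤ s → q k ∈ X)
    (star : ∀ a b x y, 1 ≤ a → a ≤ s → 1 ≤ b → b ≤ s → G.Adj (q a) (c x) → G.Adj (q b) (c y) → c x ≠ c y →
      ¬ G.Adj (c x) (c y) → (a = 1 ∧ b = s) ∨ (a = s ∧ b = 1))
    (h1 : G.Adj (q 1) (c (-1))) (hs1 : G.Adj (q s) (c 1))
    (hp : (∃ k, 1 < k ∧ k < s ∧ G.Adj (q k) (c 0)) ∨ (G.Adj (q 1) (c 0) ∧ G.Adj (q s) (c 0))) :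
    ∀ v ∈ F, ∀ w ∈ Z G c, w ∉ Q G c (-1) → w ∉ Q G c 0 → ¬ G.Adj v w := by
  have hn := h.five
  have wi := (h.win (-1)).2
  have wadj : ∀ x y, -1 ≤ x → x ≤ n - 2 → -1 ≤ y → y ≤ n - 2 → (G.Adj (c x) (c y) ↔ y = x + 1 ∨ x = y + 1 ∨
      x = -1 ∧ y = n - 2 ∨ x = n - 2 ∧ y = -1) := by
    intro x y a1 a2 a3 a4
    rw [(wi x y a1 (by omega) a3 (by omega)).1]; omega
  have winj : ∀ x y, -1 ≤ x → x ≤ n - 2 → -1 ≤ y → y ≤ n - 2 → c x = c y → x = y := by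
    intro x y a1 a2 a3 a4
    exact (wi x y a1 (by omega) a3 (by omega)).2
  have qH : ∀ k, 1 ≤ k → k ≤ s → ∀ x, q k ≠ c x := by
    intro k k1 k2
    rcases hXF _ (hX k k1 k2) with e | e
    · exact h.ne_of_not_Z (hZ _ e)
    · exact e.2
  have near : ∀ x y, c x = c y ∨ G.Adj (c x) (c y) ∨ (c x ≠ c y ∧ ¬ G.Adj (c x) (c y)) := by
    intro x y; tauto
  have int : ∀ k x, 1 < k → k < s → -1 ≤ x → x ≤ n - 2 → G.Adj (q k) (c x) → x = 0 := by
    intro k x k1 k2 x1 x2 e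
    have e1 : x = -1 ∨ x = 0 ∨ x = n - 2 := by
      rcases near x (-1) with e' | e' | e'
      · have := winj _ _ (by omega) (by omega) (by omega) (by omega) e'; omega
      · rw [wadj _ _ (by omega) (by omega) (by omega) (by omega)] at e'; omega
      · have := star k 1 x (-1) (by omega) (by omega) (by omega) (by omega) e h1 e'.1 e'.2; omega
    rcases near x 1 with e' | e' | e'
    · have := winj _ _ (by omega) (by omega) (by omega) (by omega) e'; omega
    · rw [wadj _ _ (by omega) (by omega) (by omega) (by omega)] at e'; omega
    · have := star k s x 1 (by omega) (by omega) (by omega) (by omega) e hs1 e'.1 e'.2; omega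
  have hub : ∀ k x y, 1 ≤ k → k ≤ s → -1 ≤ x → x ≤ n - 2 → -1 ≤ y → y ≤ n - 2 → G.Adj (q k) (c x) → G.Adj (q k) (c y) →
     x = y ∨ y = x + 1 ∨ x = y + 1 ∨ x = -1 ∧ y = n - 2 ∨ x = n - 2 ∧ y = -1 := by
    intro k x y k1 k2 x1 x2 y1 y2 e e'
    rcases h.hub _ x y (qH k k1 k2) e e' with a | a
    · exact Or.inl (winj _ _ x1 x2 y1 y2 a)
    · exact Or.inr ((wadj _ _ x1 x2 y1 y2).1 a)
  have end1 : ∀ x, -1 ≤ x → x ≤ n - 2 → G.Adj (q 1) (c x) → x = -1 ∨ x = 0 := by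
    intro x x1 x2 e
    have := hub 1 x (-1) (by omega) (by omega) x1 x2 (by omega) (by omega) e h1
    by_contra hc
    have hx : x = n - 2 := by omega
    rcases hp with ⟨k, k1, k2, k3⟩ | ⟨k3, -⟩
    · have := star 1 k x 0 (by omega) (by omega) (by omega) (by omega) e k3 (fun e' => by
        have := winj _ _ (by omega) (by omega) (by omega) (by omega) e'; omega) (fun e' => by
        rw [wadj _ _ (by omega) (by omega) (by omega) (by omega)] at e'; omega)
      omega
    · have := hub 1 x 0 (by omega) (by omega) x1 x2 (by omega) (by omega) e k3
      omega
  have ends : ∀ x, -1 ≤ x → x ≤ n - 2 → G.Adj (q s) (c x) → x = 1 ∨ x = 0 := by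
    intro x x1 x2 e
    have := hub s x 1 (by omega) (by omega) x1 x2 (by omega) (by omega) e hs1
    by_contra hc
    have hx : x = 2 := by omega
    rcases hp with ⟨k, k1, k2, k3⟩ | ⟨-, k3⟩
    · have := star s k x 0 (by omega) (by omega) (by omega) (by omega) e k3 (fun e' => by
        have := winj _ _ (by omega) (by omega) (by omega) (by omega) e'; omega) (fun e' => by
        rw [wadj _ _ (by omega) (by omega) (by omega) (by omega)] at e'; omega)
      omega
    · have := hub s x 0 (by omega) (by omega) x1 x2 (by omega) (by omega) e k3
      omega
  have cn1 : c (n - 1) = c (-1) := by rw [h.eq_iff]; exact ⟨1, by ring⟩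
  -- interior attachment
  have hp' : ∃ k, 1 < k ∧ k < s ∧ G.Adj (q k) (c 0) := by
    by_contra hno
    have hboth := hp.resolve_left hno
    push Not at hno
    have hO : IsHoleSet G (q '' Set.Icc 1 s ∪ c '' Set.Icc 1 (n - 1)) := by
      refine hole2 hq (g := c) (k := 1) (l := n - 1) ?_ (by omega) (by omega) (by omega) ?_
      · intro x y x1 x2 y1 y2
        have := (h.win 0).2 x y (by omega) (by omega) (by omega) (by omega)
        exact ⟨this.1.trans (by omega), this.2⟩
      · intro k x k1 k2 x1 x2
        refine ⟨⟨fun e => ?_, ?_⟩, qH k k1 k2 x⟩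
        · obtain ⟨y, y1, y2, y3, y4⟩ : ∃ y, -1 ≤ y ∧ y ≤ n - 2 ∧ c x = c y ∧ (y = x ∨ (x = n - 1 ∧ y = -1)) := by
            by_cases hx : x = n - 1
            · exact ⟨-1, by omega, by omega, by rw [hx, cn1], Or.inr ⟨hx, rfl⟩⟩
            · exact ⟨x, by omega, by omega, rfl, Or.inl rfl⟩
          rw [y3] at e
          rcases (by omega : k = 1 ∨ k = s ∨ (1 < k ∧ k < s)) with rfl | rfl | hk
          · have hy5 := end1 y y1 y2 e; right; refine ⟨rfl, ?_⟩; clear hp hno; omega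
          · have hy5 := ends y y1 y2 e; left; refine ⟨rfl, ?_⟩; clear hp hno; omega
          · have := int k y hk.1 hk.2 y1 y2 e; omega
        · rintro (⟨rfl, rfl⟩ | ⟨rfl, rfl⟩)
          · exact hs1
          · rw [cn1]; exact h1
    have hc0 : c 0 ∉ q '' Set.Icc 1 s ∪ c '' Set.Icc 1 (n - 1) := by
      rintro (⟨k, ⟨k1, k2⟩, e⟩ | ⟨x, ⟨x1, x2⟩, e⟩)
      · exact qH k k1 k2 0 e
      · have := ((h.win 0).2 _ _ (by omega) (by omega) (by omega) (by omega)).2 e; omega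
    have hcard : nbrsIn G (q '' Set.Icc 1 s ∪ c '' Set.Icc 1 (n - 1)) (c 0) = {q 1} ∪ ({q s} ∪ ({c 1} ∪ {c (n - 1)})) := by
      ext v
      constructor
      · rintro ⟨⟨k, ⟨k1, k2⟩, rfl⟩ | ⟨x, ⟨x1, x2⟩, rfl⟩, e⟩
        · rcases (by omega : k = 1 ∨ k = s ∨ (1 < k ∧ k < s)) with rfl | rfl | hk
          · exact Or.inl rfl
          · exact Or.inr (Or.inl rfl)
          · exact absurd e.symm (hno k hk.1 hk.2)
        · rw [((h.win 0).2 _ _ (by omega) (by omega) (by omega) (by omega)).1] at e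
          rcases (by omega : x = 1 ∨ x = n - 1) with rfl | rfl
          · exact Or.inr (Or.inr (Or.inl rfl))
          · exact Or.inr (Or.inr (Or.inr rfl))
      · rintro (rfl | rfl | rfl | rfl)
        · exact ⟨Or.inl ⟨1, ⟨by omega, by omega⟩, rfl⟩, hboth.1.symm⟩
        · exact ⟨Or.inl ⟨s, ⟨by omega, by omega⟩, rfl⟩, hboth.2.symm⟩
        · exact ⟨Or.inr ⟨1, ⟨by omega, by omega⟩, rfl⟩, (wadj _ _ (by omega) (by omega) (by omega) (by omega)).2 (by omega)⟩
        · refine ⟨Or.inr ⟨n - 1, ⟨by omega, by omega⟩, rfl⟩, ?_⟩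
          rw [cn1]
          exact (wadj _ _ (by omega) (by omega) (by omega) (by omega)).2 (by omega)
    have e1n : c 1 ≠ c (n - 1) := fun e => by
      have := ((h.win 0).2 _ _ (by omega) (by omega) (by omega) (by omega)).2 e; omega
    have hq1s : q 1 ≠ q s := fun e => by
      have := hq.inj (by omega) (by omega) (by omega) (by omega) e; omega
    have hcard4 : (nbrsIn G (q '' Set.Icc 1 s ∪ c '' Set.Icc 1 (n - 1)) (c 0)).ncard = 4 := by
      rw [hcard]
      have : ({q 1} ∪ ({q s} ∪ ({c 1} ∪ {c (n - 1)})) : Set V) = {q 1, q s, c 1, c (n - 1)} := by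
        ext; simp; tauto
      rw [this, Set.ncard_insert_of_notMem, Set.ncard_insert_of_notMem, Set.ncard_pair e1n]
      · simp only [Set.mem_insert_iff, Set.mem_singleton_iff, not_or]
        exact ⟨qH s (by omega) (by omega) _, qH s (by omega) (by omega) _⟩
      · simp only [Set.mem_insert_iff, Set.mem_singleton_iff, not_or]
        exact ⟨hq1s, qH 1 (by omega) (by omega) _, qH 1 (by omega) (by omega) _⟩
    have m1 : c 1 ∈ nbrsIn G (q '' Set.Icc 1 s ∪ c '' Set.Icc 1 (n - 1)) (c 0) := by
      rw [hcard]; exact Or.inr (Or.inr (Or.inl rfl))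
    have m2 : c (n - 1) ∈ nbrsIn G (q '' Set.Icc 1 s ∪ c '' Set.Icc 1 (n - 1)) (c 0) := by
      rw [hcard]; exact Or.inr (Or.inr (Or.inr rfl))
    rcases g.even _ _ hO hc0 (by rw [hcard4]; decide) (c 1) (c (n - 1)) m1.1 m2.1 m1.2 m2.2 with e | e
    · exact e1n e
    · rw [((h.win 0).2 _ _ (by omega) (by omega) (by omega) (by omega)).1] at e; omega
  clear hp
  obtain ⟨k0, k1, k2, k3⟩ := hp'
  -- attachments of Z-vertices
  have qZ : ∀ k, 1 ≤ k → k ≤ s → q k ∉ F → ∃ j, -1 ≤ j ∧ j ≤ n - 2 ∧ q k ∈ Q G c j ∧ G.Adj (q k) (c j) ∧ G.Adj (q k) (c (j + 1)) := by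
    intro k k1 k2 hk
    obtain ⟨⟨j, hj⟩, hH⟩ := (hXF _ (hX k k1 k2)).resolve_left hk
    obtain ⟨y, y1, y2, y3⟩ := h.norm' (-1) j
    rw [← h.Q_congr y3] at hj
    exact ⟨y, y1, by omega, hj, hj.1.resolve_left (hH _), hj.2.resolve_left (hH _)⟩
  have cnm : c (n - 2 + 1) = c (-1) := by rw [← cn1]; congr 1; ring
  have intF : ∀ k, 1 < k → k < s → q k ∈ F := by
    intro k k1 k2
    by_contra hk
    obtain ⟨j, j1, j2, -, j3, j4⟩ := qZ k (by omega) (by omega) hk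
    have e1 := int k j k1 k2 j1 j2 j3
    have e2 := int k (j + 1) k1 k2 (by omega) (by omega) j4
    omega
  have q1F : q 1 ∉ F → q 1 ∈ Q G c (-1) := by
    intro hk
    obtain ⟨j, j1, j2, j5, j3, j4⟩ := qZ 1 (by omega) (by omega) hk
    have e1 := end1 j j1 j2 j3
    have e2 := end1 (j + 1) (by omega) (by omega) j4
    obtain rfl : j = -1 := by omega
    exact j5
  have qsF : q s ∉ F → q s ∈ Q G c 0 := by
    intro hk
    obtain ⟨j, j1, j2, j5, j3, j4⟩ := qZ s (by omega) (by omega) hk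
    have e1 := ends j j1 j2 j3
    by_cases hj : j = n - 2
    · omega
    have e2 := ends (j + 1) (by omega) (by omega) j4
    obtain rfl : j = 0 := by omega
    exact j5
  obtain ⟨lo, hlo⟩ : ∃ lo : ℤ, (lo = 1 ∧ q 1 ∈ F) ∨ (lo = 2 ∧ q 1 ∈ Q G c (-1)) := by
    by_cases e : q 1 ∈ F
    · exact ⟨1, Or.inl ⟨rfl, e⟩⟩
    · exact ⟨2, Or.inr ⟨rfl, q1F e⟩⟩
  obtain ⟨hi, hhi⟩ : ∃ hi : ℤ, (hi = s ∧ q s ∈ F) ∨ (hi = s - 1 ∧ q s ∈ Q G c 0) := by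
    by_cases e : q s ∈ F
    · exact ⟨s, Or.inl ⟨rfl, e⟩⟩
    · exact ⟨s - 1, Or.inr ⟨rfl, qsF e⟩⟩
  have lo12 : lo = 1 ∨ lo = 2 := by rcases hlo with e | e; exact Or.inl e.1; exact Or.inr e.1
  have hi12 : hi = s ∨ hi = s - 1 := by rcases hhi with e | e; exact Or.inl e.1; exact Or.inr e.1
  have inF : ∀ k, lo ≤ k → k ≤ hi → q k ∈ F := by
    intro k a1 a2
    rcases (by omega : k = 1 ∨ k = s ∨ (1 < k ∧ k < s)) with rfl | rfl | hk
    · rcases hlo with e | e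
      · exact e.2
      · omega
    · rcases hhi with e | e
      · exact e.2
      · omega
    · exact intF k hk.1 hk.2
  have att : ∀ k x, 1 ≤ k → k ≤ s → G.Adj (q k) (c x) → c x = c (-1) ∨ c x = c 0 ∨ c x = c 1 := by
    intro k x a1 a2 e
    obtain ⟨y, y1, y2, y3⟩ := h.norm' (-1) x
    rw [← y3] at e ⊢
    rcases (by omega : k = 1 ∨ k = s ∨ (1 < k ∧ k < s)) with rfl | rfl | hk
    · rcases end1 y y1 (by omega) e with rfl | rfl
      · exact Or.inl rfl
      · exact Or.inr (Or.inl rfl)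
    · rcases ends y y1 (by omega) e with rfl | rfl
      · exact Or.inr (Or.inr rfl)
      · exact Or.inr (Or.inl rfl)
    · rw [int k y hk.1 hk.2 y1 (by omega) e]
      exact Or.inr (Or.inl rfl)
  have int' : ∀ k x, 1 < k → k < s → G.Adj (q k) (c x) → c x = c 0 := by
    intro k x a1 a2 e
    obtain ⟨y, y1, y2, y3⟩ := h.norm' (-1) x
    rw [← y3] at e ⊢
    rw [int k y a1 a2 y1 (by omega) e]
  have c01 : c (-1) ≠ c 0 := fun e => by
    have := winj _ _ (by omega) (by omega) (by omega) (by omega) e; omega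
  have c10 : c 1 ≠ c 0 := fun e => by
    have := winj _ _ (by omega) (by omega) (by omega) (by omega) e; omega
  have exA : ∃ u, u ∈ Q G c (-1) ∧ u ≠ c 0 ∧ G.Adj (q lo) u := by
    rcases hlo with ⟨rfl, e⟩ | ⟨rfl, e⟩
    · exact ⟨_, h.mem0 (-1), c01, h1⟩
    · exact ⟨_, e, qH 1 (by omega) (by omega) 0, (hq.adj (by omega) (by omega) (by omega) (by omega)).2 (by omega)⟩
  have exB : ∃ u, u ∈ Q G c 0 ∧ u ≠ c 0 ∧ G.Adj (q hi) u := by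
    rcases hhi with ⟨rfl, e⟩ | ⟨rfl, e⟩
    · exact ⟨_, h.mem1 0, c10, hs1⟩
    · exact ⟨_, e, qH s (by omega) (by omega) 0, (hq.adj (by omega) (by omega) (by omega) (by omega)).2 (by omega)⟩
  obtain ⟨u, u1, u2, u3⟩ := exA
  obtain ⟨u', v1, v2, v3⟩ := exB
  have hY := (hq.sub (show 1 ≤ lo by omega) (show hi ≤ s by omega)).conn
  refine A3 g h hF hZ hY ?_ (a := q lo) ⟨lo, ⟨le_refl _, by omega⟩, rfl⟩ u1 u2 u3 (b := q hi) ⟨hi, ⟨by omega, le_refl _⟩, rfl⟩ v1 v2 v3 ?_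
  · rintro _ ⟨k, ⟨a1, a2⟩, rfl⟩; exact inF k a1 a2
  rintro _ ⟨j, ⟨j1, j2⟩, rfl⟩ w wZ w1 w0 hjw
  have wH : ∀ x, w ≠ c x := by
    rintro x rfl
    rcases att j x (by omega) (by omega) hjw with e | e | e <;> rw [e] at w1 w0
    · exact w1 (h.mem0 _)
    · exact w0 (h.mem0 _)
    · exact w0 (h.mem1 0)
  have noatt : ∀ x, ¬ G.Adj (q j) (c x) := fun x e => h.alpha g (hZ _ (inF j j1 j2)) wZ wH e hjw
  have j3 : j ≠ 1 := by rintro rfl; exact noatt _ h1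
  have j4 : j ≠ s := by rintro rfl; exact noatt _ hs1
  have j5 : j ≠ k0 := by rintro rfl; exact noatt _ k3
  obtain ⟨m, hm⟩ := wZ
  rcases (by omega : j < k0 ∨ k0 < j) with hlt | hlt
  · exact A2b g h hlt (hq.sub (by omega) (by omega)) (fun t t1 t2 => hZ _ (intF t (by omega) (by omega))) hm wH w1 w0 hjw.symm
      k3 (fun t x t1 t2 => int' t x (by omega) (by omega))
  · have hr := (hq.sub (show 1 ≤ k0 by omega) (show j ≤ s by omega)).rev 0
    refine A2b g h (j := 0 - j) (k := 0 - k0) (by omega) hr (fun t t1 t2 => hZ _ (intF _ (by omega) (by omega))) hm wH w1 w0 ?_ ?_ ?_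
    · simpa using hjw.symm
    · simpa using k3
    · exact fun t x t1 t2 => int' _ x (by omega) (by omega)

end Paper
end

section
open SimpleGraph
namespace Paper
variable {V : Type*}

lemma A1 {G : SimpleGraph V} (g : Good G) {c : ℤ → V} {n : ℤ} (h : HF G c n) {F X : Set V} 
    (hF : Conn G F) (hZ : ∀ v ∈ F, v ∉ Z G c) (hXF : ∀ v ∈ X, v ∈ F ∨ (v ∈ Z G c ∧ ∀ x, v ≠ c x))
    {q : ℤ → V} {s : ℤ} (hs : 2 ≤ s) (hq : IPath G q 1 s) (hX : ∀ k, 1 ≤ k → k ≤ s → q k ∈ X)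
    (star : ∀ a b x y, 1 ≤ a → a ≤ s → 1 ≤ b → b ≤ s → G.Adj (q a) (c x) → G.Adj (q b) (c y) → c x ≠ c y →
      ¬ G.Adj (c x) (c y) → (a = 1 ∧ b = s) ∨ (a = s ∧ b = 1)) (i : ℤ)
    (h1 : G.Adj (q 1) (c (i - 1))) (hs1 : G.Adj (q s) (c (i + 1)))
    (hp : (∃ k, 1 < k ∧ k < s ∧ G.Adj (q k) (c i)) ∨ (G.Adj (q 1) (c i) ∧ G.Adj (q s) (c i))) :
    ∀ v ∈ F, ∀ w ∈ Z G c, G.Adj v w → w ∈ Q G c (i - 1) ∨ w ∈ Q G c i := by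
  have := A2 g (h.shift i) hF (by rwa [Z_shift]) (X := X) (by
      intro v hv
      rw [Z_shift]
      rcases hXF v hv with e | e
      · exact Or.inl e
      · exact Or.inr ⟨e.1, fun x => e.2 _⟩) hs hq hX
      (fun a b x y a1 a2 a3 a4 a5 a6 a7 a8 => star a b _ _ a1 a2 a3 a4 a5 a6 a7 a8)
      (by rwa [show -1 + i = i - 1 by ring]) (by rwa [show 1 + i = i + 1 by ring]) (by simpa using hp)
  intro v hv w hw hvw
  by_contra hc
  push Not at hc
  refine this v hv w (by rwa [Z_shift]) ?_ ?_ hvw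
  · rw [Q_shift, show -1 + i = i - 1 by ring]; exact hc.1
  · rw [Q_shift, zero_add]; exact hc.2

lemma lemmaA {G : SimpleGraph V} (g : Good G) (hN : NCC G) {c : ℤ → V} {n : ℤ} (h : HF G c n) {F : Set V} {v0 : V}
    (hF : Conn G F) (hv0 : v0 ∈ F) (hZ : ∀ v ∈ F, v ∉ Z G c)
    (hNF : ∀ v ∈ F, ∀ w, G.Adj v w → w ∈ F ∨ w ∈ Z G c) :
    ∃ i, ∀ v ∈ F, ∀ w ∈ Z G c, G.Adj v w → w ∈ Q G c (i - 1) ∨ w ∈ Q G c i := by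
  classical
  have hn := h.five
  obtain ⟨X, hXd⟩ : ∃ X : Set V, X = F ∪ {z | z ∈ Z G c ∧ (∀ x, z ≠ c x) ∧ ∃ f ∈ F, G.Adj z f} := ⟨_, rfl⟩
  have hXc : Conn G X := by rw [hXd]; exact hF.add (fun w hw => hw.2.2)
  have hXF : ∀ v ∈ X, v ∈ F ∨ (v ∈ Z G c ∧ ∀ x, v ≠ c x) := by
    rw [hXd]; rintro v (hv | hv)
    · exact Or.inl hv
    · exact Or.inr ⟨hv.1, hv.2.1⟩
  have XH : ∀ v ∈ X, ∀ x, v ≠ c x := by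
    intro v hv
    rcases hXF v hv with e | e
    · exact h.ne_of_not_Z (hZ v e)
    · exact e.2
  -- two nonadjacent attachments
  have hex : ∃ x y, (∃ a ∈ X, G.Adj a (c x)) ∧ (∃ b ∈ X, G.Adj b (c y)) ∧ c x ≠ c y ∧ ¬ G.Adj (c x) (c y) := by
    by_contra hno
    obtain ⟨i, hi⟩ := h.clique_pair (fun v => ∃ a ∈ X, G.Adj a v) (by
      intro x y hx hy
      by_contra hc
      push Not at hc
      exact hno ⟨x, y, hx, hy, hc.1, hc.2⟩)
    have hQ : ∀ f ∈ F, ∀ w ∈ Z G c, G.Adj f w → w ∈ Q G c i := by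
      intro f hf w hw hfw
      by_cases hwH : ∃ x, w = c x
      · obtain ⟨x, rfl⟩ := hwH
        rcases hi x ⟨f, by rw [hXd]; exact Or.inl hf, hfw⟩ with e | e <;> rw [e]
        · exact h.mem0 i
        · exact h.mem1 i
      · push Not at hwH
        have wX : w ∈ X := by rw [hXd]; exact Or.inr ⟨hw, hwH, f, hf, hfw.symm⟩
        obtain ⟨j, hj⟩ := hw
        have := h.pair_inj (hi j ⟨w, wX, hj.1.resolve_left (hwH _)⟩) (hi (j + 1) ⟨w, wX, hj.2.resolve_left (hwH _)⟩)
        rw [← h.Q_congr this]; exact hj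
    obtain ⟨f, hf, w, w1, w2, w3⟩ := hN.att (h.cl g i) hv0 (fun x hx e => hZ x hx ⟨i, e⟩) (v := c (i + 2))
      (fun e => hZ _ e (h.memZ _)) (fun e => by
        have wi := (h.win i).2
        rcases h.z2 e with e | e
        · have := (wi _ _ (by omega) (by omega) (by omega) (by omega)).2 e; omega
        · have := (wi _ _ (by omega) (by omega) (by omega) (by omega)).2 e; omega)
    rcases hNF f hf w w3 with e | e
    · exact w1 e
    · exact w2 (hQ f hf w e w3)
  have hex2 : ∃ m : ℕ, ∃ x y a b, Wk G X m a b ∧ G.Adj a (c x) ∧ G.Adj b (c y) ∧ c x ≠ c y ∧ ¬ G.Adj (c x) (c y) := by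
    obtain ⟨x, y, ⟨a, a1, a2⟩, ⟨b, b1, b2⟩, e1, e2⟩ := hex
    obtain ⟨m, hm⟩ := hXc a a1 b b1
    exact ⟨m, x, y, a, b, hm, a2, b2, e1, e2⟩
  obtain ⟨x0, y0, a, b, hw, ha, hb, hne, hna⟩ := Nat.find_spec hex2
  have hmin : ∀ m x y a b, Wk G X m a b → G.Adj a (c x) → G.Adj b (c y) → c x ≠ c y → ¬ G.Adj (c x) (c y) →
      Nat.find hex2 ≤ m := fun m x y a b h1 h2 h3 h4 h5 => Nat.find_min' hex2 ⟨x, y, a, b, h1, h2, h3, h4, h5⟩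
  generalize Nat.find hex2 = M at hw hmin
  obtain ⟨s, q, s1, hq, hX, hA, hB, hsm⟩ := SP (fun v => G.Adj v (c x0)) (fun v => G.Adj v (c y0)) hw ha hb
  have hsM := hsm _ _ _ ha hb hw
  have q1 : G.Adj (q 1) (c x0) := (hA 1 (by omega) s1).2 rfl
  have qs : G.Adj (q s) (c y0) := (hB s s1 (le_refl _)).2 rfl
  have star : ∀ a b x y, 1 ≤ a → a ≤ s → 1 ≤ b → b ≤ s → G.Adj (q a) (c x) → G.Adj (q b) (c y) → c x ≠ c y →
      ¬ G.Adj (c x) (c y) → (a = 1 ∧ b = s) ∨ (a = s ∧ b = 1) := by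
    intro a b x y a1 a2 b1 b2 e1 e2 e3 e4
    rcases le_total a b with l | l
    · have := hmin _ _ _ _ _ (hq.wk hX a1 l b2) e1 e2 e3 e4
      omega
    · have := hmin _ _ _ _ _ (hq.wk hX b1 l a2).symm e1 e2 e3 e4
      omega
  have hub : ∀ k x y, 1 ≤ k → k ≤ s → G.Adj (q k) (c x) → G.Adj (q k) (c y) → c x = c y ∨ G.Adj (c x) (c y) := by
    intro k x y k1 k2 e e'
    exact h.hub _ x y (XH _ (hX k k1 k2)) e e'
  have s2 : 2 ≤ s := by
    by_contra hc
    obtain rfl : s = 1 := by omega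
    rcases hub 1 x0 y0 (by omega) (by omega) q1 qs with e | e
    · exact hne e
    · exact hna e
  -- find p
  have hp : ∃ i, G.Adj (c i) (c x0) ∧ G.Adj (c i) (c y0) ∧
      ((∃ k, 1 < k ∧ k < s ∧ G.Adj (q k) (c i)) ∨ (G.Adj (q 1) (c i) ∧ G.Adj (q s) (c i))) := by
    have fin : ∀ i, (c i = c x0 ∨ G.Adj (c i) (c x0)) → (c i = c y0 ∨ G.Adj (c i) (c y0)) →
        G.Adj (c i) (c x0) ∧ G.Adj (c i) (c y0) := by
      rintro i (e | e) (e' | e')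
      · exact absurd (e.symm.trans e') hne
      · rw [e] at e'; exact absurd e' hna
      · rw [e'] at e; exact absurd e.symm hna
      · exact ⟨e, e'⟩
    by_cases hinn : ∃ k i, 1 < k ∧ k < s ∧ G.Adj (q k) (c i)
    · obtain ⟨k, i, k1, k2, k3⟩ := hinn
      have f := fin i (by
        by_contra hc; push Not at hc
        have := star k 1 i x0 (by omega) (by omega) (by omega) (by omega) k3 q1 hc.1 hc.2; omega) (by
        by_contra hc; push Not at hc
        have := star k s i y0 (by omega) (by omega) (by omega) (by omega) k3 qs hc.1 hc.2; omega)
      exact ⟨i, f.1, f.2, Or.inl ⟨k, k1, k2, k3⟩⟩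
    · push Not at hinn
      by_cases hco : ∃ i, G.Adj (q 1) (c i) ∧ G.Adj (q s) (c i)
      · obtain ⟨i, i1, i2⟩ := hco
        have f := fin i (hub 1 i x0 (by omega) s1 i1 q1) (hub s i y0 s1 (le_refl _) i2 qs)
        exact ⟨i, f.1, f.2, Or.inr ⟨i1, i2⟩⟩
      · push Not at hco
        exact absurd (h.E g hq (by omega) (fun k k1 k2 => XH _ (hX k k1 k2)) (fun k k1 k2 x => hinn k x k1 k2)
          hco ⟨x0, y0, q1, qs, hna⟩) id
  obtain ⟨i, i1, i2, i3⟩ := hp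
  refine ⟨i, ?_⟩
  rcases h.adj_cases i1 with e1 | e1 <;> rcases h.adj_cases i2 with e2 | e2
  · exact absurd (e1.trans e2.symm) hne
  · -- reversed
    have hr := hq.rev (s + 1)
    rw [show s + 1 - s = 1 by ring, show s + 1 - 1 = s by ring] at hr
    refine A1 g h hF hZ hXF s2 hr (fun k k1 k2 => hX _ (by omega) (by omega)) ?_ i ?_ ?_ ?_
    · intro a b x y a1 a2 b1 b2 d1 d2 d3 d4
      have := star _ _ x y (by omega) (by omega) (by omega) (by omega) d1 d2 d3 d4
      omega
    · rw [← e2, show s + 1 - 1 = s by ring]; exact qs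
    · rw [← e1, show s + 1 - s = 1 by ring]; exact q1
    · rcases i3 with ⟨k, k1, k2, k3⟩ | ⟨k1, k2⟩
      · exact Or.inl ⟨s + 1 - k, by omega, by omega, by rw [show s + 1 - (s + 1 - k) = k by ring]; exact k3⟩
      · right; rw [show s + 1 - 1 = s by ring, show s + 1 - s = 1 by ring]; exact ⟨k2, k1⟩
  · exact A1 g h hF hZ hXF s2 hq hX star i (e1 ▸ q1) (e2 ▸ qs) i3
  · exact absurd (e1.trans e2.symm) hne

end Paper
end

section
open SimpleGraph
namespace Paper
variable {V : Type*}

inductive TDec (G : SimpleGraph V) (k : ℕ) : Set V → Set (Set V) → Prop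
  | single (B : Set V) : B.ncard ≤ k → TDec G k B {B}
  | glue {X Y : Set V} {BB CC : Set (Set V)} {B C : Set V} : TDec G k X BB → TDec G k Y CC → B ∈ BB → C ∈ CC →
      X ∩ Y ⊆ B → X ∩ Y ⊆ C → (∀ x ∈ X, x ∉ Y → ∀ y ∈ Y, y ∉ X → ¬ G.Adj x y) →
      TDec G k (X ∪ Y) (BB ∪ CC)

lemma TDec.bag_sub {G : SimpleGraph V} {k : ℕ} {X : Set V} {BB : Set (Set V)} (h : TDec G k X BB) :
    ∀ B ∈ BB, B ⊆ X := by
  induction h with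
  | single B hB => rintro _ rfl; exact le_rfl
  | glue _ _ _ _ _ _ _ ih1 ih2 =>
    rintro B (hB | hB)
    · exact (ih1 B hB).trans Set.subset_union_left
    · exact (ih2 B hB).trans Set.subset_union_right

lemma TDec.clique {G : SimpleGraph V} {k : ℕ} {X : Set V} {BB : Set (Set V)} (h : TDec G k X BB) {K : Set V}
    (hK : ∀ x ∈ K, ∀ y ∈ K, x ≠ y → G.Adj x y) : K ⊆ X → ∃ B ∈ BB, K ⊆ B := by
  induction h with
  | single B hB => intro h; exact ⟨B, rfl, h⟩
  | @glue X Y BB CC B C _ _ _ _ _ _ he ih1 ih2 =>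
    intro h
    by_cases h1 : K ⊆ X
    · obtain ⟨D, hD, hD'⟩ := ih1 h1
      exact ⟨D, Or.inl hD, hD'⟩
    by_cases h2 : K ⊆ Y
    · obtain ⟨D, hD, hD'⟩ := ih2 h2
      exact ⟨D, Or.inr hD, hD'⟩
    obtain ⟨y, hy, hyX⟩ := Set.not_subset.1 h1
    obtain ⟨x, hx, hxY⟩ := Set.not_subset.1 h2
    have hx' := (h hx).resolve_right hxY
    have hy' := (h hy).resolve_left hyX
    exact absurd (hK x hx y hy (fun e => hyX (e ▸ hx'))) (he x hx' hxY y hy' hyX)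

lemma TDec.lift {G : SimpleGraph V} {k : ℕ} {S : Set V} {X : Set S} {BB : Set (Set S)}
    (h : TDec (G.induce S) k X BB) : TDec G k (Subtype.val '' X) ((fun B => Subtype.val '' B) '' BB) := by
  induction h with
  | single B hB =>
    rw [Set.image_singleton]
    exact TDec.single _ (by rwa [Set.ncard_image_of_injective _ Subtype.val_injective])
  | @glue X Y BB CC B C _ _ hB hC h1 h2 he ih1 ih2 =>
    rw [Set.image_union, Set.image_union]
    refine TDec.glue ih1 ih2 ⟨B, hB, rfl⟩ ⟨C, hC, rfl⟩ ?_ ?_ ?_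
    · rw [← Set.image_inter Subtype.val_injective]; exact Set.image_mono h1
    · rw [← Set.image_inter Subtype.val_injective]; exact Set.image_mono h2
    · rintro _ ⟨x, hx, rfl⟩ hxY _ ⟨y, hy, rfl⟩ hyX hadj
      exact he x hx (fun h => hxY ⟨x, h, rfl⟩) y hy (fun h => hyX ⟨y, h, rfl⟩) hadj

lemma sum_bridge_aux {I J : Type} {T : SimpleGraph I} {T' : SimpleGraph J} (h : T.IsAcyclic) {u v : I}
    (ha : T.Adj u v) : (T ⊕g T').IsBridge s(Sum.inl u, Sum.inl v) := by
  rw [isAcyclic_iff_forall_adj_isBridge] at h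
  have hb := h ha
  rw [isBridge_iff] at hb ⊢
  intro hr
  apply hb
  have := (SimpleGraph.reachable_iff_reflTransGen _ _).1 hr
  rw [SimpleGraph.reachable_iff_reflTransGen]
  let f : I ⊕ J → I := fun x => Sum.elim id (fun _ => u) x
  refine Relation.ReflTransGen.lift' f ?_ _ _ this
  rintro (a | a) (b | b) hab
  · apply Relation.ReflTransGen.single
    simpa [f, SimpleGraph.deleteEdges_adj] using hab
  · simp at hab
  · simp at hab
  · exact Relation.ReflTransGen.refl

lemma sum_acyclic {I J : Type} {T : SimpleGraph I} {T' : SimpleGraph J} (h : T.IsAcyclic) (h' : T'.IsAcyclic) :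
    (T ⊕g T').IsAcyclic := by
  rw [isAcyclic_iff_forall_adj_isBridge]
  rintro (a | a) (b | b) hab
  · exact sum_bridge_aux h (by simpa using hab)
  · simp at hab
  · simp at hab
  · have hb := h'
    rw [isAcyclic_iff_forall_adj_isBridge] at hb
    have hb := hb (v := a) (w := b) (by simpa using hab)
    rw [isBridge_iff] at hb ⊢
    intro hr
    apply hb
    have := (SimpleGraph.reachable_iff_reflTransGen _ _).1 hr
    rw [SimpleGraph.reachable_iff_reflTransGen]
    let f : I ⊕ J → J := fun x => Sum.elim (fun _ => a) id x
    refine Relation.ReflTransGen.lift' f ?_ _ _ this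
    rintro (x | x) (y | y) hxy
    · exact Relation.ReflTransGen.refl
    · simp at hxy
    · simp at hxy
    · apply Relation.ReflTransGen.single
      simpa [f, SimpleGraph.deleteEdges_adj] using hxy

lemma Wk.map {I J : Type*} {T : SimpleGraph I} {T' : SimpleGraph J} (f : I → J)
    (hf : ∀ a b, T.Adj a b → T'.Adj (f a) (f b)) {X : Set I} {m x y} (h : Wk T X m x y) :
    Wk T' (f '' X) m (f x) (f y) := by
  induction h with
  | nil hx => exact Wk.nil ⟨_, hx, rfl⟩
  | cons hx ha _ ih => exact Wk.cons ⟨_, hx, rfl⟩ (hf _ _ ha) ih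

lemma Conn.map {I J : Type*} {T : SimpleGraph I} {T' : SimpleGraph J} (f : I → J)
    (hf : ∀ a b, T.Adj a b → T'.Adj (f a) (f b)) {X : Set I} (h : Conn T X) : Conn T' (f '' X) := by
  rintro _ ⟨x, hx, rfl⟩ _ ⟨y, hy, rfl⟩
  obtain ⟨m, hm⟩ := h x hx y hy
  exact ⟨m, hm.map f hf⟩

lemma Wk.reach {G : SimpleGraph V} {X : Set V} {m x y} (h : Wk G X m x y) :
    (G.induce X).Reachable ⟨x, h.start_mem⟩ ⟨y, h.end_mem⟩ := by
  induction h with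
  | nil hx => exact Reachable.refl _
  | @cons m x y z hx ha hw ih =>
    have : (G.induce X).Adj ⟨x, hx⟩ ⟨y, hw.start_mem⟩ := by simpa using ha
    exact this.reachable.trans ih

lemma Conn.connected {G : SimpleGraph V} {X : Set V} (h : Conn G X) (hX : X.Nonempty) : (G.induce X).Connected := by
  obtain ⟨x, hx⟩ := hX
  have : Nonempty X := ⟨⟨x, hx⟩⟩
  refine SimpleGraph.Connected.mk ?_
  rintro ⟨a, ha⟩ ⟨b, hb⟩
  obtain ⟨m, hm⟩ := h a ha b hb
  exact hm.reach

lemma TDec.real {G : SimpleGraph V} {k : ℕ} {X : Set V} {BB : Set (Set V)} (h : TDec G k X BB) :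
    ∃ (I : Type) (T : SimpleGraph I) (bag : I → Set V), T.IsAcyclic ∧ T.Connected ∧
      (∀ t, bag t ⊆ X ∧ (bag t).ncard ≤ k) ∧ (∀ v ∈ X, ∃ t, v ∈ bag t) ∧
      (∀ u ∈ X, ∀ v ∈ X, G.Adj u v → ∃ t, u ∈ bag t ∧ v ∈ bag t) ∧
      (∀ v ∈ X, Conn T {t | v ∈ bag t}) ∧ ∀ B ∈ BB, ∃ t, B ⊆ bag t := by
  induction h with
  | single B hB =>
    refine ⟨Unit, ⊥, fun _ => B, isAcyclic_bot, ?_, fun _ => ⟨le_rfl, hB⟩, fun v hv => ⟨(), hv⟩,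
      fun u hu v hv _ => ⟨(), hu, hv⟩, ?_, ?_⟩
    · exact IsTree.of_subsingleton.1
    · rintro v hv x hx y hy
      exact ⟨0, Wk.nil hx⟩
    · rintro _ rfl; exact ⟨(), le_rfl⟩
  | @glue X Y BB CC B C _ _ hB hC h1 h2 he ih1 ih2 =>
    obtain ⟨I, T, b1, a1, c1, d1, e1, f1, g1, k1⟩ := ih1
    obtain ⟨J, S, b2, a2, c2, d2, e2, f2, g2, k2⟩ := ih2
    obtain ⟨i, hi⟩ := k1 B hB
    obtain ⟨j, hj⟩ := k2 C hC
    have hle : (T ⊕g S) ≤ (T ⊕g S) ⊔ SimpleGraph.edge (Sum.inl i) (Sum.inr j) := le_sup_left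
    have hij : ((T ⊕g S) ⊔ SimpleGraph.edge (Sum.inl i) (Sum.inr j)).Adj (Sum.inl i) (Sum.inr j) := by
      right; simp [SimpleGraph.edge_adj]
    have hl : ∀ a b, T.Adj a b → ((T ⊕g S) ⊔ SimpleGraph.edge (Sum.inl i) (Sum.inr j)).Adj (Sum.inl a) (Sum.inl b) :=
      fun a b h => hle (by simpa using h)
    have hr : ∀ a b, S.Adj a b → ((T ⊕g S) ⊔ SimpleGraph.edge (Sum.inl i) (Sum.inr j)).Adj (Sum.inr a) (Sum.inr b) :=
      fun a b h => hle (by simpa using h)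
    refine ⟨I ⊕ J, (T ⊕g S) ⊔ SimpleGraph.edge (Sum.inl i) (Sum.inr j), Sum.elim b1 b2,
      IsAcyclic.sup_edge_of_not_reachable (not_reachable_sum_inl_inr _ _) (sum_acyclic a1 a2),
      c1.sum_sup_edge c2, ?_, ?_, ?_, ?_, ?_⟩
    · rintro (t | t)
      · exact ⟨(d1 t).1.trans Set.subset_union_left, (d1 t).2⟩
      · exact ⟨(d2 t).1.trans Set.subset_union_right, (d2 t).2⟩
    · rintro v (hv | hv)
      · obtain ⟨t, ht⟩ := e1 v hv
        exact ⟨Sum.inl t, ht⟩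
      · obtain ⟨t, ht⟩ := e2 v hv
        exact ⟨Sum.inr t, ht⟩
    · intro u hu v hv ha
      by_cases hX : u ∈ X ∧ v ∈ X
      · obtain ⟨t, ht⟩ := f1 u hX.1 v hX.2 ha
        exact ⟨Sum.inl t, ht⟩
      by_cases hY : u ∈ Y ∧ v ∈ Y
      · obtain ⟨t, ht⟩ := f2 u hY.1 v hY.2 ha
        exact ⟨Sum.inr t, ht⟩
      exfalso
      rcases hu with hu | hu
      · by_cases hvX : v ∈ X
        · exact hX ⟨hu, hvX⟩
        have hvY := hv.resolve_left hvX
        exact he u hu (fun h => hY ⟨h, hvY⟩) v hvY hvX ha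
      · by_cases hvY : v ∈ Y
        · exact hY ⟨hu, hvY⟩
        have hvX := hv.resolve_right hvY
        exact he v hvX hvY u hu (fun h => hX ⟨h, hvX⟩) ha.symm
    · intro v hv
      have hset : {t | v ∈ Sum.elim b1 b2 t} = Sum.inl '' {t | v ∈ b1 t} ∪ Sum.inr '' {t | v ∈ b2 t} := by
        ext t
        rcases t with t | t <;> simp
      rw [hset]
      have m1 : v ∉ X → {t | v ∈ b1 t} = ∅ := fun h => Set.eq_empty_of_forall_notMem fun t ht => h ((d1 t).1 ht)
      have m2 : v ∉ Y → {t | v ∈ b2 t} = ∅ := fun h => Set.eq_empty_of_forall_notMem fun t ht => h ((d2 t).1 ht)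
      by_cases hX : v ∈ X
      · by_cases hY : v ∈ Y
        · exact Conn.union ((g1 v hX).map _ hl) ((g2 v hY).map _ hr)
            ⟨_, ⟨i, hi (h1 ⟨hX, hY⟩), rfl⟩, _, ⟨j, hj (h2 ⟨hX, hY⟩), rfl⟩, Or.inr hij⟩
        · rw [m2 hY, Set.image_empty, Set.union_empty]
          exact (g1 v hX).map _ hl
      · rw [m1 hX, Set.image_empty, Set.empty_union]
        exact (g2 v (hv.resolve_left hX)).map _ hr
    · rintro D (hD | hD)
      · obtain ⟨t, ht⟩ := k1 D hD
        exact ⟨Sum.inl t, ht⟩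
      · obtain ⟨t, ht⟩ := k2 D hD
        exact ⟨Sum.inr t, ht⟩

lemma TDec.tw {G : SimpleGraph V} {k : ℕ} {BB : Set (Set V)} (h : TDec G k Set.univ BB) : treewidth G ≤ k := by
  obtain ⟨I, T, b1, a1, c1, d1, e1, f1, g1, k1⟩ := h.real
  apply Nat.sInf_le
  refine ⟨⟨I, T, a1, c1, b1, fun v => e1 v trivial, fun u v ha => f1 u trivial v trivial ha,
    fun v => (g1 v trivial).connected (e1 v trivial)⟩, fun t => (d1 t).2.trans (Nat.le_succ k)⟩

lemma TDec.chain [Finite V] {G : SimpleGraph V} {t : ℕ} (A : ℕ → Set V) (m : ℕ) (hm : 1 ≤ m)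
    (hc : ∀ k, k ≤ m → (A k).ncard ≤ t)
    (h1 : ∀ i k, i ≤ k → k < m → A i ∩ A (k + 1) ⊆ A 0 ∪ A k)
    (h2 : ∀ i k, i ≤ k → k < m → ∀ x ∈ A i, ∀ y ∈ A (k + 1), G.Adj x y →
      x ∈ A 0 ∪ A k ∪ A (k + 1) ∨ ∃ l, l ≤ k ∧ y ∈ A l) :
    ∃ BB, TDec G (3 * t) {v | ∃ k, k ≤ m ∧ v ∈ A k} BB ∧ ∀ k, k < m → A 0 ∪ A k ∪ A (k + 1) ∈ BB := by
  have hsize : ∀ k, k < m → (A 0 ∪ A k ∪ A (k + 1)).ncard ≤ 3 * t := by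
    intro k hk
    have e1 := Set.ncard_union_le (A 0 ∪ A k) (A (k + 1))
    have e2 := Set.ncard_union_le (A 0) (A k)
    have := hc 0 (by omega)
    have := hc k (by omega)
    have := hc (k + 1) (by omega)
    omega
  induction m, hm using Nat.le_induction with
  | base =>
    refine ⟨{A 0 ∪ A 0 ∪ A 1}, ?_, ?_⟩
    · have : {v | ∃ k, k ≤ 1 ∧ v ∈ A k} = A 0 ∪ A 0 ∪ A 1 := by
        ext v
        constructor
        · rintro ⟨k, hk, hv⟩
          interval_cases k
          · exact Or.inl (Or.inl hv)
          · exact Or.inr hv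
        · rintro ((h | h) | h)
          · exact ⟨0, by omega, h⟩
          · exact ⟨0, by omega, h⟩
          · exact ⟨1, by omega, h⟩
      rw [this]
      exact TDec.single _ (hsize 0 (by omega))
    · intro k hk
      obtain rfl : k = 0 := by omega
      rfl
  | succ m hm ih =>
    obtain ⟨BB, hB, hB'⟩ := ih (fun k hk => hc k (by omega)) (fun i k hi hk => h1 i k hi (by omega))
      (fun i k hi hk => h2 i k hi (by omega)) (fun k hk => hsize k (by omega))
    have hin : {v | ∃ k, k ≤ m ∧ v ∈ A k} ∩ (A 0 ∪ A m ∪ A (m + 1)) ⊆ A 0 ∪ A m := by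
      rintro v ⟨⟨k, hk, hv⟩, h | h⟩
      · exact h
      · exact h1 k m hk (by omega) ⟨hv, h⟩
    have hl := hB' (m - 1) (by omega)
    rw [show m - 1 + 1 = m by omega] at hl
    refine ⟨BB ∪ {A 0 ∪ A m ∪ A (m + 1)}, ?_, ?_⟩
    · have : {v | ∃ k, k ≤ m + 1 ∧ v ∈ A k} = {v | ∃ k, k ≤ m ∧ v ∈ A k} ∪ (A 0 ∪ A m ∪ A (m + 1)) := by
        ext v
        constructor
        · rintro ⟨k, hk, hv⟩
          by_cases e : k = m + 1
          · subst e; exact Or.inr (Or.inr hv)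
          · exact Or.inl ⟨k, by omega, hv⟩
        · rintro (⟨k, hk, h⟩ | ((h | h) | h))
          · exact ⟨k, by omega, h⟩
          · exact ⟨0, by omega, h⟩
          · exact ⟨m, by omega, h⟩
          · exact ⟨m + 1, by omega, h⟩
      rw [this]
      refine TDec.glue hB (TDec.single _ (hsize m (by omega))) hl rfl (hin.trans ?_) (hin.trans ?_) ?_
      · rintro v (h | h)
        · exact Or.inl (Or.inl h)
        · exact Or.inr h
      · exact Set.subset_union_left
      · rintro x ⟨i, hi, hx⟩ hxY y hy hyX ha
        have hy' : y ∈ A (m + 1) := by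
          rcases hy with (h | h) | h
          · exact absurd ⟨0, by omega, h⟩ hyX
          · exact absurd ⟨m, by omega, h⟩ hyX
          · exact h
        rcases h2 i m hi (by omega) x hx y hy' ha with h | ⟨l, hl, h⟩
        · exact hxY h
        · exact hyX ⟨l, hl, h⟩
    · intro k hk
      by_cases e : k = m
      · subst e; exact Or.inr rfl
      · exact Or.inl (hB' k (by omega))

lemma TDec.hang [Finite V] {G : SimpleGraph V} {k : ℕ} {U : Set V} : ∀ (n : ℕ) (X : Set V) (BB : Set (Set V)),
    (U \ X).ncard ≤ n → TDec G k X BB → X ⊆ U →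
    (∀ u ∈ U \ X, ∃ C, (∃ B ∈ BB, C ⊆ B) ∧ (∀ y ∈ Comp G (U \ X) u, ∀ w ∈ X, G.Adj y w → w ∈ C) ∧
      ∃ CC, TDec G k (Comp G (U \ X) u ∪ C) CC ∧ ∃ B ∈ CC, C ⊆ B) →
    ∃ BB', BB ⊆ BB' ∧ TDec G k U BB' := by
  intro n
  induction n with
  | zero =>
    intro X BB hn hX hXU h
    have : U \ X = ∅ := by
      rwa [Nat.le_zero, Set.ncard_eq_zero (Set.toFinite _)] at hn
    have e : X = U := hXU.antisymm (Set.diff_eq_empty.1 this)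
    exact ⟨BB, le_rfl, e ▸ hX⟩
  | succ n ih =>
    intro X BB hn hX hXU h
    by_cases hne : (U \ X).Nonempty
    swap
    · have e : X = U := hXU.antisymm (Set.diff_eq_empty.1 (Set.not_nonempty_iff_eq_empty.1 hne))
      exact ⟨BB, le_rfl, e ▸ hX⟩
    obtain ⟨u, hu⟩ := hne
    obtain ⟨C, ⟨B, hB, hCB⟩, hN, CC, hCC, B', hB', hCB'⟩ := h u hu
    have hCX : C ⊆ X := hCB.trans (hX.bag_sub B hB)
    have hY : Comp G (U \ X) u ⊆ U \ X := Comp.subset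
    have hin : X ∩ (Comp G (U \ X) u ∪ C) ⊆ C := by
      rintro v ⟨h1, h2 | h2⟩
      · exact absurd h1 (hY h2).2
      · exact h2
    have hg := TDec.glue hX hCC hB hB' (hin.trans hCB) (hin.trans hCB') (by
      rintro x hx hxY y (hy | hy) hyX ha
      · exact hxY (Or.inr (hN y hy x hx ha.symm))
      · exact hyX (hCX hy))
    have hdiff : U \ (X ∪ (Comp G (U \ X) u ∪ C)) = (U \ X) \ Comp G (U \ X) u := by
      ext v
      constructor
      · rintro ⟨h1, h2⟩
        exact ⟨⟨h1, fun h => h2 (Or.inl h)⟩, fun h => h2 (Or.inr (Or.inl h))⟩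
      · rintro ⟨⟨h1, h2⟩, h3⟩
        refine ⟨h1, ?_⟩
        rintro (h | h | h)
        · exact h2 h
        · exact h3 h
        · exact h2 (hCX h)
    have hcomp : ∀ w ∈ (U \ X) \ Comp G (U \ X) u, Comp G ((U \ X) \ Comp G (U \ X) u) w = Comp G (U \ X) w := by
      intro w hw
      ext z
      constructor
      · rintro ⟨m, hm⟩; exact ⟨m, hm.mono Set.diff_subset⟩
      · rintro ⟨m, hm⟩
        refine ⟨m, (Comp.wk_in hm (Comp.self hw.1)).mono ?_⟩
        intro v hv
        refine ⟨Comp.subset hv, fun h => hw.2 ?_⟩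
        have e1 := Comp.eq_of_mem hv
        have e2 := Comp.eq_of_mem h
        rw [← e2, e1]; exact Comp.self hw.1
    obtain ⟨BB', hs, hT⟩ := ih _ _ (by
      rw [hdiff]
      have : ((U \ X) \ Comp G (U \ X) u).ncard < (U \ X).ncard :=
        Set.ncard_lt_ncard ⟨Set.diff_subset, fun h => (h hu).2 (Comp.self hu)⟩ (Set.toFinite _)
      omega) hg (by
      rintro v (h | h | h)
      · exact hXU h
      · exact (hY h).1
      · exact hXU (hCX h)) (by
      rw [hdiff]
      intro w hw
      rw [hcomp w hw]
      obtain ⟨C', ⟨D, hD, hCD⟩, hN', CC', hCC', D', hD', hCD'⟩ := h w hw.1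
      refine ⟨C', ⟨D, Or.inl hD, hCD⟩, ?_, CC', hCC', D', hD', hCD'⟩
      rintro y hy z (hz | hz | hz) ha
      · exact hN' y hy z hz ha
      · exfalso
        have hy2 : y ∈ Comp G (U \ X) u := Comp.closed hz ha.symm (Comp.subset hy)
        apply hw.2
        rw [← Comp.eq_of_mem hy2, Comp.eq_of_mem hy]
        exact Comp.self hw.1
      · exact hN' y hy z (hCX hz) ha)
    exact ⟨BB', (Set.subset_union_left).trans hs, hT⟩

end Paper
end

section
open SimpleGraph
namespace Paper
variable {V : Type*}

lemma hole_step [Finite V] {G : SimpleGraph V} (g : Good G) (hN : NCC G) {t : ℕ}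
    (hcl : ∀ K : Set V, (∀ x ∈ K, ∀ y ∈ K, x ≠ y → G.Adj x y) → K.ncard ≤ t)
    {c : ℤ → V} {n : ℤ} (h : HF G c n) {U : Set V} (hU : Z G c ⊆ U)
    (hUc : ∀ u ∈ U, u ∉ Z G c → Comp G (Z G c)ᶜ u ⊆ U)
    (hY : ∀ u ∈ U, u ∉ Z G c → ∀ i,
      (∀ v ∈ Comp G (Z G c)ᶜ u, ∀ w ∈ Z G c, G.Adj v w → w ∈ Q G c (i-1) ∨ w ∈ Q G c i) →
      ∃ CC, TDec G (3 * t) (Comp G (Z G c)ᶜ u ∪ (Q G c (i-1) ∪ Q G c i)) CC ∧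
        ∃ B ∈ CC, Q G c (i-1) ∪ Q G c i ⊆ B) :
    ∃ BB, TDec G (3 * t) U BB ∧ ∃ B ∈ BB, Q G c (-1) ∪ Q G c 0 ⊆ B := by
  have hn := h.five
  have inj : ∀ x y, 0 ≤ x → x ≤ n - 1 → 0 ≤ y → y ≤ n - 1 → c x = c y → x = y :=
    fun x y h1 h2 h3 h4 e => by
      have := (h.eq_iff x y).1 e
      rw [dvd_small hn (by omega) (by omega)] at this
      omega
  have inj' : ∀ x y, x - y < 2 * n → -(2 * n) < x - y → c x = c y → x - y = 0 ∨ x - y = n ∨ x - y = -n :=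
    fun x y h1 h2 e => by
      have := (h.eq_iff x y).1 e
      rwa [dvd_small hn (by omega) (by omega)] at this
  have Qn : ∀ x, Q G c (x + n) = Q G c x := fun x => h.Q_congr (h.add x)
  have off : ∀ v, (∃ x, v = c x) ∨ ∀ x, v ≠ c x := fun v => by
    by_cases hh : ∃ x, v = c x
    · exact Or.inl hh
    · push Not at hh; exact Or.inr hh
  obtain ⟨BB, hT, hB⟩ := TDec.chain (G := G) (t := t) (fun k : ℕ => Q G c k) (n - 1).toNat (by omega)
    (fun k _ => hcl _ (h.cl g k))
    (by
      intro i k hik hk v ⟨h1, h2⟩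
      push_cast at h2
      rcases off v with ⟨x, rfl⟩ | hv
      · rcases h.z2 h2 with e | e
        · right; rw [e]; exact h.mem1 k
        · rcases h.z2 h1 with e' | e'
          · have := inj' (k + 1 + 1) i (by omega) (by omega) (e.symm.trans e')
            left
            obtain rfl : i = 0 := by omega
            exact h1
          · have := inj' (k + 1 + 1) (i + 1) (by omega) (by omega) (e.symm.trans e')
            omega
      · have := inj' i (k + 1) (by omega) (by omega) (h.z4 g h1 h2 hv hv (Or.inl rfl))
        omega)
    (by
      intro i k hik hk x hx y hy ha
      push_cast at hy
      rcases off y with ⟨b, rfl⟩ | hyo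
      · rcases h.z2 hy with e | e
        · right; exact ⟨k, le_rfl, by rw [e]; exact h.mem1 k⟩
        · rcases off x with ⟨a, rfl⟩ | hxo
          · obtain ⟨j, j1, j2, j3⟩ : ∃ j : ℤ, 0 ≤ j ∧ j ≤ k + 1 ∧ c a = c j := by
              rcases h.z2 hx with e | e
              · exact ⟨i, by omega, by omega, e⟩
              · exact ⟨i + 1, by omega, by omega, e⟩
            rw [j3, e, h.adj_iff, dvd_small hn (by omega) (by omega), dvd_small hn (by omega) (by omega)] at ha
            rw [j3]
            by_cases e1 : j = k + 1
            · left; right; push_cast; rw [e1]; exact h.mem0 _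
            by_cases e2 : j = 0
            · left; left; left; rw [e2]; exact h.mem0 _
            right
            have : (k : ℤ) + 1 + 1 = n := by omega
            refine ⟨0, by omega, ?_⟩
            rw [e, this]
            have := h.add 0
            rw [zero_add] at this
            rw [this]; exact h.mem0 0
          · rw [e] at ha
            rcases (h.z1 hx hxo _).1 ha with e' | e'
            · have := inj' (k + 1 + 1) i (by omega) (by omega) e'
              left; left; left
              obtain rfl : i = 0 := by omega
              exact hx
            · have := inj' (k + 1 + 1) (i + 1) (by omega) (by omega) e'
              omega
      · rcases off x with ⟨a, rfl⟩ | hxo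
        · left; right
          push_cast
          rcases (h.z1 hy hyo a).1 ha.symm with e | e
          · rw [e]; exact h.mem0 _
          · rw [e]; exact h.mem1 _
        · have := inj' i (k + 1) (by omega) (by omega) (h.z4 g hx hy hxo hyo (Or.inr ha))
          omega)
  have hZ : {v | ∃ k : ℕ, k ≤ (n - 1).toNat ∧ v ∈ Q G c k} = Z G c := by
    ext v
    constructor
    · rintro ⟨k, -, hk⟩; exact ⟨k, hk⟩
    · rintro ⟨i, hi⟩
      obtain ⟨x, x1, x2, x3⟩ := h.norm' 0 i
      refine ⟨x.toNat, by omega, ?_⟩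
      rw [show ((x.toNat : ℕ) : ℤ) = x by omega, h.Q_congr x3]
      exact hi
  have hbag : ∀ i, ∃ B ∈ BB, Q G c (i - 1) ∪ Q G c i ⊆ B := by
    intro i
    obtain ⟨x, x1, x2, x3⟩ := h.norm 1 i
    have e0 : Q G c i = Q G c x := (h.Q_congr (by simpa using x3 0)).symm
    have e1 : Q G c (i - 1) = Q G c (x - 1) := (h.Q_congr (x3 (-1))).symm
    rw [e0, e1]
    by_cases hx : x = n
    · refine ⟨_, hB (n - 2).toNat (by omega), ?_⟩
      rintro v (hv | hv)
      · right
        rwa [show (((n - 2).toNat + 1 : ℕ) : ℤ) = x - 1 by omega]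
      · left; left
        have := Qn 0
        rw [zero_add, ← hx] at this
        rw [this] at hv
        exact_mod_cast hv
    · refine ⟨_, hB (x - 1).toNat (by omega), ?_⟩
      rintro v (hv | hv)
      · left; right
        rwa [show (((x - 1).toNat : ℕ) : ℤ) = x - 1 by omega]
      · right
        rwa [show (((x - 1).toNat + 1 : ℕ) : ℤ) = x by omega]
  rw [hZ] at hT
  obtain ⟨BB', hsub, hT'⟩ := TDec.hang (G := G) (U := U) _ _ _ le_rfl hT hU (by
    intro u hu
    have hcomp : Comp G (U \ Z G c) u = Comp G (Z G c)ᶜ u := by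
      ext z
      constructor
      · rintro ⟨m, hm⟩; exact ⟨m, hm.mono (fun v hv => hv.2)⟩
      · rintro ⟨m, hm⟩
        refine ⟨m, (Comp.wk_in hm (Comp.self hu.2)).mono (Y := U \ Z G c) fun v hv => ?_⟩
        exact ⟨hUc u hu.1 hu.2 hv, Comp.subset hv⟩
    rw [hcomp]
    obtain ⟨i, hi⟩ := lemmaA g hN h (F := Comp G (Z G c)ᶜ u) Comp.conn (Comp.self hu.2)
      (fun v hv => Comp.subset hv) (fun v hv w ha => by
        by_cases hw : w ∈ Z G c
        · exact Or.inr hw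
        · exact Or.inl (Comp.closed hv ha hw))
    exact ⟨_, hbag i, hi, hY u hu.1 hu.2 i hi⟩)
  obtain ⟨B, hB1, hB2⟩ := hbag 0
  exact ⟨BB', hT', B, hsub hB1, by simpa using hB2⟩

end Paper
end

section
open SimpleGraph
namespace Paper
variable {V : Type*}

def Mc (G : SimpleGraph V) (p y : V) : Set V := Qc G p y \ {p}

lemma Good.Mc_ne {G : SimpleGraph V} (g : Good G) {p y z : V} (hy : G.Adj p y) (hz : G.Adj p z)
    (hne : y ≠ z) (hn : ¬ G.Adj y z) {a b : V} (ha : a ∈ Mc G p y) (hb : b ∈ Mc G p z) : a ≠ b ∧ ¬ G.Adj a b := by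
  refine ⟨?_, g.Qc_noedge hy hz hne hn ha.1 hb.1 ha.2 hb.2⟩
  rintro rfl
  exact ha.2 (g.Qc_inter hy hz hne hn ha.1 hb.1)

lemma Good.Mc_adj {G : SimpleGraph V} (g : Good G) {p y a : V} (hy : G.Adj p y) (ha : a ∈ Mc G p y) : G.Adj p a :=
  g.Qc_adj hy ha.1 ha.2

/-- no vertex other than p sees both -/
lemma Good.Mc_both {G : SimpleGraph V} (g : Good G) {p y z : V} (hy : G.Adj p y) (hz : G.Adj p z)
    (hne : y ≠ z) (hn : ¬ G.Adj y z) {a b v : V} (ha : a ∈ Mc G p y) (hb : b ∈ Mc G p z) (h1 : G.Adj v a)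
    (h2 : G.Adj v b) : v = p := by
  obtain ⟨h3, h4⟩ := g.Mc_ne hy hz hne hn ha hb
  exact g.K a b v p h3 h4 h1.symm h2.symm (g.Mc_adj hy ha).symm (g.Mc_adj hz hb).symm

structure LP (G : SimpleGraph V) (p y z : V) (U : Set V) (f : ℤ → V) (s : ℤ) : Prop where
  s2 : 2 ≤ s
  path : IPath G f 0 (s + 1)
  f0 : f 0 ∈ Mc G p y
  f1 : f (s + 1) ∈ Mc G p z
  mem : ∀ k, 1 ≤ k → k ≤ s → f k ∈ U
  adjA : ∀ k, 1 ≤ k → k ≤ s → ∀ a ∈ Mc G p y, (G.Adj (f k) a ↔ k = 1 ∧ a = f 0)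
  adjB : ∀ k, 1 ≤ k → k ≤ s → ∀ a ∈ Mc G p z, (G.Adj (f k) a ↔ k = s ∧ a = f (s + 1))

lemma link_path {G : SimpleGraph V} (g : Good G) {p y z : V} (hy : G.Adj p y) (hz : G.Adj p z)
    (hne : y ≠ z) (hn : ¬ G.Adj y z) {U : Set V} (hc : Conn G U) (hU : ∀ u ∈ U, u ∉ Qc G p y ∧ u ∉ Qc G p z)
    (hA : ∃ u ∈ U, ∃ a ∈ Mc G p y, G.Adj u a) (hB : ∃ u ∈ U, ∃ a ∈ Mc G p z, G.Adj u a) :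
    ∃ f s, LP G p y z U f s ∧ ∀ m u v, (∃ a ∈ Mc G p y, G.Adj u a) → (∃ a ∈ Mc G p z, G.Adj v a) →
      Wk G U m u v → s ≤ m + 1 := by
  obtain ⟨u, hu, hua⟩ := hA
  obtain ⟨v, hv, hvb⟩ := hB
  obtain ⟨m, hm⟩ := hc u hu v hv
  obtain ⟨s, q, s1, hq, hX, PA, PB, hmin⟩ := SP (fun u => ∃ a ∈ Mc G p y, G.Adj u a)
    (fun u => ∃ a ∈ Mc G p z, G.Adj u a) hm hua hvb
  obtain ⟨a, ha, ha'⟩ := (PA 1 le_rfl s1).2 rfl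
  obtain ⟨b, hb, hb'⟩ := (PB s s1 le_rfl).2 rfl
  have s2 : 2 ≤ s := by
    by_contra hc
    obtain rfl : s = 1 := by omega
    have := g.Mc_both hy hz hne hn ha hb ha' hb'
    exact (hU _ (hX 1 le_rfl le_rfl)).1 (by rw [this]; exact Qc.left hy)
  have h1 : IPath G (fun x => if x ≤ 1 - 1 then a else q x) (1 - 1) s := by
    refine hq.cons a (fun x x1 x2 => ⟨⟨fun h => ?_, ?_⟩, ?_⟩)
    · exact (PA x x1 x2).1 ⟨a, ha, h.symm⟩
    · rintro rfl; exact ha'.symm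
    · intro e; exact (hU _ (hX x x1 x2)).1 (e ▸ ha.1)
  have h2 := h1.snoc b (fun x x1 x2 => by
    by_cases hx : x ≤ 1 - 1
    · simp only [hx, if_true]
      have := g.Mc_ne hy hz hne hn ha hb
      exact ⟨⟨fun h => absurd h.symm this.2, by omega⟩, this.1.symm⟩
    · simp only [hx, if_false]
      refine ⟨⟨fun h => ?_, ?_⟩, ?_⟩
      · exact (PB x (by omega) x2).1 ⟨b, hb, h.symm⟩
      · rintro rfl; exact hb'.symm
      · intro e; exact (hU _ (hX x (by omega) x2)).2 (e ▸ hb.1))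
  refine ⟨_, s, ⟨s2, h2, ?_, ?_, ?_, ?_, ?_⟩, hmin⟩
  · simpa [show (0:ℤ) ≤ s by omega] using ha
  · simpa using hb
  · intro k k1 k2
    simpa [k2, show ¬ k ≤ 0 by omega] using hX k k1 k2
  · intro k k1 k2 a' ha2
    simp only [k2, if_true, show ¬ k ≤ 1 - 1 by omega, if_false, show (0 : ℤ) ≤ s by omega, show (0:ℤ) ≤ 1 - 1 by omega]
    constructor
    · intro h
      have := (PA k k1 k2).1 ⟨a', ha2, h⟩
      subst this
      exact ⟨rfl, g.Qc_one hy ha2.1 ha.1 h ha' (hU _ (hX 1 k1 k2)).1⟩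
    · rintro ⟨rfl, rfl⟩; exact ha'
  · intro k k1 k2 a' ha2
    simp only [k2, if_true, show ¬ k ≤ 1 - 1 by omega, if_false, show ¬ s + 1 ≤ s by omega]
    constructor
    · intro h
      have := (PB k k1 k2).1 ⟨a', ha2, h⟩
      subst this
      exact ⟨rfl, g.Qc_one hz ha2.1 hb.1 h hb' (hU _ (hX k k1 k2)).2⟩
    · rintro ⟨rfl, rfl⟩; exact hb'

lemma LP.cross {G : SimpleGraph V} (g : Good G) {p y z : V} (hy : G.Adj p y) (hz : G.Adj p z)
    (hne : y ≠ z) (hn : ¬ G.Adj y z) {U U' : Set V} (hU : ∀ u ∈ U, u ∉ Qc G p y ∧ u ∉ Qc G p z)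
    (hU' : ∀ u ∈ U', u ∉ Qc G p y ∧ u ∉ Qc G p z) (hd : ∀ u ∈ U, ∀ v ∈ U', u ≠ v ∧ ¬ G.Adj u v)
    {f f' s s'} (h : LP G p y z U f s) (h' : LP G p y z U' f' s') (k l : ℤ) (k1 : 0 ≤ k) (k2 : k ≤ s + 1)
    (l1 : 0 ≤ l) (l2 : l ≤ s' + 1) :
    (G.Adj (f k) (f' l) ↔ (k = 0 ∧ l = 0 ∧ f 0 ≠ f' 0) ∨ (k = 0 ∧ l = 1 ∧ f 0 = f' 0) ∨
      (k = 1 ∧ l = 0 ∧ f 0 = f' 0) ∨ (k = s + 1 ∧ l = s' + 1 ∧ f (s + 1) ≠ f' (s' + 1)) ∨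
      (k = s + 1 ∧ l = s' ∧ f (s + 1) = f' (s' + 1)) ∨ (k = s ∧ l = s' + 1 ∧ f (s + 1) = f' (s' + 1))) ∧
    (f k = f' l → (k = 0 ∧ l = 0) ∨ (k = s + 1 ∧ l = s' + 1)) := by
  have e1 := h.s2
  have e2 := h'.s2
  by_cases a1 : k = 0
  · subst a1
    by_cases b1 : l = 0
    · subst b1
      refine ⟨⟨fun h => Or.inl ⟨rfl, rfl, h.ne⟩, ?_⟩, fun _ => Or.inl ⟨rfl, rfl⟩⟩
      intro hh
      have : f 0 ≠ f' 0 := by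
        rcases hh with h | h | h | h | h | h
        · exact h.2.2
        all_goals omega
      exact g.clique hy _ h.f0.1 _ h'.f0.1 this
    by_cases b2 : l = s' + 1
    · subst b2
      have := g.Mc_ne hy hz hne hn h.f0 h'.f1
      refine ⟨⟨fun h => absurd h this.2, fun hh => ?_⟩, fun e => absurd e this.1⟩
      omega
    · have := h'.adjA l (by omega) (by omega) _ h.f0
      rw [G.adj_comm, this]
      refine ⟨⟨fun hh => Or.inr (Or.inl ⟨rfl, hh⟩), fun hh => ?_⟩, fun e => ?_⟩
      · rcases hh with h | h | h | h | h | h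
        · omega
        · exact h.2
        all_goals omega
      · exact absurd h.f0.1 (e ▸ (hU' _ (h'.mem l (by omega) (by omega))).1)
  by_cases a2 : k = s + 1
  · subst a2
    by_cases b1 : l = 0
    · subst b1
      have := g.Mc_ne hy hz hne hn h'.f0 h.f1
      refine ⟨⟨fun h => absurd h.symm this.2, fun hh => ?_⟩, fun e => absurd e.symm this.1⟩
      omega
    by_cases b2 : l = s' + 1
    · subst b2
      refine ⟨⟨fun h => Or.inr (Or.inr (Or.inr (Or.inl ⟨rfl, rfl, h.ne⟩))), ?_⟩, fun _ => Or.inr ⟨rfl, rfl⟩⟩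
      intro hh
      have : f (s + 1) ≠ f' (s' + 1) := by
        rcases hh with h | h | h | h | h | h
        · omega
        · omega
        · omega
        · exact h.2.2
        all_goals omega
      exact g.clique hz _ h.f1.1 _ h'.f1.1 this
    · have := h'.adjB l (by omega) (by omega) _ h.f1
      rw [G.adj_comm, this]
      refine ⟨⟨fun hh => Or.inr (Or.inr (Or.inr (Or.inr (Or.inl ⟨rfl, hh⟩)))), fun hh => ?_⟩, fun e => ?_⟩
      · rcases hh with h | h | h | h | h | h
        · omega
        · omega
        · omega
        · omega
        · exact h.2
        · omega
      · exact absurd h.f1.1 (e ▸ (hU' _ (h'.mem l (by omega) (by omega))).2)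
  have mk := h.mem k (by omega) (by omega)
  by_cases b1 : l = 0
  · subst b1
    have := h.adjA k (by omega) (by omega) _ h'.f0
    rw [this]
    refine ⟨⟨fun hh => Or.inr (Or.inr (Or.inl ⟨hh.1, rfl, hh.2.symm⟩)), fun hh => ?_⟩, fun e => ?_⟩
    · rcases hh with h | h | h | h | h | h
      · omega
      · omega
      · exact ⟨h.1, h.2.2.symm⟩
      all_goals omega
    · exact absurd (e ▸ h'.f0.1) ((hU _ mk).1)
  by_cases b2 : l = s' + 1
  · subst b2
    have := h.adjB k (by omega) (by omega) _ h'.f1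
    rw [this]
    refine ⟨⟨fun hh => Or.inr (Or.inr (Or.inr (Or.inr (Or.inr ⟨hh.1, rfl, hh.2.symm⟩)))), fun hh => ?_⟩, fun e => ?_⟩
    · rcases hh with h | h | h | h | h | h
      · omega
      · omega
      · omega
      · omega
      · omega
      · exact ⟨h.1, h.2.2.symm⟩
    · exact absurd (e ▸ h'.f1.1) ((hU _ mk).2)
  have := hd _ mk _ (h'.mem l (by omega) (by omega))
  exact ⟨⟨fun h => absurd h this.2, fun hh => by omega⟩, fun e => absurd e this.1⟩

lemma threeC {G : SimpleGraph V} (g : Good G) {p y z : V} (hy : G.Adj p y) (hz : G.Adj p z)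
    (hne : y ≠ z) (hn : ¬ G.Adj y z) {U1 U2 U3 : Set V}
    (hc1 : Conn G U1) (hc2 : Conn G U2) (hc3 : Conn G U3)
    (hU1 : ∀ u ∈ U1, u ∉ Qc G p y ∧ u ∉ Qc G p z)
    (hU2 : ∀ u ∈ U2, u ∉ Qc G p y ∧ u ∉ Qc G p z)
    (hU3 : ∀ u ∈ U3, u ∉ Qc G p y ∧ u ∉ Qc G p z)
    (hd12 : ∀ u ∈ U1, ∀ v ∈ U2, u ≠ v ∧ ¬ G.Adj u v)
    (hd13 : ∀ u ∈ U1, ∀ v ∈ U3, u ≠ v ∧ ¬ G.Adj u v)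
    (hd23 : ∀ u ∈ U2, ∀ v ∈ U3, u ≠ v ∧ ¬ G.Adj u v)
    (hA1 : ∃ u ∈ U1, ∃ a ∈ Mc G p y, G.Adj u a) (hB1 : ∃ u ∈ U1, ∃ a ∈ Mc G p z, G.Adj u a)
    (hA2 : ∃ u ∈ U2, ∃ a ∈ Mc G p y, G.Adj u a) (hB2 : ∃ u ∈ U2, ∃ a ∈ Mc G p z, G.Adj u a)
    (hA3 : ∃ u ∈ U3, ∃ a ∈ Mc G p y, G.Adj u a) (hB3 : ∃ u ∈ U3, ∃ a ∈ Mc G p z, G.Adj u a) : False := by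
  obtain ⟨f1, s1, h1, -⟩ := link_path g hy hz hne hn hc1 hU1 hA1 hB1
  obtain ⟨f2, s2, h2, -⟩ := link_path g hy hz hne hn hc2 hU2 hA2 hB2
  obtain ⟨f3, s3, h3, -⟩ := link_path g hy hz hne hn hc3 hU3 hA3 hB3
  have c12 := LP.cross g hy hz hne hn hU1 hU2 hd12 h1 h2
  have c13 := LP.cross g hy hz hne hn hU1 hU3 hd13 h1 h3
  have c23 := LP.cross g hy hz hne hn hU2 hU3 hd23 h2 h3
  have t1 := h1.s2
  have t2 := h2.s2
  have t3 := h3.s2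
  obtain ⟨lo, l1, l2⟩ : ∃ lo : ℤ, (f1 0 = f2 0 → lo = 1) ∧ (f1 0 ≠ f2 0 → lo = 0) := by
    by_cases e : f1 0 = f2 0
    · exact ⟨1, fun _ => rfl, fun h => absurd e h⟩
    · exact ⟨0, fun h => absurd h e, fun _ => rfl⟩
  obtain ⟨hi, i1, i2⟩ : ∃ hi : ℤ, (f1 (s1 + 1) = f2 (s2 + 1) → hi = s2) ∧ (f1 (s1 + 1) ≠ f2 (s2 + 1) → hi = s2 + 1) := by
    by_cases e : f1 (s1 + 1) = f2 (s2 + 1)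
    · exact ⟨s2, fun _ => rfl, fun h => absurd e h⟩
    · exact ⟨s2 + 1, fun h => absurd h e, fun _ => rfl⟩
  obtain ⟨lo3, l31, l32⟩ : ∃ lo : ℤ, ((f1 0 = f3 0 ∨ f2 0 = f3 0) → lo = 1) ∧ (¬ (f1 0 = f3 0 ∨ f2 0 = f3 0) → lo = 0) := by
    by_cases e : (f1 0 = f3 0 ∨ f2 0 = f3 0)
    · exact ⟨1, fun _ => rfl, fun h => absurd e h⟩
    · exact ⟨0, fun h => absurd h e, fun _ => rfl⟩
  obtain ⟨hi3, i31, i32⟩ : ∃ hi : ℤ, ((f1 (s1 + 1) = f3 (s3 + 1) ∨ f2 (s2 + 1) = f3 (s3 + 1)) → hi = s3) ∧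
      (¬ (f1 (s1 + 1) = f3 (s3 + 1) ∨ f2 (s2 + 1) = f3 (s3 + 1)) → hi = s3 + 1) := by
    by_cases e : (f1 (s1 + 1) = f3 (s3 + 1) ∨ f2 (s2 + 1) = f3 (s3 + 1))
    · exact ⟨s3, fun _ => rfl, fun h => absurd e h⟩
    · exact ⟨s3 + 1, fun h => absurd h e, fun _ => rfl⟩
  have hlo : 0 ≤ lo ∧ lo ≤ 1 := by
    by_cases e : f1 0 = f2 0
    · have := l1 e; omega
    · have := l2 e; omega
  have hhi : s2 ≤ hi ∧ hi ≤ s2 + 1 := by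
    by_cases e : f1 (s1 + 1) = f2 (s2 + 1)
    · have := i1 e; omega
    · have := i2 e; omega
  have hlo3 : 0 ≤ lo3 ∧ lo3 ≤ 1 := by
    by_cases e : f1 0 = f3 0 ∨ f2 0 = f3 0
    · have := l31 e; omega
    · have := l32 e; omega
  have hhi3 : s3 ≤ hi3 ∧ hi3 ≤ s3 + 1 := by
    by_cases e : f1 (s1 + 1) = f3 (s3 + 1) ∨ f2 (s2 + 1) = f3 (s3 + 1)
    · have := i31 e; omega
    · have := i32 e; omega
  have hS := hole2' h1.path (h2.path.sub hlo.1 hhi.2) (by omega) (by omega) (by omega) (fun x w x1 x2 w1 w2 => by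
    obtain ⟨a, b⟩ := c12 x w x1 x2 (by omega) (by omega)
    rw [a]
    clear c12 c13 c23 l31 l32 i31 i32
    refine ⟨?_, fun e => ?_⟩
    · by_cases e1 : f1 0 = f2 0 <;> by_cases e2 : f1 (s1 + 1) = f2 (s2 + 1) <;>
        simp only [e1, e2, ne_eq, not_true, not_false_iff, and_true, and_false, or_false, false_or]
      · have := l1 e1; have := i1 e2; omega
      · have := l1 e1; have := i2 e2; omega
      · have := l2 e1; have := i1 e2; omega
      · have := l2 e1; have := i2 e2; omega
    · rcases b e with ⟨rfl, rfl⟩ | ⟨rfl, rfl⟩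
      · have := l1 e; omega
      · have := i1 e; omega)
  set S := f1 '' Set.Icc 0 (s1 + 1) ∪ f2 '' Set.Icc lo hi with hSdef
  have m1 : ∀ x, 0 ≤ x → x ≤ s1 + 1 → f1 x ∈ S := fun x x1 x2 => Or.inl ⟨x, ⟨x1, x2⟩, rfl⟩
  have m20 : f2 0 ∈ S := by
    by_cases e : f1 0 = f2 0
    · rw [← e]; exact m1 0 (by omega) (by omega)
    · exact Or.inr ⟨0, ⟨by have := l2 e; omega, by omega⟩, rfl⟩
  have m21 : f2 (s2 + 1) ∈ S := by
    by_cases e : f1 (s1 + 1) = f2 (s2 + 1)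
    · rw [← e]; exact m1 _ (by omega) (by omega)
    · exact Or.inr ⟨s2 + 1, ⟨by omega, by have := i2 e; omega⟩, rfl⟩
  have d3 : ∀ x, x ∈ S → ∀ k, lo3 ≤ k → k ≤ hi3 → x ≠ f3 k ∧
      (G.Adj x (f3 k) → (k = lo3 ∧ x ∈ Mc G p y) ∨ (k = hi3 ∧ x ∈ Mc G p z)) := by
    rintro x hx k k1 k2
    rcases hx with ⟨j, ⟨j1, j2⟩, rfl⟩ | ⟨j, ⟨j1, j2⟩, rfl⟩
    · obtain ⟨a, b⟩ := c13 j k j1 j2 (by omega) (by omega)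
      refine ⟨fun e => ?_, fun hadj => ?_⟩
      · rcases b e with ⟨rfl, rfl⟩ | ⟨rfl, rfl⟩
        · have := l31 (Or.inl e); omega
        · have := i31 (Or.inl e); omega
      · rcases a.1 hadj with ⟨rfl, rfl, e⟩ | ⟨rfl, rfl, e⟩ | ⟨rfl, rfl, e⟩ | ⟨rfl, rfl, e⟩ | ⟨rfl, rfl, e⟩ | ⟨rfl, rfl, e⟩
        · exact Or.inl ⟨by omega, h1.f0⟩
        · exact Or.inl ⟨by have := l31 (Or.inl e); omega, h1.f0⟩
        · have := l31 (Or.inl e); omega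
        · exact Or.inr ⟨by omega, h1.f1⟩
        · exact Or.inr ⟨by have := i31 (Or.inl e); omega, h1.f1⟩
        · have := i31 (Or.inl e); omega
    · obtain ⟨a, b⟩ := c23 j k (by omega) (by omega) (by omega) (by omega)
      refine ⟨fun e => ?_, fun hadj => ?_⟩
      · rcases b e with ⟨rfl, rfl⟩ | ⟨rfl, rfl⟩
        · have := l31 (Or.inr e); omega
        · have := i31 (Or.inr e); omega
      · rcases a.1 hadj with ⟨rfl, rfl, e⟩ | ⟨rfl, rfl, e⟩ | ⟨rfl, rfl, e⟩ | ⟨rfl, rfl, e⟩ | ⟨rfl, rfl, e⟩ | ⟨rfl, rfl, e⟩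
        · exact Or.inl ⟨by omega, h2.f0⟩
        · exact Or.inl ⟨by have := l31 (Or.inr e); omega, h2.f0⟩
        · have := l31 (Or.inr e); omega
        · exact Or.inr ⟨by omega, h2.f1⟩
        · exact Or.inr ⟨by have := i31 (Or.inr e); omega, h2.f1⟩
        · have := i31 (Or.inr e); omega
  have hsh := (h3.path.sub hlo3.1 hhi3.2).shift (lo3 - 1)
  rw [show lo3 - (lo3 - 1) = 1 by ring] at hsh
  have exA : ∃ a ∈ S, a ∈ Mc G p y ∧ G.Adj (f3 lo3) a := by
    by_cases e : f1 0 = f3 0 ∨ f2 0 = f3 0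
    · rw [l31 e]
      rcases e with e | e
      · exact ⟨_, m1 0 (by omega) (by omega), h1.f0, (h3.adjA 1 le_rfl (by omega) _ h1.f0).2 ⟨rfl, e⟩⟩
      · exact ⟨_, m20, h2.f0, (h3.adjA 1 le_rfl (by omega) _ h2.f0).2 ⟨rfl, e⟩⟩
    · rw [l32 e]
      push Not at e
      exact ⟨_, m1 0 (by omega) (by omega), h1.f0, g.clique hy _ h3.f0.1 _ h1.f0.1 e.1.symm⟩
  have exB : ∃ a ∈ S, a ∈ Mc G p z ∧ G.Adj (f3 hi3) a := by
    by_cases e : f1 (s1 + 1) = f3 (s3 + 1) ∨ f2 (s2 + 1) = f3 (s3 + 1)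
    · rw [i31 e]
      rcases e with e | e
      · exact ⟨_, m1 _ (by omega) (by omega), h1.f1, (h3.adjB s3 (by omega) (by omega) _ h1.f1).2 ⟨rfl, e⟩⟩
      · exact ⟨_, m21, h2.f1, (h3.adjB s3 (by omega) (by omega) _ h2.f1).2 ⟨rfl, e⟩⟩
    · rw [i32 e]
      push Not at e
      exact ⟨_, m1 _ (by omega) (by omega), h1.f1, g.clique hz _ h3.f1.1 _ h1.f1.1 e.1.symm⟩
  refine g.E S _ (hi3 - (lo3 - 1)) {a | a ∈ S ∧ a ∈ Mc G p y ∧ G.Adj (f3 lo3) a}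
    {a | a ∈ S ∧ a ∈ Mc G p z ∧ G.Adj (f3 hi3) a} hS (by omega) hsh ?_ (fun a ha => ha.1) (fun a ha => ha.1) ?_ ?_ ?_ ?_ ?_
  · intro k k1 k2 hk
    exact (d3 _ hk (k + (lo3 - 1)) (by omega) (by omega)).1 rfl
  · intro a ha b hb e; exact g.clique hy _ ha.2.1.1 _ hb.2.1.1 e
  · intro a ha b hb e; exact g.clique hz _ ha.2.1.1 _ hb.2.1.1 e
  · intro a ha hb; exact (g.Mc_ne hy hz hne hn ha.2.1 hb.2.1).1 rfl
  · obtain ⟨a, a1, a2, a3⟩ := exA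
    obtain ⟨b, b1, b2, b3⟩ := exB
    exact ⟨a, ⟨a1, a2, a3⟩, b, ⟨b1, b2, b3⟩, (g.Mc_ne hy hz hne hn a2 b2).2⟩
  · intro k x k1 k2 hx
    constructor
    · intro ha
      rcases (d3 x hx (k + (lo3 - 1)) (by omega) (by omega)).2 ha.symm with ⟨e, h⟩ | ⟨e, h⟩
      · left; exact ⟨by omega, hx, h, by rw [← e]; exact ha⟩
      · right; exact ⟨by omega, hx, h, by rw [← e]; exact ha⟩
    · rintro (⟨rfl, h⟩ | ⟨rfl, h⟩)
      · have := h.2.2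
        rwa [show lo3 = 1 + (lo3 - 1) by ring] at this
      · have := h.2.2
        rwa [show hi3 = hi3 - (lo3 - 1) + (lo3 - 1) by ring] at this

end Paper
end

section
open SimpleGraph
namespace Paper
variable {V : Type*}

structure SSt (G : SimpleGraph V) (p y z : V) (F E : Set V) (f : ℤ → V) (s : ℤ) : Prop where
  g : Good G
  hy : G.Adj p y
  hz : G.Adj p z
  hne : y ≠ z
  hn : ¬ G.Adj y z
  Fd : ∀ v ∈ F, v ∉ Qc G p y ∧ v ∉ Qc G p z
  FN : ∀ v ∈ F, ∀ w, G.Adj v w → w ∈ F ∨ w ∈ Qc G p y ∨ w ∈ Qc G p z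
  Ec : Conn G E
  Ed : ∀ v ∈ E, v ∉ Qc G p y ∧ v ∉ Qc G p z
  EN : ∀ v ∈ E, ∀ w, G.Adj v w → w ∈ E ∨ w ∈ Qc G p y ∨ w ∈ Qc G p z
  EF : ∀ v ∈ E, v ∉ F
  EA : ∃ u ∈ E, ∃ a ∈ Mc G p y, G.Adj u a
  EB : ∃ u ∈ E, ∃ a ∈ Mc G p z, G.Adj u a
  lp : LP G p y z F f s
  min : ∀ m u v, (∃ a ∈ Mc G p y, G.Adj u a) → (∃ a ∈ Mc G p z, G.Adj v a) → Wk G F m u v → s ≤ m + 1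

namespace SSt
variable {G : SimpleGraph V} {p y z : V} {F E : Set V} {f : ℤ → V} {s : ℤ}

lemma rev (h : SSt G p y z F E f s) : SSt G p z y F E (fun k => f (s + 1 - k)) s := by
  refine ⟨h.g, h.hz, h.hy, h.hne.symm, fun e => h.hn e.symm, fun v hv => (h.Fd v hv).symm,
    fun v hv w ha => (h.FN v hv w ha).imp_right Or.symm, h.Ec, fun v hv => (h.Ed v hv).symm,
    fun v hv w ha => (h.EN v hv w ha).imp_right Or.symm, h.EF, h.EB, h.EA, ⟨h.lp.s2, ?_, ?_, ?_, ?_, ?_, ?_⟩,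
    fun m u v hu hv hw => h.min m v u hv hu hw.symm⟩
  · have := h.lp.path.rev (s + 1)
    simpa using this
  · simpa using h.lp.f1
  · simpa using h.lp.f0
  · intro k k1 k2; exact h.lp.mem _ (by omega) (by omega)
  · intro k k1 k2 a ha
    rw [h.lp.adjB _ (by omega) (by omega) a ha, sub_zero]
    exact and_congr_left' (by omega)
  · intro k k1 k2 a ha
    rw [h.lp.adjA _ (by omega) (by omega) a ha, sub_self]
    exact and_congr_left' (by omega)

lemma pF (h : SSt G p y z F E f s) : p ∉ F := fun hp => (h.Fd p hp).1 (Qc.left h.hy)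

lemma pf (h : SSt G p y z F E f s) (k : ℤ) (k1 : 0 ≤ k) (k2 : k ≤ s + 1) : f k ≠ p := by
  intro e
  by_cases a : k = 0
  · subst a; exact h.lp.f0.2 e
  by_cases b : k = s + 1
  · subst b; exact h.lp.f1.2 e
  exact h.pF (e ▸ h.lp.mem k (by omega) (by omega))

lemma two (h : SSt G p y z F E f s) {v : V} (hv : v ∈ F) (hvf : ∀ k, 0 ≤ k → k ≤ s + 1 → v ≠ f k) {i j : ℤ}
    (i1 : 0 ≤ i) (j2 : j ≤ s + 1) (hij : i ≤ j) (hi : G.Adj v (f i)) (hj : G.Adj v (f j)) : j ≤ i + 1 := by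
  by_contra hc
  have hs := h.lp.s2
  have P := h.lp.path
  by_cases e : j = i + 2
  · subst e
    refine hvf (i + 1) (by omega) (by omega) ?_
    refine h.g.K (f i) (f (i + 2)) v (f (i + 1)) ?_ ?_ hi.symm hj.symm ?_ ?_
    · intro e; have := P.inj (by omega) (by omega) (by omega) (by omega) e; omega
    · rw [P.adj (by omega) (by omega) (by omega) (by omega)]; omega
    · rw [P.adj (by omega) (by omega) (by omega) (by omega)]; omega
    · rw [P.adj (by omega) (by omega) (by omega) (by omega)]; omega
  have P1 : IPath G f 1 s := P.sub (by omega) (by omega)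
  have A1 : ∃ a ∈ Mc G p y, G.Adj (f 1) a := ⟨f 0, h.lp.f0, (h.lp.adjA 1 le_rfl (by omega) _ h.lp.f0).2 ⟨rfl, rfl⟩⟩
  have B1 : ∃ a ∈ Mc G p z, G.Adj (f s) a := ⟨f (s + 1), h.lp.f1, (h.lp.adjB s (by omega) le_rfl _ h.lp.f1).2 ⟨rfl, rfl⟩⟩
  by_cases i0 : i = 0
  · subst i0
    by_cases js : j = s + 1
    · subst js
      exact h.pF ((h.g.Mc_both h.hy h.hz h.hne h.hn h.lp.f0 h.lp.f1 hi hj) ▸ hv)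
    · have := h.min _ _ _ ⟨f 0, h.lp.f0, hi⟩ B1 (Wk.cons hv hj (P1.wk h.lp.mem (x := j) (y := s) (by omega) (by omega) le_rfl))
      omega
  · by_cases js : j = s + 1
    · subst js
      have := h.min _ _ _ A1 ⟨f (s + 1), h.lp.f1, hj⟩
        ((P1.wk h.lp.mem (x := 1) (y := i) (by omega) (by omega) (by omega)).snoc hi.symm hv)
      omega
    · have := h.min _ _ _ A1 B1 ((P1.wk h.lp.mem (x := 1) (y := i) (by omega) (by omega) (by omega)).trans
        (Wk.cons (h.lp.mem i (by omega) (by omega)) hi.symm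
          (Wk.cons hv hj (P1.wk h.lp.mem (x := j) (y := s) (by omega) (by omega) le_rfl))))
      omega

lemma inA (h : SSt G p y z F E f s) {a : V} (ha : a ∈ Mc G p y) {k : ℤ} (k1 : 0 ≤ k) (k2 : k ≤ s + 1)
    (hk : G.Adj a (f k)) : k = 0 ∨ (k = 1 ∧ a = f 0) := by
  by_cases e : k = 0
  · exact Or.inl e
  by_cases e' : k = s + 1
  · subst e'
    exact absurd hk (h.g.Mc_ne h.hy h.hz h.hne h.hn ha h.lp.f1).2
  · exact Or.inr ((h.lp.adjA k (by omega) (by omega) a ha).1 hk.symm)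

lemma inB (h : SSt G p y z F E f s) {a : V} (ha : a ∈ Mc G p z) {k : ℤ} (k1 : 0 ≤ k) (k2 : k ≤ s + 1)
    (hk : G.Adj a (f k)) : k = s + 1 ∨ (k = s ∧ a = f (s + 1)) := by
  have := h.rev.inA ha (k := s + 1 - k) (by omega) (by omega) (by simpa using hk)
  rw [sub_zero] at this
  rcases this with h | h
  · left; omega
  · right; exact ⟨by omega, h.2⟩

lemma out (h : SSt G p y z F E f s) {v : V} (hv : v ∉ F) (h1 : v ∉ Qc G p y) (h2 : v ∉ Qc G p z)
    {k : ℤ} (k1 : 0 ≤ k) (k2 : k ≤ s + 1) (hk : G.Adj v (f k)) : k = 0 ∨ k = s + 1 := by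
  by_contra hc
  rcases h.FN _ (h.lp.mem k (by omega) (by omega)) v hk.symm with e | e | e
  · exact hv e
  · exact h1 e
  · exact h2 e

lemma hub (h : SSt G p y z F E f s) {i j : ℤ} (i0 : 0 ≤ i) (js : j ≤ s + 1) {v : V} {x w : ℤ} (hvp : v ≠ p)
    (hvf : ∀ k, i ≤ k → k ≤ j → v ≠ f k) (x1 : i ≤ x) (x2 : x ≤ j) (w1 : i ≤ w) (w2 : w ≤ j)
    (hx : G.Adj v (f x)) (hw : G.Adj v (f w)) : f x = f w ∨ G.Adj (f x) (f w) := by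
  wlog hxw : x ≤ w generalizing x w
  · rcases this w1 w2 x1 x2 hw hx (by omega) with e | e
    · exact Or.inl e.symm
    · exact Or.inr e.symm
  have P := h.lp.path
  have hs := h.lp.s2
  suffices hh : w ≤ x + 1 by
    by_cases e : x = w
    · subst e; exact Or.inl rfl
    · right; rw [P.adj (by omega) (by omega) (by omega) (by omega)]; omega
  by_cases hF : ∃ k, 0 ≤ k ∧ k ≤ s + 1 ∧ v = f k
  · obtain ⟨k, k1, k2, rfl⟩ := hF
    rw [P.adj (by omega) (by omega) (by omega) (by omega)] at hx hw
    have : ¬ (i ≤ k ∧ k ≤ j) := fun hh => hvf k hh.1 hh.2 rfl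
    omega
  push Not at hF
  by_cases hvF : v ∈ F
  · exact h.two hvF hF (by omega) (by omega) hxw hx hw
  by_cases hvy : v ∈ Qc G p y
  · have a1 := h.inA ⟨hvy, hvp⟩ (by omega) (by omega) hx
    have a2 := h.inA ⟨hvy, hvp⟩ (by omega) (by omega) hw
    omega
  by_cases hvz : v ∈ Qc G p z
  · have a1 := h.inB ⟨hvz, hvp⟩ (by omega) (by omega) hx
    have a2 := h.inB ⟨hvz, hvp⟩ (by omega) (by omega) hw
    omega
  have a1 := h.out hvF hvy hvz (by omega) (by omega) hx
  have a2 := h.out hvF hvy hvz (by omega) (by omega) hw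
  by_contra hc
  obtain rfl : x = 0 := by omega
  obtain rfl : w = s + 1 := by omega
  exact hvp (h.g.Mc_both h.hy h.hz h.hne h.hn h.lp.f0 h.lp.f1 hx hw)

lemma I0 (h : SSt G p y z F E f s) : G.Adj p (f 0) := h.g.Mc_adj h.hy h.lp.f0
lemma Is (h : SSt G p y z F E f s) : G.Adj p (f (s + 1)) := h.g.Mc_adj h.hz h.lp.f1

lemma M0 (h : SSt G p y z F E f s) : Qc G p (f 0) = Qc G p y :=
  h.g.Qc_eq h.hy (Qc.left h.hy) h.lp.f0.1 (Ne.symm h.lp.f0.2)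
lemma Ms (h : SSt G p y z F E f s) : Qc G p (f (s + 1)) = Qc G p z :=
  h.g.Qc_eq h.hz (Qc.left h.hz) h.lp.f1.1 (Ne.symm h.lp.f1.2)

lemma I1 (h : SSt G p y z F E f s) : ¬ G.Adj p (f 1) := by
  intro ha
  have hs := h.lp.s2
  have : f 1 ∈ Qc G p (f 0) := ⟨Or.inr ha.symm, Or.inr
    ((h.lp.path.adj (by omega) (by omega) (by omega) (by omega)).2 (by omega))⟩
  rw [h.M0] at this
  exact (h.Fd _ (h.lp.mem 1 le_rfl (by omega))).1 this

lemma I2 (h : SSt G p y z F E f s) {i : ℤ} (i0 : 0 ≤ i) (j2 : i + 2 ≤ s + 1) (hi : G.Adj p (f i))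
    (hj : G.Adj p (f (i + 2))) : False := by
  have P := h.lp.path
  refine h.pf (i + 1) (by omega) (by omega) ?_
  refine (h.g.K (f i) (f (i + 2)) p (f (i + 1)) ?_ ?_ hi.symm hj.symm ?_ ?_).symm
  · intro e; have := P.inj (by omega) (by omega) (by omega) (by omega) e; omega
  · rw [P.adj (by omega) (by omega) (by omega) (by omega)]; omega
  · rw [P.adj (by omega) (by omega) (by omega) (by omega)]; omega
  · rw [P.adj (by omega) (by omega) (by omega) (by omega)]; omega

lemma I3 (h : SSt G p y z F E f s) {i j : ℤ} (i0 : 0 ≤ i) (j2 : j ≤ s + 1) (hij : i < j) (hi : G.Adj p (f i))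
    (hj : G.Adj p (f j)) : j = i + 1 ∨ i + 3 ≤ j := by
  by_cases e : j = i + 2
  · subst e; exact (h.I2 i0 j2 hi hj).elim
  · omega

/-- adjacent indices in I give the same clique -/
lemma Meq (h : SSt G p y z F E f s) {i j : ℤ} (i0 : 0 ≤ i) (is : i ≤ s + 1) (j0 : 0 ≤ j) (js : j ≤ s + 1)
    (hi : G.Adj p (f i)) (hj : f j ∈ Qc G p (f i)) : Qc G p (f j) = Qc G p (f i) :=
  h.g.Qc_eq hi (Qc.left hi) hj (h.pf j j0 js).symm

/-- membership of path vertices in the cliques -/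
lemma fM (h : SSt G p y z F E f s) {i k : ℤ} (i0 : 0 ≤ i) (is : i ≤ s + 1) (k0 : 0 ≤ k) (ks : k ≤ s + 1)
    (hk : f k ∈ Qc G p (f i)) : G.Adj p (f k) ∧ (k = i ∨ k = i + 1 ∨ i = k + 1) := by
  refine ⟨(hk.1.resolve_left (h.pf k k0 ks)).symm, ?_⟩
  rcases hk.2 with e | e
  · left; exact h.lp.path.inj k0 ks i0 is e
  · right; rw [h.lp.path.adj k0 ks i0 is] at e; omega

lemma MX (h : SSt G p y z F E f s) {l : ℤ} (l0 : 0 ≤ l) (ls : l ≤ s + 1) {v : V}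
    (hv : v ∈ Qc G p (f l)) : v ∈ F ∨ v ∈ Qc G p y ∨ v ∈ Qc G p z := by
  by_cases a : l = 0
  · subst a; rw [h.M0] at hv; exact Or.inr (Or.inl hv)
  by_cases b : l = s + 1
  · subst b; rw [h.Ms] at hv; exact Or.inr (Or.inr hv)
  have hf := h.lp.mem l (by omega) (by omega)
  rcases hv.2 with e | e
  · left; rw [e]; exact hf
  · exact h.FN _ hf v e.symm

/-- if two cliques share a non-p vertex or there is an edge between them, they are equal -/
lemma Mlink (h : SSt G p y z F E f s) {i j : ℤ} (i0 : 0 ≤ i) (is : i ≤ s + 1) (j0 : 0 ≤ j) (js : j ≤ s + 1)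
    (hi : G.Adj p (f i)) (hj : G.Adj p (f j)) {a b : V} (ha : a ∈ Mc G p (f i)) (hb : b ∈ Mc G p (f j))
    (hab : a = b ∨ G.Adj a b) : Qc G p (f i) = Qc G p (f j) ∧ (i = j ∨ i = j + 1 ∨ j = i + 1) := by
  by_cases e : f i = f j
  · rw [e]; exact ⟨rfl, Or.inl (h.lp.path.inj i0 is j0 js e)⟩
  by_cases e' : G.Adj (f i) (f j)
  · refine ⟨h.Meq j0 js i0 is hj ⟨Or.inr hi.symm, Or.inr e'⟩, ?_⟩
    rw [h.lp.path.adj i0 is j0 js] at e'; omega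
  · have := h.g.Mc_ne hi hj e e' ha hb
    rcases hab with hab | hab
    · exact absurd hab this.1
    · exact absurd hab this.2

end SSt

def TL (G : SimpleGraph V) (p y : V) (E : Set V) (f : ℤ → V) (l : ℤ) : Set V :=
  {v | v ∈ E ∨ ((v ∈ Mc G p y ∨ ∃ k, 0 ≤ k ∧ k < l ∧ v = f k) ∧ v ∉ Qc G p (f l))}

def TR (G : SimpleGraph V) (p z : V) (E : Set V) (f : ℤ → V) (s l : ℤ) : Set V :=
  {v | v ∈ E ∨ ((v ∈ Mc G p z ∨ ∃ k, l < k ∧ k ≤ s + 1 ∧ v = f k) ∧ v ∉ Qc G p (f l))}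

lemma TR_eq (G : SimpleGraph V) (p z : V) (E : Set V) (f : ℤ → V) (s l : ℤ) :
    TR G p z E f s l = TL G p z E (fun k => f (s + 1 - k)) (s + 1 - l) := by
  ext v
  simp only [TR, TL, Set.mem_setOf_eq, sub_sub_cancel]
  refine or_congr Iff.rfl (and_congr_left' (or_congr Iff.rfl ?_))
  constructor
  · rintro ⟨k, k1, k2, k3⟩; exact ⟨s + 1 - k, by omega, by omega, by simpa using k3⟩
  · rintro ⟨k, k1, k2, k3⟩; exact ⟨s + 1 - k, by omega, by omega, k3⟩

namespace SSt
variable {G : SimpleGraph V} {p y z : V} {F E : Set V} {f : ℤ → V} {s : ℤ}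

lemma TL_main (h : SSt G p y z F E f s) {l : ℤ} (l0 : 0 ≤ l) (ls : l ≤ s + 1) (hl : G.Adj p (f l)) :
    Conn G (TL G p y E f l) ∧ ∃ u ∈ TL G p y E f l, ∃ a ∈ Mc G p (f l), G.Adj u a := by
  have P := h.lp.path
  have hs := h.lp.s2
  obtain ⟨u, hu, a, ha, hua⟩ := h.EA
  by_cases e0 : l = 0
  · subst e0
    have : TL G p y E f 0 = E := by
      ext v
      constructor
      · rintro (hv | ⟨hv | ⟨k, k1, k2, -⟩, hv'⟩)
        · exact hv
        · rw [h.M0] at hv'; exact absurd hv.1 hv'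
        · omega
      · exact Or.inl
    rw [this]
    refine ⟨h.Ec, u, hu, a, ?_, hua⟩
    rw [Mc, h.M0]; exact ha
  have l3 : 3 ≤ l := by
    rcases h.I3 le_rfl ls (by omega) h.I0 hl with e | e
    · exfalso; apply h.I1; rwa [show l = 1 by omega] at hl
    · omega
  obtain ⟨m, m1, m2, m3, m4⟩ : ∃ m, 0 ≤ m ∧ m < l ∧ (∀ k, 0 ≤ k → k < l → (f k ∉ Qc G p (f l) ↔ k ≤ m)) ∧
      ∃ a ∈ Mc G p (f l), G.Adj (f m) a := by
    by_cases e : G.Adj p (f (l - 1))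
    · refine ⟨l - 2, by omega, by omega, fun k k1 k2 => ⟨fun hk => ?_, fun hk hk' => ?_⟩, f (l - 1), ⟨?_, ?_⟩, ?_⟩
      · by_contra hc
        obtain rfl : k = l - 1 := by omega
        exact hk ⟨Or.inr e.symm, Or.inr ((P.adj (by omega) (by omega) (by omega) (by omega)).2 (by omega))⟩
      · have := (h.fM (by omega) (by omega) (by omega) (by omega) hk').2; omega
      · exact ⟨Or.inr e.symm, Or.inr ((P.adj (by omega) (by omega) (by omega) (by omega)).2 (by omega))⟩
      · exact h.pf _ (by omega) (by omega)
      · exact (P.adj (by omega) (by omega) (by omega) (by omega)).2 (by omega)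
    · refine ⟨l - 1, by omega, by omega, fun k k1 k2 => ⟨fun hk => by omega, fun hk hk' => ?_⟩, f l, ⟨?_, ?_⟩, ?_⟩
      · have := h.fM (by omega) (by omega) (by omega) (by omega) hk'
        obtain rfl : k = l - 1 := by omega
        exact e this.1
      · exact Qc.right hl
      · exact h.pf _ (by omega) (by omega)
      · exact (P.adj (by omega) (by omega) (by omega) (by omega)).2 (by omega)
  have hTL : TL G p y E f l = (E ∪ Mc G p y) ∪ f '' Set.Icc 0 m := by
    ext v
    constructor
    · rintro (hv | ⟨hv | ⟨k, k1, k2, rfl⟩, hv'⟩)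
      · exact Or.inl (Or.inl hv)
      · exact Or.inl (Or.inr hv)
      · exact Or.inr ⟨k, ⟨k1, (m3 k k1 k2).1 hv'⟩, rfl⟩
    · rintro ((hv | hv) | ⟨k, ⟨k1, k2⟩, rfl⟩)
      · exact Or.inl hv
      · refine Or.inr ⟨Or.inl hv, fun hv' => ?_⟩
        have := (h.Mlink (i := 0) (a := v) (b := v) (by omega) (by omega) l0 ls h.I0 hl (by rw [Mc, h.M0]; exact hv) ⟨hv', hv.2⟩ (Or.inl rfl)).2
        omega
      · exact Or.inr ⟨Or.inr ⟨k, k1, by omega, rfl⟩, (m3 k k1 (by omega)).2 k2⟩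
  rw [hTL]
  refine ⟨?_, f m, Or.inr ⟨m, ⟨m1, le_rfl⟩, rfl⟩, m4⟩
  refine Conn.union (Conn.union h.Ec (conn_clique fun x hx w hw e => h.g.clique h.hy x hx.1 w hw.1 e)
    ⟨u, hu, a, ha, Or.inr hua⟩) (IPath.conn (P.sub le_rfl (by omega))) ⟨f 0, Or.inr h.lp.f0, f 0, ⟨0, ⟨le_rfl, m1⟩, rfl⟩, Or.inl rfl⟩

lemma TR_main (h : SSt G p y z F E f s) {l : ℤ} (l0 : 0 ≤ l) (ls : l ≤ s + 1) (hl : G.Adj p (f l)) :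
    Conn G (TR G p z E f s l) ∧ ∃ u ∈ TR G p z E f s l, ∃ a ∈ Mc G p (f l), G.Adj u a := by
  have := h.rev.TL_main (l := s + 1 - l) (by omega) (by omega) (by simpa using hl)
  rw [TR_eq]
  simpa using this

end SSt
end Paper
end

section
open SimpleGraph
namespace Paper
variable {V : Type*}

lemma hf_of_path' {G : SimpleGraph V} (g : Good G) {f : ℤ → V} {p : V} {i j : ℤ} (hij : i + 3 ≤ j) (hf : IPath G f i j)
    (hp : ∀ k, i ≤ k → k ≤ j → p ≠ f k) (hpa : ∀ k, i ≤ k → k ≤ j → (G.Adj p (f k) ↔ (k = i ∨ k = j)))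
    (hub : ∀ v x y, v ≠ p → (∀ z, i ≤ z → z ≤ j → v ≠ f z) → i ≤ x → x ≤ j → i ≤ y → y ≤ j →
      G.Adj v (f x) → G.Adj v (f y) → f x = f y ∨ G.Adj (f x) (f y)) :
    ∃ c, HF G c (j - i + 2) ∧ c 0 = p ∧ (∀ k, 1 ≤ k → k ≤ j - i + 1 → c k = f (i + k - 1)) := by
  refine hf_of_path hij hf hp hpa hub ?_
  intro v x hvp hvf x1 x2 hvx hv
  by_contra hc
  have hH : IsHoleSet G ((fun _ : ℤ => p) '' Set.Icc 0 0 ∪ f '' Set.Icc i j) := by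
    refine hole2 (IPath.single G _ 0) hf le_rfl (by omega) (by omega) ?_
    intro a b a1 a2 b1 b2
    refine ⟨?_, hp b b1 b2⟩
    rw [hpa b b1 b2]; omega
  have hS : ∀ w, w ∈ ((fun _ : ℤ => p) '' Set.Icc 0 0 ∪ f '' Set.Icc i j) ↔ w = p ∨ ∃ k, i ≤ k ∧ k ≤ j ∧ w = f k := by
    intro w
    constructor
    · rintro (⟨_, -, rfl⟩ | ⟨k, ⟨k1, k2⟩, rfl⟩)
      · exact Or.inl rfl
      · exact Or.inr ⟨k, k1, k2, rfl⟩
    · rintro (rfl | ⟨k, k1, k2, rfl⟩)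
      · exact Or.inl ⟨0, by simp, rfl⟩
      · exact Or.inr ⟨k, ⟨k1, k2⟩, rfl⟩
  generalize ((fun _ : ℤ => p) '' Set.Icc 0 0 ∪ f '' Set.Icc i j) = S at hH hS
  have hvS : v ∉ S := by
    rw [hS]; rintro (e | ⟨k, k1, k2, e⟩)
    · exact hvp e
    · exact hvf k k1 k2 e
  have hpS : p ∈ S := (hS p).2 (Or.inl rfl)
  have hfS : ∀ k, i ≤ k → k ≤ j → f k ∈ S := fun k k1 k2 => (hS _).2 (Or.inr ⟨k, k1, k2, rfl⟩)
  by_cases hx' : ∃ x', i ≤ x' ∧ x' ≤ j ∧ x' ≠ x ∧ G.Adj v (f x')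
  · obtain ⟨x', y1, y2, hne, hvx'⟩ := hx'
    have had : G.Adj (f x) (f x') := by
      rcases hub v x x' hvp hvf x1 x2 y1 y2 hvx hvx' with e | e
      · exact absurd (hf.inj x1 x2 y1 y2 e).symm hne
      · exact e
    have hN : nbrsIn G S v = {p, f x, f x'} := by
      ext w
      constructor
      · rintro ⟨hw, hvw⟩
        rcases (hS w).1 hw with rfl | ⟨k, k1, k2, rfl⟩
        · exact Or.inl rfl
        · have e1 := hub v x k hvp hvf x1 x2 k1 k2 hvx hvw
          have e2 := hub v x' k hvp hvf y1 y2 k1 k2 hvx' hvw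
          rcases e1 with e1 | e1
          · exact Or.inr (Or.inl e1.symm)
          rcases e2 with e2 | e2
          · exact Or.inr (Or.inr e2.symm)
          rw [hf.adj x1 x2 k1 k2] at e1
          rw [hf.adj y1 y2 k1 k2] at e2
          rw [hf.adj x1 x2 y1 y2] at had
          omega
      · rintro (rfl | rfl | rfl)
        · exact ⟨hpS, hv⟩
        · exact ⟨hfS _ x1 x2, hvx⟩
        · exact ⟨hfS _ y1 y2, hvx'⟩
    refine g.three S v hH hvS ?_ _ _ (hfS x x1 x2) (hfS x' y1 y2) hvx hvx' had
    rw [hN, Set.ncard_eq_three]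
    exact ⟨_, _, _, hp x x1 x2, hp x' y1 y2, had.ne, rfl⟩
  · push Not at hx'
    have hN : nbrsIn G S v = {p, f x} := by
      ext w
      constructor
      · rintro ⟨hw, hvw⟩
        rcases (hS w).1 hw with rfl | ⟨k, k1, k2, rfl⟩
        · exact Or.inl rfl
        · by_cases e : k = x
          · subst e; exact Or.inr rfl
          · exact absurd hvw (hx' k k1 k2 e)
      · rintro (rfl | rfl)
        · exact ⟨hpS, hv⟩
        · exact ⟨hfS _ x1 x2, hvx⟩
    rcases g.even S v hH hvS (by rw [hN, Set.ncard_pair (hp x x1 x2)]; exact even_two) p (f x) hpS (hfS x x1 x2) hv hvx with e | e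
    · exact hp x x1 x2 e
    · exact hc e

lemma SSt.sector {G : SimpleGraph V} {p y z : V} {F E : Set V} {f : ℤ → V} {s : ℤ} (h : SSt G p y z F E f s)
    {i j : ℤ} (i0 : 0 ≤ i) (js : j ≤ s + 1) (hij : i + 3 ≤ j) (hi : G.Adj p (f i)) (hj : G.Adj p (f j))
    (hno : ∀ k, i < k → k < j → ¬ G.Adj p (f k)) :
    ∃ c, HF G c (j - i + 2) ∧ c 0 = p ∧ (∀ k, 1 ≤ k → k ≤ j - i + 1 → c k = f (i + k - 1)) ∧
      Q G c 0 = Qc G p (f i) ∧ Q G c (-1) = Qc G p (f j) := by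
  obtain ⟨c, h1, h2, h3⟩ := hf_of_path' h.g hij (h.lp.path.sub i0 js) (fun k k1 k2 => (h.pf k (by omega) (by omega)).symm)
    (fun k k1 k2 => ⟨fun hk => by
      by_contra hc
      exact hno k (by omega) (by omega) hk, by rintro (rfl | rfl) <;> assumption⟩)
    (fun v x w hvp hvf x1 x2 w1 w2 hx hw => h.hub i0 js hvp hvf x1 x2 w1 w2 hx hw)
  refine ⟨c, h1, h2, h3, ?_, ?_⟩
  · rw [Q, h2, show (0:ℤ) + 1 = 1 by ring, h3 1 (by omega) (by omega), show i + 1 - 1 = i by ring]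
  · have := h1.add (-1)
    rw [h3 _ (by omega) (by omega), show i + (-1 + (j - i + 2)) - 1 = j by ring] at this
    rw [Q, ← this, show (-1:ℤ) + 1 = 0 by ring, h2, Qc_comm]

lemma HF.att_idx {G : SimpleGraph V} (g : Good G) {c : ℤ → V} {n : ℤ} (h : HF G c n) {i x : ℤ} {a : V}
    (ha : a ∈ Q G c i) (hx : a ∈ Q G c x) : c i = c x ∨ (a = c i ∧ c i = c (x + 1)) ∨ (a = c (i + 1) ∧ c (i + 1) = c x) := by
  by_cases hh : ∃ m, a = c m
  · obtain ⟨m, rfl⟩ := hh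
    rcases h.z2 ha with e | e <;> rcases h.z2 hx with e' | e'
    · exact Or.inl (e.symm.trans e')
    · exact Or.inr (Or.inl ⟨e, e.symm.trans e'⟩)
    · exact Or.inr (Or.inr ⟨e, e.symm.trans e'⟩)
    · left
      have := e.symm.trans e'
      rw [h.eq_iff] at this ⊢
      rwa [show i - x = i + 1 - (x + 1) by ring]
  · push Not at hh
    exact Or.inl (h.z4 g ha hx hh hh (Or.inl rfl))

lemma HF.att2 {G : SimpleGraph V} (g : Good G) (hN : NCC G) {c : ℤ → V} {n : ℤ} (h : HF G c n) {W : Set V}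
    (hW : Conn G W) (hZ : ∀ v ∈ W, v ∉ Z G c) (hNW : ∀ v ∈ W, ∀ w, G.Adj v w → w ∈ W ∨ w ∈ Z G c)
    (hA : ∃ u ∈ W, ∃ a ∈ Q G c 0, a ≠ c 0 ∧ G.Adj u a) (hB : ∃ u ∈ W, ∃ a ∈ Q G c (-1), a ≠ c 0 ∧ G.Adj u a) :
    ∀ v ∈ W, ∀ w ∈ Z G c, G.Adj v w → w ∈ Q G c (-1) ∨ w ∈ Q G c 0 := by
  obtain ⟨u, hu, a, ha, ha0, hua⟩ := hA
  obtain ⟨v, hv, b, hb, hb0, hvb⟩ := hB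
  have hn := h.five
  obtain ⟨x0, hx0⟩ := lemmaA g hN h hW hu hZ hNW
  obtain ⟨x, x1, x2, x3⟩ := h.norm (-2) x0
  have e0 : c x = c x0 := by simpa using x3 0
  have e1 : c (x - 1) = c (x0 - 1) := x3 (-1)
  rw [← h.Q_congr e0, ← h.Q_congr e1] at hx0
  have key : ∀ y z : ℤ, y - z < 2 * n → -(2 * n) < y - z → c y = c z → y - z = 0 ∨ y - z = n ∨ y - z = -n :=
    fun y z h1 h2 e => by
      have := (h.eq_iff y z).1 e
      rwa [dvd_small hn (by omega) (by omega)] at this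
  have r1 : 0 ≤ x ∧ x ≤ 2 := by
    rcases hx0 u hu a ⟨0, ha⟩ hua with e | e
    · rcases h.att_idx g ha e with e | ⟨e, -⟩ | ⟨-, e⟩
      · have := key _ _ (by omega) (by omega) e; omega
      · exact absurd e ha0
      · have := key _ _ (by omega) (by omega) e; omega
    · rcases h.att_idx g ha e with e | ⟨e, -⟩ | ⟨-, e⟩
      · have := key _ _ (by omega) (by omega) e; omega
      · exact absurd e ha0
      · have := key _ _ (by omega) (by omega) e; omega
  have r2 : x ≤ 0 := by
    rcases hx0 v hv b ⟨-1, hb⟩ hvb with e | e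
    · rcases h.att_idx g hb e with e | ⟨-, e⟩ | ⟨e, -⟩
      · have := key _ _ (by omega) (by omega) e; omega
      · have := key _ _ (by omega) (by omega) e; omega
      · exact absurd e hb0
    · rcases h.att_idx g hb e with e | ⟨-, e⟩ | ⟨e, -⟩
      · have := key _ _ (by omega) (by omega) e; omega
      · have := key _ _ (by omega) (by omega) e; omega
      · exact absurd e hb0
  obtain rfl : x = 0 := by omega
  exact hx0

end Paper
end

section
open SimpleGraph
namespace Paper
variable {V : Type*}

def NZ (G : SimpleGraph V) (p : V) (f : ℤ → V) (i j : ℤ) (v : V) : Prop :=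
  v ≠ p ∧ (∀ k, i ≤ k → k ≤ j → v ≠ f k) ∧ v ∉ Qc G p (f i) ∧ v ∉ Qc G p (f j) ∧
    (∀ k, i < k → k < j → ¬ G.Adj v (f k))

namespace SSt
variable {G : SimpleGraph V} {p y z : V} {F E : Set V} {f : ℤ → V} {s : ℤ}

lemma TL_NZ (h : SSt G p y z F E f s) {i j : ℤ} (i0 : 0 ≤ i) (js : j ≤ s + 1) (hij : i + 3 ≤ j)
    (hi : G.Adj p (f i)) (hj : G.Adj p (f j)) {v : V} (hv : v ∈ TL G p y E f i) : NZ G p f i j v := by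
  have P := h.lp.path
  have hs := h.lp.s2
  rcases hv with hv | ⟨hv | ⟨m, m1, m2, rfl⟩, hvi⟩
  · have hvF := h.EF v hv
    have hvQ := h.Ed v hv
    have hvp : v ≠ p := by rintro rfl; exact hvQ.1 (Qc.left h.hy)
    have hvf : ∀ k, 0 ≤ k → k ≤ s + 1 → v ≠ f k := by
      rintro k k1 k2 rfl
      by_cases a : k = 0
      · subst a; exact hvQ.1 h.lp.f0.1
      by_cases b : k = s + 1
      · subst b; exact hvQ.2 h.lp.f1.1
      exact hvF (h.lp.mem k (by omega) (by omega))
    have hM : ∀ k, 0 ≤ k → k ≤ s + 1 → v ∉ Qc G p (f k) := by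
      intro k k1 k2 hk
      rcases h.MX k1 k2 hk with e | e | e
      · exact hvF e
      · exact hvQ.1 e
      · exact hvQ.2 e
    refine ⟨hvp, fun k k1 k2 => hvf k (by omega) (by omega), hM i i0 (by omega), hM j (by omega) js, ?_⟩
    intro k k1 k2 h1
    have a1 := h.out hvF hvQ.1 hvQ.2 (by omega) (by omega) h1
    omega
  · have hvp := hv.2
    refine ⟨hvp, ?_, hvi, ?_, ?_⟩
    · rintro k k1 k2 rfl
      have h0 : f k ∈ Qc G p (f 0) := by rw [h.M0]; exact hv.1
      have := h.fM le_rfl (by omega) (by omega) (by omega) h0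
      by_cases e : k = 0
      · subst e
        obtain rfl : i = 0 := by omega
        exact hvi h0
      · obtain rfl : k = 1 := by omega
        exact h.I1 this.1
    · intro hvj
      have := (h.Mlink (i := 0) (j := j) (a := v) (b := v) le_rfl (by omega) (by omega) js h.I0 hj
        (by rw [Mc, h.M0]; exact hv) ⟨hvj, hvp⟩ (Or.inl rfl)).2
      omega
    · intro k k1 k2 h1
      have := h.inA hv (by omega) (by omega) h1
      obtain rfl : i = 0 := by omega
      rw [h.M0] at hvi
      exact hvi hv.1
  · refine ⟨h.pf m m1 (by omega), ?_, hvi, ?_, ?_⟩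
    · intro k k1 k2 e
      have := P.inj m1 (by omega) (by omega) (by omega) e
      omega
    · intro hmj
      have := (h.fM (by omega) (by omega) m1 (by omega) hmj).2
      omega
    · intro k k1 k2 h1
      rw [P.adj m1 (by omega) (by omega) (by omega)] at h1
      omega

lemma TR_NZ (h : SSt G p y z F E f s) {i j : ℤ} (i0 : 0 ≤ i) (js : j ≤ s + 1) (hij : i + 3 ≤ j)
    (hi : G.Adj p (f i)) (hj : G.Adj p (f j)) {v : V} (hv : v ∈ TR G p z E f s j) : NZ G p f i j v := by
  rw [TR_eq] at hv
  have := h.rev.TL_NZ (i := s + 1 - j) (j := s + 1 - i) (by omega) (by omega) (by omega) (by simpa using hj)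
    (by simpa using hi) hv
  obtain ⟨a1, a2, a3, a4, a5⟩ := this
  refine ⟨a1, fun k k1 k2 => ?_, by simpa using a4, by simpa using a3, fun k k1 k2 => ?_⟩
  · simpa using a2 (s + 1 - k) (by omega) (by omega)
  · simpa using a5 (s + 1 - k) (by omega) (by omega)

lemma sec (h : SSt G p y z F E f s) (hN : NCC G)
    {i j : ℤ} (i0 : 0 ≤ i) (js : j ≤ s + 1) (hij : i + 3 ≤ j) (hi : G.Adj p (f i)) (hj : G.Adj p (f j))
    (hno : ∀ k, i < k → k < j → ¬ G.Adj p (f k)) :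
    ∃ c n, HF G c n ∧ Q G c 0 = Qc G p (f i) ∧ Q G c (-1) = Qc G p (f j) ∧
      Z G c ⊆ Comp G (Qc G p (f i) ∪ Qc G p (f j))ᶜ (f (i+1)) ∪ (Qc G p (f i) ∪ Qc G p (f j)) ∧
      Comp G (Qc G p (f i) ∪ Qc G p (f j))ᶜ (f (i+1)) ⊆ F ∧
      (∀ l, 0 ≤ l → l ≤ s + 1 → G.Adj p (f l) → ∀ v ∈ Qc G p (f l),
        v ∉ Comp G (Qc G p (f i) ∪ Qc G p (f j))ᶜ (f (i+1))) ∧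
      (∀ k, i < k → k < j → f k ∈ Z G c ∧ f k ∈ Comp G (Qc G p (f i) ∪ Qc G p (f j))ᶜ (f (i+1))) := by
  obtain ⟨c, hc, c0, ck, Q0, Q1⟩ := h.sector i0 js hij hi hj hno
  have P := h.lp.path
  have hs := h.lp.s2
  refine ⟨c, _, hc, Q0, Q1, ?_⟩
  have hn := hc.five
  -- description of Z
  have hZc : ∀ v, v ∈ Z G c → v ∈ Qc G p (f i) ∨ v ∈ Qc G p (f j) ∨
      ∃ k, i ≤ k ∧ k < j ∧ v ∈ Qc G (f k) (f (k+1)) := by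
    rintro v ⟨x0, hx0⟩
    obtain ⟨x, x1, x2, x3⟩ := hc.norm 0 x0
    have e0 : c x = c x0 := by simpa using x3 0
    rw [← hc.Q_congr e0] at hx0
    by_cases a : x = 0
    · subst a; rw [Q0] at hx0; exact Or.inl hx0
    by_cases b : x = j - i + 1
    · have : c x = c (-1) := by rw [← hc.add (-1)]; congr 1; omega
      rw [hc.Q_congr this, Q1] at hx0
      exact Or.inr (Or.inl hx0)
    · right; right
      refine ⟨i + x - 1, by omega, by omega, ?_⟩
      rw [Q, ck x (by omega) (by omega), ck (x+1) (by omega) (by omega)] at hx0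
      rwa [show i + x - 1 + 1 = i + (x + 1) - 1 by ring]
  have hNZ : ∀ v, NZ G p f i j v → v ∉ Z G c := by
    rintro v ⟨a1, a2, a3, a4, a5⟩ hv
    rcases hZc v hv with e | e | ⟨k, k1, k2, e1, e2⟩
    · exact a3 e
    · exact a4 e
    · have r1 := e1.resolve_left (a2 k (by omega) (by omega))
      have r2 := e2.resolve_left (a2 (k+1) (by omega) (by omega))
      by_cases k = i
      · exact a5 _ (by omega) (by omega) r2
      · exact a5 _ (by omega) (by omega) r1
  obtain ⟨TLc, TLa⟩ := h.TL_main i0 (by omega) hi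
  obtain ⟨TRc, TRa⟩ := h.TR_main (by omega) js hj
  obtain ⟨e, he, -⟩ := h.EA
  have TLZ : TL G p y E f i ⊆ (Z G c)ᶜ := fun v hv => hNZ v (h.TL_NZ i0 js hij hi hj hv)
  have TRZ : TR G p z E f s j ⊆ (Z G c)ᶜ := fun v hv => hNZ v (h.TR_NZ i0 js hij hi hj hv)
  have eW : e ∈ Comp G (Z G c)ᶜ e := Comp.self (TLZ (Or.inl he))
  have TLW : TL G p y E f i ⊆ Comp G (Z G c)ᶜ e := TLc.subset_comp TLZ (Or.inl he) eW
  have TRW : TR G p z E f s j ⊆ Comp G (Z G c)ᶜ e := TRc.subset_comp TRZ (Or.inl he) eW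
  have WZ : ∀ v ∈ Comp G (Z G c)ᶜ e, v ∉ Z G c := fun v hv => Comp.subset hv
  have WN : ∀ v ∈ Comp G (Z G c)ᶜ e, ∀ w, G.Adj v w → w ∈ Comp G (Z G c)ᶜ e ∨ w ∈ Z G c := by
    intro v hv w hw
    by_cases hc : w ∈ Z G c
    · exact Or.inr hc
    · exact Or.inl (Comp.closed hv hw hc)
  have att := hc.att2 h.g hN Comp.conn WZ WN
    (by obtain ⟨u, hu, a, ha, hua⟩ := TLa
        exact ⟨u, TLW hu, a, by rw [Q0]; exact ha.1, by rw [c0]; exact ha.2, hua⟩)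
    (by obtain ⟨u, hu, a, ha, hua⟩ := TRa
        exact ⟨u, TRW hu, a, by rw [Q1]; exact ha.1, by rw [c0]; exact ha.2, hua⟩)
  rw [Q0, Q1] at att
  generalize Comp G (Z G c)ᶜ e = W at *
  have WN' : ∀ v ∈ W, ∀ w, G.Adj v w → w ∉ (Qc G p (f i) ∪ Qc G p (f j)) → w ∈ W := by
    intro v hv w hw hwC
    rcases WN v hv w hw with e | e
    · exact e
    · exact absurd (att v hv w e hw).symm hwC
  have fC : ∀ k, i < k → k < j → f k ∈ (Qc G p (f i) ∪ Qc G p (f j))ᶜ := by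
    rintro k k1 k2 (e | e)
    · exact hno k k1 k2 (h.fM (by omega) (by omega) (by omega) (by omega) e).1
    · exact hno k k1 k2 (h.fM (by omega) (by omega) (by omega) (by omega) e).1
  have fF : ∀ k, i < k → k < j → f k ∈ Comp G (Qc G p (f i) ∪ Qc G p (f j))ᶜ (f (i+1)) := by
    intro k k1 k2
    have hP : IPath G f (i+1) (j-1) := P.sub (by omega) (by omega)
    refine hP.conn.subset_comp ?_ (y := f (i+1)) ⟨i+1, ⟨le_rfl, by omega⟩, rfl⟩ (Comp.self (fC _ (by omega) (by omega)))
      ⟨k, ⟨by omega, by omega⟩, rfl⟩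
    rintro _ ⟨k, ⟨k1, k2⟩, rfl⟩
    exact fC k (by omega) (by omega)
  have fZ : ∀ k, i ≤ k → k ≤ j → f k ∈ Z G c := by
    intro k k1 k2
    have := hc.memZ (k - i + 1)
    rwa [ck _ (by omega) (by omega), show i + (k - i + 1) - 1 = k by ring] at this
  have hdis : ∀ v ∈ Comp G (Qc G p (f i) ∪ Qc G p (f j))ᶜ (f (i+1)), v ∉ W := by
    rintro v ⟨m, hm⟩ hv
    obtain ⟨a, b, h1, h2, h3, h4, h5⟩ := hm.symm.exit hv (fun hh => WZ _ hh (fZ (i+1) (by omega) (by omega)))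
    exact h3 (WN' a h1 b h5 h4)
  refine ⟨?_, ?_, ?_, fun k k1 k2 => ⟨fZ k (by omega) (by omega), fF k k1 k2⟩⟩
  · intro v hv
    rcases hZc v hv with e | e | ⟨k, k1, k2, e1, e2⟩
    · exact Or.inr (Or.inl e)
    · exact Or.inr (Or.inr e)
    · by_cases hvC : v ∈ Qc G p (f i) ∪ Qc G p (f j)
      · exact Or.inr hvC
      left
      by_cases k = i
      · have := fF (k+1) (by omega) (by omega)
        rcases e2 with e2 | e2
        · rw [e2]; exact this
        · exact Comp.closed this e2.symm hvC
      · have := fF k (by omega) (by omega)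
        rcases e1 with e2 | e2
        · rw [e2]; exact this
        · exact Comp.closed this e2.symm hvC
  · rintro x hx
    by_contra hxF
    have hx2 := hx
    obtain ⟨m, hm⟩ := hx
    have h1F : f (i+1) ∈ F := h.lp.mem _ (by omega) (by omega)
    obtain ⟨a, b, h1, h2, h3, h4, h5⟩ := (Comp.wk_in hm (fF (i+1) (by omega) (by omega))).exit h1F hxF
    have hbC := Comp.subset h4
    have hbp : b ≠ p := by rintro rfl; exact hbC (Or.inl (Qc.left hi))
    rcases h.FN a h1 b h5 with e | e | e
    · exact h3 e
    · exact hdis b h4 (TLW (Or.inr ⟨Or.inl ⟨e, hbp⟩, fun hh => hbC (Or.inl hh)⟩))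
    · exact hdis b h4 (TRW (Or.inr ⟨Or.inl ⟨e, hbp⟩, fun hh => hbC (Or.inr hh)⟩))
  · intro l l0 ls hl v hv hvF
    have hvC := Comp.subset hvF
    have n1 : f l ∉ Qc G p (f i) := fun hh => hvC (Or.inl (h.Meq i0 (by omega) l0 ls hi hh ▸ hv))
    have n2 : f l ∉ Qc G p (f j) := fun hh => hvC (Or.inr (h.Meq (by omega) js l0 ls hj hh ▸ hv))
    have hlW : f l ∈ W := by
      by_cases a : l < i
      · exact TLW (Or.inr ⟨Or.inr ⟨l, l0, a, rfl⟩, n1⟩)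
      by_cases b : j < l
      · exact TRW (Or.inr ⟨Or.inr ⟨l, b, ls, rfl⟩, n2⟩)
      exfalso
      by_cases a' : l = i
      · subst a'; exact n1 (Qc.right hl)
      by_cases b' : l = j
      · subst b'; exact n2 (Qc.right hl)
      exact hno l (by omega) (by omega) hl
    rcases hv.2 with e | e
    · exact hdis v hvF (e ▸ hlW)
    · exact hdis v hvF (WN' _ hlW v e.symm hvC)

end SSt
end Paper
end

section
open SimpleGraph
namespace Paper
variable {V : Type*}

def StateOK (G : SimpleGraph V) (t N : ℕ) : Prop :=
  ∀ (p y z : V) (F E : Set V), G.Adj p y → G.Adj p z → y ≠ z → ¬ G.Adj y z → Conn G F → F.Nonempty →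
    (∀ v ∈ F, v ∉ Qc G p y ∧ v ∉ Qc G p z) →
    (∀ v ∈ F, ∀ w, G.Adj v w → w ∈ F ∨ w ∈ Qc G p y ∨ w ∈ Qc G p z) →
    Conn G E → E.Nonempty → (∀ v ∈ E, v ∉ Qc G p y ∧ v ∉ Qc G p z) →
    (∀ v ∈ E, ∀ w, G.Adj v w → w ∈ E ∨ w ∈ Qc G p y ∨ w ∈ Qc G p z) →
    (∀ v ∈ E, v ∉ F) → F.ncard ≤ N →
    ∃ CC, TDec G (3 * t) (F ∪ (Qc G p y ∪ Qc G p z)) CC ∧ ∃ B ∈ CC, Qc G p y ∪ Qc G p z ⊆ B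

lemma hole_ind {G : SimpleGraph V} {c : ℤ → V} {n : ℤ} (h : HF G c n) {t N : ℕ}
    (hS : StateOK G t N) {u : V} (hu : u ∉ Z G c) (hcard : (Comp G (Z G c)ᶜ u).ncard ≤ N) (i : ℤ)
    (hatt : ∀ v ∈ Comp G (Z G c)ᶜ u, ∀ w ∈ Z G c, G.Adj v w → w ∈ Q G c (i-1) ∨ w ∈ Q G c i) :
    ∃ CC, TDec G (3 * t) (Comp G (Z G c)ᶜ u ∪ (Q G c (i-1) ∪ Q G c i)) CC ∧
        ∃ B ∈ CC, Q G c (i-1) ∪ Q G c i ⊆ B := by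
  have hn := h.five
  have e1 : Q G c (i-1) = Qc G (c i) (c (i-1)) := by
    rw [Q, Qc_comm, show i - 1 + 1 = i by ring]
  have e2 : Q G c i = Qc G (c i) (c (i+1)) := rfl
  have hZ1 : ∀ v, v ∈ Q G c (i-1) → v ∈ Z G c := fun v hv => ⟨_, hv⟩
  have hZ2 : ∀ v, v ∈ Q G c i → v ∈ Z G c := fun v hv => ⟨_, hv⟩
  have n1 : c (i+2) ∉ Q G c (i-1) := by
    intro hh
    rcases h.z2 hh with e | e
    · rw [h.eq_iff, dvd_small hn (by omega) (by omega)] at e; omega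
    · rw [h.eq_iff, dvd_small hn (by omega) (by omega)] at e; omega
  have n2 : c (i+2) ∉ Q G c i := by
    intro hh
    rcases h.z2 hh with e | e
    · rw [h.eq_iff, dvd_small hn (by omega) (by omega)] at e; omega
    · rw [h.eq_iff, dvd_small hn (by omega) (by omega)] at e; omega
  have hFN : ∀ v ∈ Comp G (Z G c)ᶜ u, ∀ w, G.Adj v w → w ∈ Comp G (Z G c)ᶜ u ∨ w ∈ Q G c (i-1) ∨ w ∈ Q G c i := by
    intro v hv w hw
    by_cases hc : w ∈ Z G c
    · exact Or.inr (hatt v hv w hc hw)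
    · exact Or.inl (Comp.closed hv hw hc)
  have key := hS (c i) (c (i-1)) (c (i+1)) (Comp G (Z G c)ᶜ u) (Comp G (Q G c (i-1) ∪ Q G c i)ᶜ (c (i+2)))
    (by have := h.succ (i-1); rw [show i - 1 + 1 = i by ring] at this; exact this.symm) (h.succ i)
    (by intro e; rw [h.eq_iff, dvd_small hn (by omega) (by omega)] at e; omega)
    (by intro e; rw [h.adj_iff, dvd_small hn (by omega) (by omega), dvd_small hn (by omega) (by omega)] at e; omega)
    Comp.conn ⟨u, Comp.self hu⟩
  rw [← e1, ← e2] at key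
  refine key ?_ hFN Comp.conn ⟨_, Comp.self ?_⟩ ?_ ?_ ?_ hcard
  · exact fun v hv => ⟨fun hh => Comp.subset hv (hZ1 v hh), fun hh => Comp.subset hv (hZ2 v hh)⟩
  · rintro (e | e)
    · exact n1 e
    · exact n2 e
  · exact fun v hv => ⟨fun hh => Comp.subset hv (Or.inl hh), fun hh => Comp.subset hv (Or.inr hh)⟩
  · intro v hv w hw
    by_cases hc : w ∈ Q G c (i-1) ∪ Q G c i
    · exact Or.inr hc
    · exact Or.inl (Comp.closed hv hw hc)
  · rintro v ⟨m, hm⟩ hv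
    obtain ⟨a, b, h1, h2, h3, h4, h5⟩ := hm.symm.exit hv (fun hh => Comp.subset hh (h.memZ (i+2)))
    rcases hFN a h1 b h5 with e | e
    · exact h3 e
    · exact h4 e

namespace SSt
variable {G : SimpleGraph V} {p y z : V} {F E : Set V} {f : ℤ → V} {s : ℤ}

lemma sec_dec [Finite V] (h : SSt G p y z F E f s) (hN : NCC G) {t N : ℕ}
    (hcl : ∀ K : Set V, (∀ x ∈ K, ∀ y ∈ K, x ≠ y → G.Adj x y) → K.ncard ≤ t)
    (hS : StateOK G t N) (hF : F.ncard ≤ N + 1)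
    {i j : ℤ} (i0 : 0 ≤ i) (js : j ≤ s + 1) (hij : i + 3 ≤ j) (hi : G.Adj p (f i)) (hj : G.Adj p (f j))
    (hno : ∀ k, i < k → k < j → ¬ G.Adj p (f k)) :
    ∃ Y, Y ⊆ F ∧ Conn G Y ∧ (∀ v ∈ Y, ∀ w, G.Adj v w → w ∈ Y ∨ w ∈ Qc G p (f i) ∪ Qc G p (f j)) ∧
      (∀ l, 0 ≤ l → l ≤ s + 1 → G.Adj p (f l) → ∀ v ∈ Qc G p (f l), v ∉ Y) ∧ (∀ k, i < k → k < j → f k ∈ Y) ∧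
      ∃ CC, TDec G (3 * t) (Y ∪ (Qc G p (f i) ∪ Qc G p (f j))) CC ∧ ∃ B ∈ CC, Qc G p (f i) ∪ Qc G p (f j) ⊆ B := by
  obtain ⟨c, n, hc, Q0, Q1, hZ, hYF, hM, hf⟩ := h.sec hN i0 js hij hi hj hno
  refine ⟨_, hYF, Comp.conn, ?_, hM, fun k k1 k2 => (hf k k1 k2).2, ?_⟩
  · intro v hv w hw
    by_cases hC : w ∈ Qc G p (f i) ∪ Qc G p (f j)
    · exact Or.inr hC
    · exact Or.inl (Comp.closed hv hw hC)
  have hCZ : Qc G p (f i) ∪ Qc G p (f j) ⊆ Z G c := by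
    rw [← Q0, ← Q1]
    rintro v (hv | hv)
    · exact ⟨_, hv⟩
    · exact ⟨_, hv⟩
  have hcomp : ∀ u ∈ Comp G (Qc G p (f i) ∪ Qc G p (f j))ᶜ (f (i+1)) ∪ (Qc G p (f i) ∪ Qc G p (f j)), u ∉ Z G c →
      Comp G (Z G c)ᶜ u ⊆ Comp G (Qc G p (f i) ∪ Qc G p (f j))ᶜ (f (i+1)) := by
    intro u hu huZ
    have hu' := hu.resolve_right (fun hh => huZ (hCZ hh))
    exact Comp.conn.subset_comp (fun v hv hvC => Comp.subset hv (hCZ hvC)) (Comp.self huZ) hu'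
  have := hole_step h.g hN hcl hc hZ (fun u hu huZ v hv => Or.inl (hcomp u hu huZ hv))
    (fun u hu huZ x hx => hole_ind hc hS huZ ?_ x hx)
  · rw [Q0, Q1, Set.union_comm (Qc G p (f j))] at this
    exact this
  · have hsub : insert (f (i+1)) (Comp G (Z G c)ᶜ u) ⊆ F := by
      intro v hv
      rcases hv with rfl | hv
      · exact hYF (hf (i+1) (by omega) (by omega)).2
      · exact hYF (hcomp u hu huZ hv)
    have h1 := Set.ncard_le_ncard hsub (Set.toFinite _)
    rw [Set.ncard_insert_of_notMem (fun hh => (Comp.subset hh : f (i+1) ∈ (Z G c)ᶜ) (hf (i+1) (by omega) (by omega)).1) (Set.toFinite _)] at h1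
    omega

end SSt
end Paper
end

section
open SimpleGraph
namespace Paper
variable {V : Type*}
namespace SSt
variable {G : SimpleGraph V} {p y z : V} {F E : Set V} {f : ℤ → V} {s : ℤ}

lemma noY1 (h : SSt G p y z F E f s) {Y U : Set V} (hYF : Y ⊆ F)
    (hYM : ∀ l, 0 ≤ l → l ≤ s + 1 → G.Adj p (f l) → ∀ v ∈ Qc G p (f l), v ∉ Y)
    (hYf : ∀ k, 0 ≤ k → k ≤ s + 1 → f k ∉ Y) (hUY : U ⊆ Y) (hU : Conn G U) {a b : ℤ}
    (a0 : 0 ≤ a) (bs : b ≤ s + 1) (hab : a + 3 ≤ b) (ha : G.Adj p (f a)) (hb : G.Adj p (f b))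
    (ha1 : ¬ G.Adj p (f (a+1))) (hb1 : ¬ G.Adj p (f (b-1)))
    (hUN : ∀ u ∈ U, ∀ w, G.Adj u w → w ∈ Y ∨ w ∈ Qc G p (f a) ∨ w ∈ Qc G p (f b))
    (hA : ∃ u ∈ U, ∃ x ∈ Mc G p (f a), G.Adj u x) (hB : ∃ u ∈ U, ∃ x ∈ Mc G p (f b), G.Adj u x) : False := by
  have P := h.lp.path
  have hs := h.lp.s2
  obtain ⟨TLc, TLa⟩ := h.TL_main a0 (by omega) ha
  obtain ⟨TRc, TRa⟩ := h.TR_main (by omega) bs hb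
  obtain ⟨e, he, -⟩ := h.EA
  have h3 : ∀ v ∈ TL G p y E f a ∪ TR G p z E f s b, NZ G p f a b v := by
    rintro v (hv | hv)
    · exact h.TL_NZ a0 bs hab ha hb hv
    · exact h.TR_NZ a0 bs hab ha hb hv
  have h3Y : ∀ v ∈ TL G p y E f a ∪ TR G p z E f s b, v ∉ Y := by
    rintro v ((hv | ⟨hv | ⟨k, k1, k2, rfl⟩, -⟩) | (hv | ⟨hv | ⟨k, k1, k2, rfl⟩, -⟩)) hvY
    · exact h.EF v hv (hYF hvY)
    · exact (h.Fd v (hYF hvY)).1 hv.1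
    · exact hYf k k1 (by omega) hvY
    · exact h.EF v hv (hYF hvY)
    · exact (h.Fd v (hYF hvY)).2 hv.1
    · exact hYf k (by omega) k2 hvY
  have h2 : ∀ k, a < k → k < b → f k ∉ Qc G p (f a) ∧ f k ∉ Qc G p (f b) := by
    intro k k1 k2
    refine ⟨fun hk => ?_, fun hk => ?_⟩
    · have := h.fM (by omega) (by omega) (by omega) (by omega) hk
      obtain rfl : k = a + 1 := by omega
      exact ha1 this.1
    · have := h.fM (by omega) (by omega) (by omega) (by omega) hk
      obtain rfl : k = b - 1 := by omega
      exact hb1 this.1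
  refine threeC h.g ha hb ?_ ?_ (U1 := U) (U2 := f '' Set.Icc (a+1) (b-1)) (U3 := TL G p y E f a ∪ TR G p z E f s b)
    hU (IPath.conn (P.sub (by omega) (by omega))) (TLc.union TRc ⟨e, Or.inl he, e, Or.inl he, Or.inl rfl⟩)
    ?_ ?_ ?_ ?_ ?_ ?_ hA hB ?_ ?_ ?_ ?_
  · intro e; have := P.inj (by omega) (by omega) (by omega) (by omega) e; omega
  · rw [P.adj (by omega) (by omega) (by omega) (by omega)]; omega
  · exact fun u hu => ⟨fun hh => hYM a a0 (by omega) ha u hh (hUY hu), fun hh => hYM b (by omega) bs hb u hh (hUY hu)⟩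
  · rintro _ ⟨k, ⟨k1, k2⟩, rfl⟩
    exact h2 k (by omega) (by omega)
  · exact fun v hv => ⟨(h3 v hv).2.2.1, (h3 v hv).2.2.2.1⟩
  · rintro u hu _ ⟨k, ⟨k1, k2⟩, rfl⟩
    refine ⟨?_, fun hh => ?_⟩
    · rintro rfl; exact hYf k (by omega) (by omega) (hUY hu)
    · rcases hUN u hu _ hh with e | e | e
      · exact hYf k (by omega) (by omega) e
      · exact (h2 k (by omega) (by omega)).1 e
      · exact (h2 k (by omega) (by omega)).2 e
  · intro u hu v hv
    refine ⟨?_, fun hh => ?_⟩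
    · rintro rfl; exact h3Y u hv (hUY hu)
    · rcases hUN u hu _ hh with e | e | e
      · exact h3Y v hv e
      · exact (h3 v hv).2.2.1 e
      · exact (h3 v hv).2.2.2.1 e
  · rintro _ ⟨k, ⟨k1, k2⟩, rfl⟩ v hv
    exact ⟨((h3 v hv).2.1 k (by omega) (by omega)).symm, fun hh => (h3 v hv).2.2.2.2 k (by omega) (by omega) hh.symm⟩
  · exact ⟨f (a+1), ⟨_, ⟨le_rfl, by omega⟩, rfl⟩, f a, ⟨Qc.right ha, h.pf a (by omega) (by omega)⟩,
      (P.adj (by omega) (by omega) (by omega) (by omega)).2 (by omega)⟩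
  · exact ⟨f (b-1), ⟨_, ⟨by omega, by omega⟩, rfl⟩, f b, ⟨Qc.right hb, h.pf b (by omega) (by omega)⟩,
      (P.adj (by omega) (by omega) (by omega) (by omega)).2 (by omega)⟩
  · obtain ⟨u, hu, x⟩ := TLa; exact ⟨u, Or.inl hu, x⟩
  · obtain ⟨u, hu, x⟩ := TRa; exact ⟨u, Or.inr hu, x⟩

lemma Mstep (h : SSt G p y z F E f s) {a b : ℤ} (a0 : 0 ≤ a) (as : a ≤ s + 1) (b0 : 0 ≤ b) (bs : b ≤ s + 1)
    (hab : b = a + 1 ∨ a = b + 1) (ha : G.Adj p (f a)) (hb : G.Adj p (f b)) : Qc G p (f b) = Qc G p (f a) :=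
  h.Meq a0 as b0 bs ha ⟨Or.inr hb.symm, Or.inr ((h.lp.path.adj b0 bs a0 as).2 (by omega))⟩

lemma noY2 (h : SSt G p y z F E f s) {Y U : Set V} (hYF : Y ⊆ F)
    (hYM : ∀ l, 0 ≤ l → l ≤ s + 1 → G.Adj p (f l) → ∀ v ∈ Qc G p (f l), v ∉ Y)
    (hYf : ∀ k, 0 ≤ k → k ≤ s + 1 → f k ∉ Y) (hUY : U ⊆ Y) (hU : Conn G U) {a b : ℤ}
    (a0 : 0 ≤ a) (as : a ≤ s + 1) (b0 : 0 ≤ b) (bs : b ≤ s + 1)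
    (hM : Qc G p (f a) ≠ Qc G p (f b)) (ha : G.Adj p (f a)) (hb : G.Adj p (f b))
    (hUN : ∀ u ∈ U, ∀ w, G.Adj u w → w ∈ Y ∨ w ∈ Qc G p (f a) ∨ w ∈ Qc G p (f b))
    (hA : ∃ u ∈ U, ∃ x ∈ Mc G p (f a), G.Adj u x) (hB : ∃ u ∈ U, ∃ x ∈ Mc G p (f b), G.Adj u x) : False := by
  wlog hab : a < b generalizing a b
  · refine this b0 bs a0 as hM.symm hb ha (fun u hu w hw => (hUN u hu w hw).imp_right Or.symm) hB hA ?_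
    by_contra hc
    obtain rfl : a = b := by omega
    exact hM rfl
  have hab2 : a + 1 < b := by
    by_contra hc
    exact hM (h.Mstep a0 as b0 bs (by omega) ha hb).symm
  obtain ⟨a', a1, a2, a3, a4, a5⟩ : ∃ a', a ≤ a' ∧ a' ≤ a + 1 ∧ G.Adj p (f a') ∧ ¬ G.Adj p (f (a'+1)) ∧
      Qc G p (f a') = Qc G p (f a) := by
    by_cases e : G.Adj p (f (a+1))
    · refine ⟨a+1, by omega, le_rfl, e, fun hh => ?_, h.Mstep a0 as (by omega) (by omega) (by omega) ha e⟩
      rw [show a + 1 + 1 = a + 2 by ring] at hh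
      exact h.I2 a0 (by omega) ha hh
    · exact ⟨a, le_rfl, by omega, ha, e, rfl⟩
  obtain ⟨b', b1, b2, b3, b4, b5⟩ : ∃ b', b - 1 ≤ b' ∧ b' ≤ b ∧ G.Adj p (f b') ∧ ¬ G.Adj p (f (b'-1)) ∧
      Qc G p (f b') = Qc G p (f b) := by
    by_cases e : G.Adj p (f (b-1))
    · refine ⟨b-1, by omega, by omega, e, fun hh => ?_, h.Mstep b0 bs (by omega) (by omega) (by omega) hb e⟩
      refine h.I2 (i := b-1-1) (by omega) (by omega) hh ?_
      rwa [show b - 1 - 1 + 2 = b by ring]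
    · exact ⟨b, by omega, le_rfl, hb, e, rfl⟩
  have hne : a' ≠ b' := by
    rintro rfl; exact hM (a5.symm.trans b5)
  have h3 : a' + 3 ≤ b' := by
    rcases h.I3 (i := a') (j := b') (by omega) (by omega) (by omega) a3 b3 with e | e
    · exfalso
      have := h.Mstep (a := a') (b := b') (by omega) (by omega) (by omega) (by omega) (Or.inl e) a3 b3
      rw [a5, b5] at this
      exact hM this.symm
    · exact e
  refine h.noY1 hYF hYM hYf hUY hU (a := a') (b := b') (by omega) (by omega) h3 a3 b3 a4 b4 ?_ ?_ ?_
  · rw [a5, b5]; exact hUN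
  · rw [Mc, a5]; exact hA
  · rw [Mc, b5]; exact hB

lemma noY (h : SSt G p y z F E f s) (hN : NCC G) {Y : Set V} (hYc : Conn G Y) (hY0 : Y.Nonempty) (hYF : Y ⊆ F)
    (hYM : ∀ l, 0 ≤ l → l ≤ s + 1 → G.Adj p (f l) → ∀ v ∈ Qc G p (f l), v ∉ Y)
    (hYN : ∀ u ∈ Y, ∀ w, G.Adj u w → w ∈ Y ∨ ∃ l, 0 ≤ l ∧ l ≤ s + 1 ∧ G.Adj p (f l) ∧ w ∈ Qc G p (f l))
    (hYf : ∀ k, 0 ≤ k → k ≤ s + 1 → f k ∉ Y) : False := by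
  obtain ⟨e, he, -⟩ := h.EA
  have heY : e ∉ Y := fun hh => h.EF e he (hYF hh)
  have hpY : p ∉ Y := fun hh => h.pF (hYF hh)
  have hep : e ≠ p := by rintro rfl; exact (h.Ed e he).1 (Qc.left h.hy)
  obtain ⟨y0, hy0⟩ := hY0
  obtain ⟨u, hu, w, hw1, hw2, huw⟩ := hN.att (K := {p}) (F := Y) (by rintro x rfl y rfl hne; exact absurd rfl hne) hy0
    (by rintro x hx rfl; exact hpY hx) heY hep
  obtain ⟨a, a0, as, ha, hwa⟩ := (hYN u hu w huw).resolve_left hw1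
  have hea : e ∉ Qc G p (f a) := by
    intro hh
    rcases h.MX a0 as hh with r | r | r
    · exact h.EF e he r
    · exact (h.Ed e he).1 r
    · exact (h.Ed e he).2 r
  obtain ⟨u', hu', w', hw1', hw2', huw'⟩ := hN.att (K := Qc G p (f a)) (F := Y) (h.g.clique ha) hy0
    (fun x hx hh => hYM a a0 as ha x hh hx) heY hea
  obtain ⟨m, hm⟩ := hYc u hu u' hu'
  obtain ⟨r, q, r1, hq, hqY, PA, PB, -⟩ := SP (fun u => ∃ x ∈ Mc G p (f a), G.Adj u x)
    (fun u => ∃ w, w ∉ Y ∧ w ∉ Qc G p (f a) ∧ G.Adj u w) hm ⟨w, ⟨hwa, hw2⟩, huw⟩ ⟨w', hw1', hw2', huw'⟩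
  obtain ⟨v, hv1, hv2, hv3⟩ := (PB r r1 le_rfl).2 rfl
  obtain ⟨b, b0, bs, hb, hvb⟩ := (hYN _ (hqY r r1 le_rfl) v hv3).resolve_left hv1
  have hvp : v ≠ p := by rintro rfl; exact hv2 (Qc.left ha)
  refine h.noY2 hYF hYM hYf (U := q '' Set.Icc 1 r) (a := a) (b := b) ?_ hq.conn a0 as b0 bs ?_ ha hb ?_ ?_ ?_
  · rintro _ ⟨k, ⟨k1, k2⟩, rfl⟩; exact hqY k k1 k2
  · intro e; rw [e] at hv2; exact hv2 hvb
  · rintro _ ⟨k, ⟨k1, k2⟩, rfl⟩ x hx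
    by_cases hxY : x ∈ Y
    · exact Or.inl hxY
    by_cases hxa : x ∈ Qc G p (f a)
    · exact Or.inr (Or.inl hxa)
    right; right
    have hk := (PB k k1 k2).1 ⟨x, hxY, hxa, hx⟩
    subst hk
    obtain ⟨d, d0, ds, hd, hxd⟩ := (hYN _ (hqY k k1 k2) x hx).resolve_left hxY
    have hxp : x ≠ p := by rintro rfl; exact hxa (Qc.left ha)
    by_cases e1 : f b = f d
    · rw [e1]; exact hxd
    by_cases e2 : G.Adj (f b) (f d)
    · rw [← h.Meq b0 bs d0 ds hb ⟨Or.inr hd.symm, Or.inr e2.symm⟩]; exact hxd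
    exfalso
    have := h.g.Mc_both hb hd e1 e2 ⟨hvb, hvp⟩ ⟨hxd, hxp⟩ hv3 hx
    exact hpY (this ▸ hqY k k1 k2)
  · obtain ⟨x, hx⟩ := (PA 1 le_rfl r1).2 rfl
    exact ⟨q 1, ⟨1, ⟨le_rfl, r1⟩, rfl⟩, x, hx⟩
  · exact ⟨q r, ⟨r, ⟨r1, le_rfl⟩, rfl⟩, v, ⟨hvb, hvp⟩, hv3⟩

end SSt
end Paper
end

section
open SimpleGraph
namespace Paper
variable {V : Type*}
namespace SSt
variable {G : SimpleGraph V} {p y z : V} {F E : Set V} {f : ℤ → V} {s : ℤ}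

lemma dec [Finite V] (h : SSt G p y z F E f s) (hN : NCC G) {t N : ℕ}
    (hcl : ∀ K : Set V, (∀ x ∈ K, ∀ y ∈ K, x ≠ y → G.Adj x y) → K.ncard ≤ t)
    (hS : StateOK G t N) (hF : F.ncard ≤ N + 1) :
    ∃ CC, TDec G (3 * t) (F ∪ (Qc G p y ∪ Qc G p z)) CC ∧ ∃ B ∈ CC, Qc G p y ∪ Qc G p z ⊆ B := by
  have hs := h.lp.s2
  have hlam : ∀ k : ℕ, ∃ x : ℤ, 0 ≤ x ∧ x ≤ k ∧ G.Adj p (f x) ∧ ∀ z, x < z → z ≤ k → ¬ G.Adj p (f z) := by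
    intro k
    obtain ⟨x, h1, h2, h3, h4⟩ := exists_max_int (P := fun x => G.Adj p (f x)) (i := 0) (j := (k : ℤ)) (x := 0) le_rfl (by omega) h.I0
    exact ⟨x, h1, h2, h3, h4⟩
  choose lam l0 lk la ln using hlam
  have luniq : ∀ (k : ℕ) (x : ℤ), x ≤ k → G.Adj p (f x) → (∀ z, x < z → z ≤ k → ¬ G.Adj p (f z)) → lam k = x := by
    intro k x x1 x2 x3
    have a1 : ¬ lam k < x := fun hh => ln k x hh x1 x2
    have a2 : ¬ x < lam k := fun hh => x3 _ hh (lk k) (la k)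
    omega
  have lself : ∀ (k : ℕ), G.Adj p (f k) → lam k = k := fun k hk => luniq k k le_rfl hk (fun z z1 z2 => by omega)
  obtain ⟨m, hm⟩ : ∃ m : ℕ, (m : ℤ) = s + 1 := ⟨(s+1).toNat, by omega⟩
  obtain ⟨BB, hT, hB⟩ := TDec.chain (G := G) (t := t) (fun k : ℕ => Qc G p (f (lam k))) m (by omega)
    (fun k _ => hcl _ (h.g.clique (la k)))
    (by
      rintro i k hik hk v ⟨v1, v2⟩
      by_cases hv : v = p
      · subst hv; exact Or.inl (Qc.left (la 0))
      have b1 := lk i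
      have b2 := lk (k+1)
      push_cast at b2
      have := l0 i
      have := l0 (k+1)
      have hM := (h.Mlink (l0 i) (by omega) (l0 (k+1)) (by omega) (la i) (la (k+1)) ⟨v1, hv⟩ ⟨v2, hv⟩ (Or.inl rfl)).2
      right
      by_cases hc : lam (k+1) ≤ k
      · have : lam k = lam (k+1) := luniq k _ hc (la _) (fun z z1 z2 => ln (k+1) z z1 (by push_cast; omega))
        rw [this]; exact v2
      · have e : lam i = k := by omega
        have e2 := la i
        rw [e] at e2
        rw [lself k e2, ← e]; exact v1)
    (by
      intro i k hik hk x hx w hw hxw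
      by_cases hxp : x = p
      · subst hxp; exact Or.inl (Or.inl (Or.inl (Qc.left (la 0))))
      by_cases hwp : w = p
      · subst hwp; exact Or.inr ⟨0, by omega, Qc.left (la 0)⟩
      have b1 := lk i
      have b2 := lk (k+1)
      push_cast at b2
      have hM := (h.Mlink (l0 i) (by omega) (l0 (k+1)) (by omega) (la i) (la (k+1)) ⟨hx, hxp⟩ ⟨hw, hwp⟩ (Or.inr hxw)).1
      right
      refine ⟨i, hik, ?_⟩
      rw [hM]; exact hw)
  have hX : ∀ v, v ∈ {v | ∃ k, k ≤ m ∧ v ∈ Qc G p (f (lam k))} ↔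
      ∃ l, 0 ≤ l ∧ l ≤ s + 1 ∧ G.Adj p (f l) ∧ v ∈ Qc G p (f l) := by
    intro v
    constructor
    · rintro ⟨k, hk, hv⟩
      have := lk k
      exact ⟨lam k, l0 k, by omega, la k, hv⟩
    · rintro ⟨l, h1, h2, h3, h4⟩
      obtain ⟨k, rfl⟩ : ∃ k : ℕ, l = k := ⟨l.toNat, by omega⟩
      refine ⟨k, by omega, ?_⟩
      rw [lself k h3]; exact h4
  generalize {v | ∃ k, k ≤ m ∧ v ∈ Qc G p (f (lam k))} = X at hT hX
  have hCX : Qc G p y ∪ Qc G p z ⊆ X := by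
    rintro v (hv | hv)
    · exact (hX v).2 ⟨0, le_rfl, by omega, h.I0, by rw [h.M0]; exact hv⟩
    · exact (hX v).2 ⟨s+1, by omega, by omega, h.Is, by rw [h.Ms]; exact hv⟩
  have hXU : X ⊆ F ∪ (Qc G p y ∪ Qc G p z) := by
    intro v hv
    obtain ⟨l, h1, h2, h3, h4⟩ := (hX v).1 hv
    exact h.MX h1 h2 h4
  have hUF : ∀ v, v ∈ (F ∪ (Qc G p y ∪ Qc G p z)) \ X → v ∈ F := fun v hv =>
    hv.1.resolve_right (fun hh => hv.2 (hCX hh))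
  obtain ⟨BB', hBB, hT'⟩ := TDec.hang (U := F ∪ (Qc G p y ∪ Qc G p z)) _ X BB le_rfl hT hXU (by
    intro u hu
    have hYN : ∀ v ∈ Comp G ((F ∪ (Qc G p y ∪ Qc G p z)) \ X) u, ∀ w, G.Adj v w →
        w ∈ Comp G ((F ∪ (Qc G p y ∪ Qc G p z)) \ X) u ∨ w ∈ X := by
      intro v hv w hw
      by_cases hwX : w ∈ X
      · exact Or.inr hwX
      · exact Or.inl (Comp.closed hv hw ⟨h.FN v (hUF v (Comp.subset hv)) w hw, hwX⟩)
    by_cases hf : ∃ k, 0 ≤ k ∧ k ≤ s + 1 ∧ f k ∈ Comp G ((F ∪ (Qc G p y ∪ Qc G p z)) \ X) u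
    · obtain ⟨k, k0, ks, hk⟩ := hf
      obtain ⟨k, rfl⟩ : ∃ k' : ℕ, k = k' := ⟨k.toNat, by omega⟩
      have hkX : f k ∉ X := (Comp.subset hk).2
      have hkp : ¬ G.Adj p (f k) := fun hh => hkX ((hX _).2 ⟨k, k0, ks, hh, Qc.right hh⟩)
      obtain ⟨j, j1, j2, j3, j4⟩ := exists_min_int (P := fun x => G.Adj p (f x)) (i := (k : ℤ)) (x := s + 1) ks h.Is
      have jk : (k : ℤ) ≠ j := by intro e; rw [← e] at j3; exact hkp j3
      have ik : lam k ≠ k := by intro e; have := la k; rw [e] at this; exact hkp this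
      have := lk k
      have := l0 k
      have hno : ∀ x, lam k < x → x < j → ¬ G.Adj p (f x) := by
        intro x x1 x2
        by_cases hx : x ≤ k
        · exact ln k x x1 hx
        · exact j4 x (by omega) x2
      have h3 : lam k + 3 ≤ j := by
        rcases h.I3 (l0 k) j2 (by omega) (la k) j3 with e | e <;> omega
      obtain ⟨Y, hYF, hYc, hYN', hYM, hYf, CC, hCC, hCB⟩ := h.sec_dec hN hcl hS hF (l0 k) j2 h3 (la k) j3 hno
      have hYX : Y ⊆ (F ∪ (Qc G p y ∪ Qc G p z)) \ X := by
        intro v hv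
        refine ⟨Or.inl (hYF hv), fun hh => ?_⟩
        obtain ⟨l, h1, h2, h3, h4⟩ := (hX v).1 hh
        exact hYM l h1 h2 h3 v h4 hv
      have hMX : Qc G p (f (lam k)) ∪ Qc G p (f j) ⊆ X := by
        rintro v (hv | hv)
        · exact (hX v).2 ⟨_, l0 k, by omega, la k, hv⟩
        · exact (hX v).2 ⟨_, by omega, j2, j3, hv⟩
      have hkY : f k ∈ Y := hYf k (by omega) (by omega)
      have e : Y = Comp G ((F ∪ (Qc G p y ∪ Qc G p z)) \ X) u := by
        refine (hYc.subset_comp hYX hkY hk).antisymm ?_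
        intro v hv
        by_contra hvY
        obtain ⟨m, hm⟩ := Comp.conn _ hk _ hv
        obtain ⟨a, b, h1, h2, h3, h4, h5⟩ := hm.exit hkY hvY
        rcases hYN' a h1 b h5 with e | e
        · exact h3 e
        · exact (Comp.subset h4).2 (hMX e)
      refine ⟨Qc G p (f (lam k)) ∪ Qc G p (f j), ?_, ?_, CC, ?_, hCB⟩
      · obtain ⟨j', hj'⟩ : ∃ j' : ℕ, j = (j' : ℤ) + 1 := ⟨(j-1).toNat, by omega⟩
        refine ⟨_, hB j' (by omega), ?_⟩
        have e1 : lam j' = lam k := luniq j' _ (by omega) (la k) (fun z z1 z2 => hno z z1 (by omega))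
        have e2 : lam (j'+1) = j := by
          rw [lself (j'+1) (by push_cast; rw [← hj']; exact j3)]; push_cast; omega
        rw [e1, e2]
        rintro v (hv | hv)
        · exact Or.inl (Or.inr hv)
        · exact Or.inr hv
      · rw [← e]
        intro v hv w hw hvw
        rcases hYN' v hv w hvw with e | e
        · exact absurd hw (hYX e).2
        · exact e
      · rw [← e]; exact hCC
    · exfalso
      push Not at hf
      refine h.noY hN Comp.conn ⟨u, Comp.self hu⟩ (fun v hv => hUF v (Comp.subset hv)) ?_ ?_ hf
      · intro l h1 h2 h3 v hv hvY
        exact (Comp.subset hvY).2 ((hX v).2 ⟨l, h1, h2, h3, hv⟩)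
      · intro v hv w hw
        exact (hYN v hv w hw).imp_right (hX w).1)
  refine ⟨BB', hT', ?_⟩
  obtain ⟨k, hk⟩ : ∃ k : ℕ, s = k := ⟨s.toNat, by omega⟩
  refine ⟨_, hBB (hB k (by omega)), ?_⟩
  have e0 : lam 0 = 0 := by
    have := lself 0 (by simpa using h.I0); simpa using this
  have e1 : lam (k+1) = s + 1 := by
    rw [lself (k+1) (by push_cast; rw [← hk]; exact h.Is)]; push_cast; omega
  rw [e0, e1, h.M0, h.Ms]
  rintro v (hv | hv)
  · exact Or.inl (Or.inl hv)
  · exact Or.inr hv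

end SSt

lemma state [Finite V] {G : SimpleGraph V} (g : Good G) (hN : NCC G) {t : ℕ}
    (hcl : ∀ K : Set V, (∀ x ∈ K, ∀ y ∈ K, x ≠ y → G.Adj x y) → K.ncard ≤ t) : ∀ N, StateOK G t N := by
  intro N
  induction N with
  | zero =>
    intro p y z F E _ _ _ _ _ h1 _ _ _ _ _ _ _ h2
    rw [Nat.le_zero, Set.ncard_eq_zero (Set.toFinite _)] at h2
    rw [h2] at h1
    exact absurd h1 Set.not_nonempty_empty
  | succ N ih =>
    intro p y z F E hy hz hne hn Fc F0 Fd FN Ec E0 Ed EN EF hF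
    obtain ⟨x, hx⟩ := F0
    obtain ⟨e, he⟩ := E0
    have FA : ∃ u ∈ F, ∃ a ∈ Mc G p y, G.Adj u a := by
      obtain ⟨u, hu, w, w1, w2, w3⟩ := hN.att (g.clique hz) hx (fun v hv => (Fd v hv).2) (EF e he) (Ed e he).2
      refine ⟨u, hu, w, ⟨((FN u hu w w3).resolve_left w1).resolve_right w2, ?_⟩, w3⟩
      rintro rfl; exact w2 (Qc.left hz)
    have FB : ∃ u ∈ F, ∃ a ∈ Mc G p z, G.Adj u a := by
      obtain ⟨u, hu, w, w1, w2, w3⟩ := hN.att (g.clique hy) hx (fun v hv => (Fd v hv).1) (EF e he) (Ed e he).1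
      refine ⟨u, hu, w, ⟨((FN u hu w w3).resolve_left w1).resolve_left w2, ?_⟩, w3⟩
      rintro rfl; exact w2 (Qc.left hy)
    have xE : x ∉ E := fun hh => EF x hh hx
    have EA : ∃ u ∈ E, ∃ a ∈ Mc G p y, G.Adj u a := by
      obtain ⟨u, hu, w, w1, w2, w3⟩ := hN.att (g.clique hz) he (fun v hv => (Ed v hv).2) xE (Fd x hx).2
      refine ⟨u, hu, w, ⟨((EN u hu w w3).resolve_left w1).resolve_right w2, ?_⟩, w3⟩
      rintro rfl; exact w2 (Qc.left hz)
    have EB : ∃ u ∈ E, ∃ a ∈ Mc G p z, G.Adj u a := by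
      obtain ⟨u, hu, w, w1, w2, w3⟩ := hN.att (g.clique hy) he (fun v hv => (Ed v hv).1) xE (Fd x hx).1
      refine ⟨u, hu, w, ⟨((EN u hu w w3).resolve_left w1).resolve_left w2, ?_⟩, w3⟩
      rintro rfl; exact w2 (Qc.left hy)
    obtain ⟨f, s, hlp, hmin⟩ := link_path g hy hz hne hn Fc Fd FA FB
    exact SSt.dec (E := E) ⟨g, hy, hz, hne, hn, Fd, FN, Ec, Ed, EN, EF, EA, EB, hlp, hmin⟩ hN hcl ih hF

end Paper
end

section
open SimpleGraph
namespace Paper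
variable {V : Type*}

lemma init_hub {G : SimpleGraph V} (g : Good G) {p : V} {s : ℤ} {q : ℤ → V} (hq : IPath G q 1 s)
    (hX : ∀ k, 1 ≤ k → k ≤ s → q k ∈ ({p}ᶜ : Set V))
    (hmin : ∀ m : ℕ, Wk G ({p}ᶜ : Set V) m (q 1) (q s) → s ≤ m + 1)
    {v : V} {x y : ℤ} (hv : v ≠ p) (hvq : ∀ z, 1 ≤ z → z ≤ s → v ≠ q z) (x1 : 1 ≤ x) (hxy : x ≤ y) (ys : y ≤ s)
    (hx : G.Adj v (q x)) (hy : G.Adj v (q y)) : q x = q y ∨ G.Adj (q x) (q y) := by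
  by_cases e0 : y = x
  · left; rw [e0]
  by_cases e1 : y = x + 1
  · right; exact (hq x y x1 (by omega) (by omega) ys).1.2 (by omega)
  exfalso
  by_cases e2 : y = x + 2
  · have a1 := (hq x (x+1) x1 (by omega) (by omega) (by omega)).1.2 (by omega)
    have a2 := (hq y (x+1) (by omega) ys (by omega) (by omega)).1.2 (by omega)
    exact hvq (x+1) (by omega) (by omega) (g.K (q x) (q y) v (q (x+1))
      (fun e => e0 ((hq x y x1 (by omega) (by omega) ys).2 e).symm)
      (fun h => by have := (hq x y x1 (by omega) (by omega) ys).1.1 h; omega)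
      hx.symm hy.symm a1 a2)
  have w1 := hq.wk hX (x := 1) (y := x) le_rfl x1 (by omega)
  have w2 := hq.wk hX (x := y) (y := s) (by omega) ys le_rfl
  have w := (w1.snoc hx.symm (show v ∈ ({p}ᶜ : Set V) from hv)).trans
    (Wk.cons (show v ∈ ({p}ᶜ : Set V) from hv) hy w2)
  have := hmin _ w
  push_cast at this
  omega

lemma main_ncc [Finite V] {G : SimpleGraph V} (g : Good G) (hN : NCC G) {t : ℕ}
    (hcl : ∀ K : Set V, (∀ x ∈ K, ∀ y ∈ K, x ≠ y → G.Adj x y) → K.ncard ≤ t) :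
    ∃ BB, TDec G (3 * t) Set.univ BB := by
  by_cases hc : ∃ p y z, G.Adj p y ∧ G.Adj p z ∧ y ≠ z ∧ ¬ G.Adj y z
  swap
  · push Not at hc
    refine ⟨_, TDec.single _ ?_⟩
    have := hcl Set.univ (fun x _ y _ hne => by
      obtain ⟨m, hm⟩ := hN ∅ (by simp) x y (by simp) (by simp)
      have key : ∀ m x y, Wk G (∅ᶜ : Set V) m x y → x = y ∨ G.Adj x y := by
        intro m x y h
        induction h with
        | nil _ => exact Or.inl rfl
        | @cons m x y z _ ha _ ih =>
          rcases ih with rfl | ih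
          · exact Or.inr ha
          · by_cases e : x = z
            · exact Or.inl e
            · exact Or.inr (hc y x z ha.symm ih e)
      exact (key m x y hm).resolve_left hne)
    omega
  obtain ⟨p, y, z, hy, hz, hne, hn⟩ := hc
  obtain ⟨m, hm⟩ := hN {p} (by rintro x rfl y rfl h; exact absurd rfl h) y z hy.ne' hz.ne'
  obtain ⟨s, q, s1, hq, hX, hA, hB, hmin⟩ := SP (fun v => v ∈ Qc G p y ∧ v ≠ p)
    (fun v => G.Adj p v ∧ v ∉ Qc G p y) hm ⟨Qc.right hy, hy.ne'⟩
    ⟨hz, fun h => hn (g.clique hy _ (Qc.right hy) _ h hne)⟩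
  have A1 := (hA 1 le_rfl s1).2 rfl
  have B1 := (hB s s1 le_rfl).2 rfl
  have p1 : G.Adj p (q 1) := g.Qc_adj hy A1.1 A1.2
  have hns : ¬ G.Adj (q s) (q 1) := fun h => B1.2 (g.absorb hy A1.1 (Qc.left hy) A1.2 h B1.1.symm)
  have hs1 : s ≠ 1 := by rintro rfl; exact B1.2 A1.1
  have hs2 : s ≠ 2 := fun e => hns ((hq s 1 s1 le_rfl le_rfl s1).1.2 (by omega))
  have hs3 : s ≠ 3 := by
    intro e
    have a1 := (hq 1 2 le_rfl s1 (by omega) (by omega)).1.2 (by omega)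
    have a2 := (hq s 2 s1 le_rfl (by omega) (by omega)).1.2 (by omega)
    exact hX 2 (by omega) (by omega) (g.K (q s) (q 1) (q 2) p
      (fun e' => hs1 ((hq s 1 s1 le_rfl le_rfl s1).2 e')) hns a2 a1 B1.1.symm p1.symm)
  obtain ⟨c, hc, -, -⟩ := hf_of_path' g (i := 1) (j := s) (p := p) (f := q) (by omega) hq
    (fun k k1 k2 e => hX k k1 k2 e.symm)
    (fun k k1 k2 => ⟨fun h => by
      by_cases hk : q k ∈ Qc G p y
      · exact Or.inl ((hA k k1 k2).1 ⟨hk, h.ne'⟩)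
      · exact Or.inr ((hB k k1 k2).1 ⟨h, hk⟩), by
      rintro (rfl | rfl)
      · exact p1
      · exact B1.1⟩)
    (fun v x w hv hvq x1 x2 w1 w2 hx hw => by
      have hm' : ∀ m : ℕ, Wk G ({p}ᶜ : Set V) m (q 1) (q s) → s ≤ m + 1 := fun m h => hmin m _ _ A1 B1 h
      rcases le_total x w with h | h
      · exact init_hub g hq hX hm' hv hvq x1 h w2 hx hw
      · rcases init_hub g hq hX hm' hv hvq w1 h x2 hw hx with e | e
        · exact Or.inl e.symm
        · exact Or.inr e.symm)
  obtain ⟨BB, hBB, -⟩ := hole_step g hN hcl hc (U := Set.univ) (Set.subset_univ _)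
    (fun _ _ _ => Set.subset_univ _)
    (fun u _ hu i hatt => hole_ind hc (state g hN hcl _) hu le_rfl i hatt)
  exact ⟨BB, hBB⟩

lemma main_all (t : ℕ) : ∀ (n : ℕ) (V : Type) [Finite V] (G : SimpleGraph V), Nat.card V ≤ n → Good G →
    (∀ K : Set V, (∀ x ∈ K, ∀ y ∈ K, x ≠ y → G.Adj x y) → K.ncard ≤ t) →
    ∃ BB, TDec G (3 * t) Set.univ BB := by
  intro n
  induction n with
  | zero =>
    intro V _ G hV g hcl
    refine ⟨_, TDec.single _ ?_⟩
    rw [Set.ncard_univ]; omega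
  | succ n ih =>
    intro V _ G hV g hcl
    by_cases hN : NCC G
    · exact main_ncc g hN hcl
    unfold NCC at hN
    push Not at hN
    obtain ⟨K, hK, x, y, hx, hy, hxy⟩ := hN
    have ih' : ∀ S : Set V, (∃ v, v ∉ S) → ∃ BB, TDec G (3 * t) S BB := by
      rintro S ⟨v, hv⟩
      have hcard : Nat.card S < Nat.card V := by
        rw [Nat.card_coe_set_eq, ← Set.ncard_univ]
        exact Set.ncard_lt_ncard ⟨Set.subset_univ _, fun h => hv (h (Set.mem_univ v))⟩ (Set.toFinite _)
      obtain ⟨BB, hBB⟩ := ih S (G.induce S) (by omega) (g.induce S) (fun L hL => by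
        rw [← Set.ncard_image_of_injective L Subtype.val_injective]
        refine hcl _ ?_
        rintro _ ⟨a, ha, rfl⟩ _ ⟨b, hb, rfl⟩ hab
        exact hL a ha b hb (fun e => hab (by rw [e])))
      have := hBB.lift
      rw [Set.image_univ, Subtype.range_coe] at this
      exact ⟨_, this⟩
    have hyC : y ∉ Comp G Kᶜ x := fun ⟨m, hm⟩ => hxy m hm
    have hxC : x ∈ Comp G Kᶜ x := Comp.self hx
    obtain ⟨B1, h1⟩ := ih' (K ∪ Comp G Kᶜ x) ⟨y, fun h => h.elim hy hyC⟩
    obtain ⟨B2, h2⟩ := ih' (Comp G Kᶜ x)ᶜ ⟨x, fun h => h hxC⟩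
    obtain ⟨b1, hb1, hb1'⟩ := h1.clique hK Set.subset_union_left
    obtain ⟨b2, hb2, hb2'⟩ := h2.clique hK (fun k hk h => Comp.subset h hk)
    have hin : (K ∪ Comp G Kᶜ x) ∩ (Comp G Kᶜ x)ᶜ ⊆ K := fun v hv => hv.1.resolve_right hv.2
    have := TDec.glue h1 h2 hb1 hb2 (hin.trans hb1') (hin.trans hb2') (by
      intro a _ ha b hb hb' hab
      exact hb (Comp.closed (not_not.1 ha) hab (fun h => hb' (Or.inl h))))
    refine ⟨_, (?_ : (K ∪ Comp G Kᶜ x) ∪ (Comp G Kᶜ x)ᶜ = Set.univ) ▸ this⟩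
    rw [Set.union_assoc, Set.union_compl_self, Set.union_univ]

end Paper
end

section
open SimpleGraph
namespace Paper

theorem statement2 (t : ℕ) (ht : 0 < t) :
    ∃ c : ℤ, ∀ (V : Type) [Fintype V] (G : SimpleGraph V),
      InC G → cliqueNum G ≤ t → (treewidth G : ℤ) ≤ c := by
  refine ⟨((3 * t : ℕ) : ℤ), ?_⟩
  intro V _ G hG hw
  obtain ⟨BB, hBB⟩ := main_all t _ V G le_rfl hG.good (fun K hK => by
    refine le_trans ?_ hw
    refine le_csSup ⟨Nat.card V, ?_⟩ ⟨K, fun x hx y hy h => hK x hx y hy h, rfl⟩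
    rintro n ⟨S, -, rfl⟩
    exact Set.ncard_le_card S)
  exact_mod_cast hBB.tw

end Paper
end
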